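/- (First link) Let X ⊂ ℙ³ be a smooth cubic surface and a a positive integer. Assume that the ideal I_{Z_{m(a)},X} ⊂ R_X of a general set of m(a) = (3/2)a(a−1) + a points on X has graded minimal free resolution over R given by 0 → R(−a−3)^{a−1} → R(−a−1)^{3a} → R(−a)^{2a+1} → I_{Z_{m(a)},X} → 0. Then the ideal I_{Z_{n(a)},X} ⊂ R_X of a general set of n(a) = (3/2)a(a−1) + 2a points on X has graded minimal free resolution over R given by 0 → R(−a−3)^{2a−1} → R(−a−2)^{3a} → R(−a)^{a+1} → I_{Z_{n(a)},X} → 0. -/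

import Mathlib

/-!
Common definitions for formalizing "The minimal resolution conjecture for points
on the cubic surface" (arXiv:math/0611137).

We work with `R = k[x₀,x₁,x₂,x₃]`, closed points of `ℙ³` modeled by
`Projectivization k (Fin 4 → k)`, saturated ideals of sets of points as vanishing
ideals, genericity expressed by a nonempty basic open subset of the configuration
space, and graded minimal free resolutions expressed by explicit homogeneous
matrices whose entries have zero constant term (no nonzero scalar entries).
-/

open MvPolynomial

noncomputable section

/-- The polynomial ring `R = k[x₀,x₁,x₂,x₃]` in four variables over `k`. -/
abbrev R4 (k : Type) [Field k] : Type := MvPolynomial (Fin 4) k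

/-- The (closed) points of the projective space `ℙ³` over `k`. -/
abbrev P3 (k : Type) [Field k] : Type := Projectivization k (Fin 4 → k)

variable (k : Type) [Field k]

/-- A polynomial vanishes at a projective point if it vanishes at every
representative vector of that point. -/
def VanishesAt (f : R4 k) (p : P3 k) : Prop :=
  ∀ (v : Fin 4 → k) (hv : v ≠ 0), Projectivization.mk k v hv = p → eval v f = 0

/-- The saturated homogeneous ideal `I_Z ⊆ R` of a set `Z` of (reduced) points of
`ℙ³`: all polynomials vanishing at every point of `Z`. -/
def pointsIdeal (Zs : Set (P3 k)) : Ideal (R4 k) where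
  carrier := {f | ∀ p ∈ Zs, VanishesAt k f p}
  zero_mem' := by
    intro p _ v hv _
    simp
  add_mem' := by
    intro a b ha hb p hp v hv hmk
    have h1 := ha p hp v hv hmk
    have h2 := hb p hp v hv hmk
    simp [h1, h2]
  smul_mem' := by
    intro c a ha p hp v hv hmk
    have h1 := ha p hp v hv hmk
    simp [smul_eq_mul, h1]

/-- An ideal of `R` is homogeneous if it is generated by homogeneous elements. -/
def IsHomogIdeal (I : Ideal (R4 k)) : Prop :=
  ∃ G : Set (R4 k), (∀ g ∈ G, ∃ d : ℕ, g.IsHomogeneous d) ∧ I = Ideal.span G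

/-- Saturation of an ideal with respect to the irrelevant maximal ideal
`(x₀,…,x₃)`. -/
def satIdeal (I : Ideal (R4 k)) : Ideal (R4 k) where
  carrier := {g | ∀ i : Fin 4, ∃ N : ℕ, (X i : R4 k) ^ N * g ∈ I}
  zero_mem' := by
    intro i
    exact ⟨0, by simp⟩
  add_mem' := by
    intro a b ha hb i
    obtain ⟨N, hN⟩ := ha i
    obtain ⟨M, hM⟩ := hb i
    refine ⟨N + M, ?_⟩
    have h1 : (X i : R4 k) ^ (N + M) * (a + b)
        = X i ^ M * (X i ^ N * a) + X i ^ N * (X i ^ M * b) := by ring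
    rw [h1]
    exact Ideal.add_mem _ (Ideal.mul_mem_left _ _ hN) (Ideal.mul_mem_left _ _ hM)
  smul_mem' := by
    intro c a ha i
    obtain ⟨N, hN⟩ := ha i
    refine ⟨N, ?_⟩
    have h1 : (X i : R4 k) ^ N * (c • a) = c * (X i ^ N * a) := by
      rw [smul_eq_mul]; ring
    rw [h1]
    exact Ideal.mul_mem_left _ _ hN

/-- The colon ideal `(I : J) = {r | r·J ⊆ I}`. -/
def icolon (I J : Ideal (R4 k)) : Ideal (R4 k) where
  carrier := {r | ∀ x ∈ J, r * x ∈ I}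
  zero_mem' := by
    intro x hx
    rw [zero_mul]; exact I.zero_mem
  add_mem' := by
    intro a b ha hb x hx
    rw [add_mul]
    exact Ideal.add_mem _ (ha x hx) (hb x hx)
  smul_mem' := by
    intro c a ha x hx
    rw [smul_eq_mul, mul_assoc]
    exact Ideal.mul_mem_left _ _ (ha x hx)

/-- A smooth cubic surface `X ⊂ ℙ³`: an irreducible homogeneous cubic form with
no singular zero (Jacobian criterion). -/
structure SmoothCubicSurface (k : Type) [Field k] : Type where
  f : MvPolynomial (Fin 4) k
  homog : f.IsHomogeneous 3
  irred : Irreducible f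
  smooth : ∀ v : Fin 4 → k, v ≠ 0 → eval v f = 0 →
    ∃ i : Fin 4, eval v (pderiv i f) ≠ 0

/-- A configuration of `t` distinct points lying on `X`. -/
def ConfigOn (S : SmoothCubicSurface k) {t : ℕ} (Z : Fin t → P3 k) : Prop :=
  Function.Injective Z ∧ ∀ i, VanishesAt k S.f (Z i)

/-- A configuration avoids the (closed locus of the) polynomial `g` on the
product of the affine cones: some choice of representatives does not annihilate `g`. -/
def Avoids {t : ℕ} (g : MvPolynomial (Fin t × Fin 4) k) (Z : Fin t → P3 k) : Prop :=
  ∃ v : Fin t → Fin 4 → k,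
    (∀ i, ∃ hv : v i ≠ 0, Projectivization.mk k (v i) hv = Z i) ∧
    eval (fun q : Fin t × Fin 4 => v q.1 q.2) g ≠ 0

/-- `P` holds for a *general* set of `t` points on `X`: it holds on a nonempty
(basic) Zariski-open subset of the family of all sets of `t` points of `X`. -/
def GeneralPointsSatisfy (S : SmoothCubicSurface k) (t : ℕ)
    (P : (Fin t → P3 k) → Prop) : Prop :=
  ∃ g : MvPolynomial (Fin t × Fin 4) k,
    (∃ Z : Fin t → P3 k, ConfigOn k S Z ∧ Avoids k g Z) ∧
    (∀ Z : Fin t → P3 k, ConfigOn k S Z → Avoids k g Z → P Z)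

/-- An admissible entry of a matrix in a graded **minimal** free resolution,
mapping a generator of degree `d` into a generator of degree `e`: the entry is
homogeneous of degree `d - e`, and it is not a nonzero scalar (zero constant
coefficient). -/
def EntryOk (d e : ℕ) (q : R4 k) : Prop :=
  (q = 0 ∨ ∃ c : ℕ, d = e + c ∧ q.IsHomogeneous c) ∧ coeff 0 q = 0

/-- Integer-degree version of `EntryOk` (for modules with generators of
arbitrary integer degrees). -/
def EntryOkZ (d e : ℤ) (q : R4 k) : Prop :=
  (q = 0 ∨ ∃ c : ℕ, d = e + (c : ℤ) ∧ q.IsHomogeneous c) ∧ coeff 0 q = 0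

/-- The body of a graded minimal free resolution of length 2 over `R` of the
`R`-module `I/J`:
`0 → ⊕ R(-d2 i) --M2--> ⊕ R(-d1 j) --g--> I/J → 0`.
The generators `g j ∈ I` are homogeneous of degree `d1 j` and generate `I` mod `J`;
`M2` is a homogeneous matrix with no nonzero scalar entries whose rows generate the
kernel, and which is injective. -/
def Res2Body (J I : Ideal (R4 k)) {n1 n2 : ℕ}
    (d1 : Fin n1 → ℕ) (d2 : Fin n2 → ℕ)
    (g : Fin n1 → R4 k) (M2 : Fin n2 → Fin n1 → R4 k) : Prop :=
  (∀ j, g j ∈ I ∧ (g j).IsHomogeneous (d1 j)) ∧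
  (∀ x ∈ I, ∃ w : Fin n1 → R4 k, x - ∑ j, w j * g j ∈ J) ∧
  (∀ i j, EntryOk k (d2 i) (d1 j) (M2 i j)) ∧
  (∀ w : Fin n1 → R4 k,
    ((∑ j, w j * g j) ∈ J) ↔ ∃ u : Fin n2 → R4 k, ∀ j, w j = ∑ i, u i * M2 i j) ∧
  (∀ u : Fin n2 → R4 k, (∀ j, (∑ i, u i * M2 i j) = 0) → u = 0)

/-- `I/J` has a graded minimal free resolution
`0 → ⊕ R(-d2 i) → ⊕ R(-d1 j) → I/J → 0` over `R`. -/
def HasMinFreeRes2 (J I : Ideal (R4 k)) {n1 n2 : ℕ}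
    (d1 : Fin n1 → ℕ) (d2 : Fin n2 → ℕ) : Prop :=
  ∃ (g : Fin n1 → R4 k) (M2 : Fin n2 → Fin n1 → R4 k), Res2Body k J I d1 d2 g M2

/-- The body of a graded minimal free resolution of length 3 over `R` of the
`R`-module `I/J`:
`0 → ⊕ R(-d3 l) --M3--> ⊕ R(-d2 i) --M2--> ⊕ R(-d1 j) --g--> I/J → 0`. -/
def Res3Body (J I : Ideal (R4 k)) {n1 n2 n3 : ℕ}
    (d1 : Fin n1 → ℕ) (d2 : Fin n2 → ℕ) (d3 : Fin n3 → ℕ)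
    (g : Fin n1 → R4 k) (M2 : Fin n2 → Fin n1 → R4 k)
    (M3 : Fin n3 → Fin n2 → R4 k) : Prop :=
  (∀ j, g j ∈ I ∧ (g j).IsHomogeneous (d1 j)) ∧
  (∀ x ∈ I, ∃ w : Fin n1 → R4 k, x - ∑ j, w j * g j ∈ J) ∧
  (∀ i j, EntryOk k (d2 i) (d1 j) (M2 i j)) ∧
  (∀ i j, EntryOk k (d3 i) (d2 j) (M3 i j)) ∧
  (∀ w : Fin n1 → R4 k,
    ((∑ j, w j * g j) ∈ J) ↔ ∃ u : Fin n2 → R4 k, ∀ j, w j = ∑ i, u i * M2 i j) ∧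
  (∀ u : Fin n2 → R4 k,
    (∀ j, (∑ i, u i * M2 i j) = 0) ↔ ∃ t : Fin n3 → R4 k, ∀ i, u i = ∑ l, t l * M3 l i) ∧
  (∀ t : Fin n3 → R4 k, (∀ i, (∑ l, t l * M3 l i) = 0) → t = 0)

/-- `I/J` has a graded minimal free resolution
`0 → ⊕ R(-d3 l) → ⊕ R(-d2 i) → ⊕ R(-d1 j) → I/J → 0` over `R`.
Taking `J = ⊥` this is a resolution of the ideal `I ⊆ R`; taking `J = (f)` it is a
resolution of `I/(f) ⊆ R_X = R/(f)`; taking `J = I_C` a resolution of `I/I_C`. -/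
def HasMinFreeRes3 (J I : Ideal (R4 k)) {n1 n2 n3 : ℕ}
    (d1 : Fin n1 → ℕ) (d2 : Fin n2 → ℕ) (d3 : Fin n3 → ℕ) : Prop :=
  ∃ (g : Fin n1 → R4 k) (M2 : Fin n2 → Fin n1 → R4 k) (M3 : Fin n3 → Fin n2 → R4 k),
    Res3Body k J I d1 d2 d3 g M2 M3

/-- The Betti numbers read off from a minimal free resolution
`0 → F₃ → F₂ → F₁ → I_Z → 0` of the ideal of `Z` (so that
`F_i = ⊕_j R(-i-j)^{b_{i,j}}` in the resolution of `R/I_Z`, with `F₀ = R`). -/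
def bettiCount {n1 n2 n3 : ℕ} (d1 : Fin n1 → ℕ) (d2 : Fin n2 → ℕ) (d3 : Fin n3 → ℕ)
    (i j : ℕ) : ℕ :=
  if i = 0 then (if j = 0 then 1 else 0)
  else if i = 1 then (Finset.univ.filter fun l => d1 l = 1 + j).card
  else if i = 2 then (Finset.univ.filter fun l => d2 l = 2 + j).card
  else if i = 3 then (Finset.univ.filter fun l => d3 l = 3 + j).card
  else 0

/-- The Hilbert polynomial `P_X(t) = (3/2)t(t+1) + 1` of the cubic surface. -/
def PXcubic (t : ℕ) : ℕ := 3 * (t * (t + 1) / 2) + 1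

/-- The saturated homogeneous ideal of an integral curve lying on `X`. -/
def IsCurveIdealOn (S : SmoothCubicSurface k) (I : Ideal (R4 k)) : Prop :=
  IsHomogIdeal k I ∧ I.IsPrime ∧ S.f ∈ I ∧
    ringKrullDim (R4 k ⧸ I) = ((2 : ℕ∞) : WithBot ℕ∞)

/-- The Jacobian criterion at a point of the cone: some 2×2 minor of the Jacobian
matrix of elements of `I` is nonzero, i.e. the curve is smooth there. -/
def CurveSmoothAt (I : Ideal (R4 k)) (v : Fin 4 → k) : Prop :=
  ∃ g₁ ∈ I, ∃ g₂ ∈ I, ∃ i j : Fin 4,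
    eval v (pderiv i g₁) * eval v (pderiv j g₂)
      - eval v (pderiv j g₁) * eval v (pderiv i g₂) ≠ 0

/-- A smooth (integral) curve on `X`. -/
def IsSmoothCurveIdealOn (S : SmoothCubicSurface k) (I : Ideal (R4 k)) : Prop :=
  IsCurveIdealOn k S I ∧
  ∀ v : Fin 4 → k, v ≠ 0 → (∀ g ∈ I, eval v g = 0) → CurveSmoothAt k I v

/-- The coordinate ring `R/I` of a curve has depth 2 (a regular sequence of two
positive-degree homogeneous elements), i.e. the curve is arithmetically
Cohen–Macaulay. -/
def IsACMIdeal (I : Ideal (R4 k)) : Prop :=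
  ∃ r₁ r₂ : R4 k,
    (∃ d₁ : ℕ, 0 < d₁ ∧ r₁.IsHomogeneous d₁) ∧
    (∃ d₂ : ℕ, 0 < d₂ ∧ r₂.IsHomogeneous d₂) ∧
    (∀ x : R4 k, r₁ * x ∈ I → x ∈ I) ∧
    (∀ x : R4 k, r₂ * x ∈ I ⊔ Ideal.span {r₁} → x ∈ I ⊔ Ideal.span {r₁})

/-- The Hilbert function `t ↦ dim_k (R/I)_t`. -/
def hilbFn (I : Ideal (R4 k)) (t : ℕ) : ℕ :=
  Module.finrank k ↥(homogeneousSubmodule (Fin 4) k t) -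
    Module.finrank k ↥(homogeneousSubmodule (Fin 4) k t ⊓
      Submodule.restrictScalars k I)

/-- The subscheme with saturated ideal `I` has degree `d` and (arithmetic) genus `g`,
read off from the Hilbert polynomial `P(t) = d·t + 1 - g`. -/
def HasDegreeGenus (I : Ideal (R4 k)) (d : ℕ) (g : ℤ) : Prop :=
  ∃ N : ℕ, ∀ t : ℕ, N ≤ t → (hilbFn k I t : ℤ) = d * t + 1 - g

/-- Linear equivalence of divisors on `X`: the divisor with (divisorial) ideal `I`
is linearly equivalent to (divisor of `J`) + `a·H`, where `H` is the hyperplane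
class.  Concretely, there are homogeneous forms `q, p` with `deg p = deg q + a`,
nonzero on `X`, with `q·I = p·J` in `R_X = R/(f)`.  (Taking `J = ⊤` expresses
that the divisor of `I` is linearly equivalent to `aH`.) -/
def LinEquivOnX (S : SmoothCubicSurface k) (I J : Ideal (R4 k)) (a : ℤ) : Prop :=
  ∃ (mq mp : ℕ) (q p : R4 k), (mp : ℤ) = (mq : ℤ) + a ∧
    q.IsHomogeneous mq ∧ p.IsHomogeneous mp ∧
    q ∉ Ideal.span {S.f} ∧ p ∉ Ideal.span {S.f} ∧
    Ideal.span {q} * I ⊔ Ideal.span {S.f} = Ideal.span {p} * J ⊔ Ideal.span {S.f}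

/-- Linear equivalence, on the curve `C` with ideal `IC`, of the divisor with
ideal `IG` to `r·H_C` (`H_C` the hyperplane section of `C`): there are homogeneous
forms `q, p`, nonzero on `C`, with `deg p = deg q + r` and `q·I_{G,C} = (p)` in
`R/I_C`. -/
def DivOnCurveEquivH (IC IG : Ideal (R4 k)) (r : ℤ) : Prop :=
  ∃ (mq mp : ℕ) (q p : R4 k), (mp : ℤ) = (mq : ℤ) + r ∧
    q.IsHomogeneous mq ∧ p.IsHomogeneous mp ∧ q ∉ IC ∧ p ∉ IC ∧
    Ideal.span {q} * IG ⊔ IC = Ideal.span {p} ⊔ IC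

/-- The saturated homogeneous ideal of a zero-dimensional subscheme of `ℙ³`. -/
def IsZeroDimIdeal (I : Ideal (R4 k)) : Prop :=
  IsHomogIdeal k I ∧ satIdeal k I = I ∧
    ringKrullDim (R4 k ⧸ I) = ((1 : ℕ∞) : WithBot ℕ∞)

/-- An arithmetically Gorenstein zero-dimensional subscheme of `ℙ³`: its ideal has a
graded minimal free resolution of length 3 whose last free module has rank one. -/
def IsAGPointsIdeal (I : Ideal (R4 k)) : Prop :=
  IsZeroDimIdeal k I ∧
  ∃ (n1 n2 : ℕ) (d1 : Fin n1 → ℕ) (d2 : Fin n2 → ℕ) (s : ℕ),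
    HasMinFreeRes3 k ⊥ I d1 d2 (fun _ : Fin 1 => s)

/-- `V₁` and `V₂` are directly Gorenstein linked by the arithmetically Gorenstein
scheme with ideal `IG`: `I_G ⊆ I_{V₁} ∩ I_{V₂}`, `I_G : I_{V₁} = I_{V₂}` and
`I_G : I_{V₂} = I_{V₁}`. -/
def IsGLinked (IG I1 I2 : Ideal (R4 k)) : Prop :=
  IG ≤ I1 ⊓ I2 ∧ icolon k IG I1 = I2 ∧ icolon k IG I2 = I1

/-- The divisor `G` (with ideal `IG`) on the curve `C ⊂ X` (with ideal `IC`) is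
linearly equivalent to `m·H_C - K_C`.  By adjunction on the cubic surface
(`K_X = -H`) this says `G + C|_C ∼ (m+1)·H_C` on `C`, where `C|_C` is realized as
the scheme-theoretic intersection `C ∩ C'` with any curve `C' ∼ C`, `C' ≠ C`,
chosen disjoint from `G`. -/
def EquivHminusKC (S : SmoothCubicSurface k) (IC IG : Ideal (R4 k)) (m : ℤ) : Prop :=
  ∃ IC' : Ideal (R4 k), IsCurveIdealOn k S IC' ∧ IC' ≠ IC ∧
    LinEquivOnX k S IC' IC 0 ∧
    satIdeal k (satIdeal k (IC ⊔ IC') ⊔ IG) = ⊤ ∧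
    DivOnCurveEquivH k IC (IG ⊓ satIdeal k (IC ⊔ IC')) (m + 1)

/-- A line on `X`: a smooth integral curve of degree 1, genus 0 on `X`. -/
def IsLineOn (S : SmoothCubicSurface k) (I : Ideal (R4 k)) : Prop :=
  IsSmoothCurveIdealOn k S I ∧ HasDegreeGenus k I 1 0

/-- A smooth conic on `X`: a smooth integral curve of degree 2, genus 0 on `X`. -/
def IsConicOn (S : SmoothCubicSurface k) (I : Ideal (R4 k)) : Prop :=
  IsSmoothCurveIdealOn k S I ∧ HasDegreeGenus k I 2 0

/-- A twisted cubic on `X`: a smooth integral curve of degree 3, genus 0 on `X`. -/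
def IsTwistedCubicOn (S : SmoothCubicSurface k) (I : Ideal (R4 k)) : Prop :=
  IsSmoothCurveIdealOn k S I ∧ HasDegreeGenus k I 3 0

/-- The curve `C ⊂ X` moves in a linear system of (projective) dimension `dim`,
i.e. `h⁰(O_X(C)) = dim + 1`.  Global sections of `O_X(C)` are computed, for any
homogeneous `q ∈ I_C` of degree `s` not divisible by `f`, as the degree-`s` part of
the colon ideal `((q, f) : I_C)` modulo `(f)`. -/
def MovesInLinSysOfDim (S : SmoothCubicSurface k) (IC : Ideal (R4 k)) (dim : ℤ) : Prop :=
  ∀ (s : ℕ) (q : R4 k), q.IsHomogeneous s → q ∈ IC → q ∉ Ideal.span {S.f} →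
    (Module.finrank k ↥(homogeneousSubmodule (Fin 4) k s ⊓
        Submodule.restrictScalars k (icolon k (Ideal.span {q} ⊔ Ideal.span {S.f}) IC)) : ℤ)
      - (Module.finrank k ↥(homogeneousSubmodule (Fin 4) k s ⊓
        Submodule.restrictScalars k (icolon k (Ideal.span {q} ⊔ Ideal.span {S.f}) IC) ⊓
        Submodule.restrictScalars k (Ideal.span {S.f})) : ℤ) = dim + 1

/-- `I/(f₀)` is a maximal Cohen–Macaulay module over `R/(f₀)` (3-dimensional):
it admits a regular sequence of three positive-degree homogeneous elements. -/
def IsMCMQuotient (f0 : R4 k) (I : Ideal (R4 k)) : Prop :=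
  ∃ r₁ r₂ r₃ : R4 k,
    (∃ d : ℕ, 0 < d ∧ r₁.IsHomogeneous d) ∧
    (∃ d : ℕ, 0 < d ∧ r₂.IsHomogeneous d) ∧
    (∃ d : ℕ, 0 < d ∧ r₃.IsHomogeneous d) ∧
    (∀ x ∈ I, r₁ * x ∈ Ideal.span {f0} → x ∈ Ideal.span {f0}) ∧
    (∀ x ∈ I, r₂ * x ∈ Ideal.span {r₁} * I ⊔ Ideal.span {f0} →
      x ∈ Ideal.span {r₁} * I ⊔ Ideal.span {f0}) ∧
    (∀ x ∈ I, r₃ * x ∈ Ideal.span {r₁} * I ⊔ Ideal.span {r₂} * I ⊔ Ideal.span {f0} →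
      x ∈ Ideal.span {r₁} * I ⊔ Ideal.span {r₂} * I ⊔ Ideal.span {f0}) ∧
    (∃ x ∈ I, x ∉ Ideal.span {r₁} * I ⊔ Ideal.span {r₂} * I ⊔ Ideal.span {r₃} * I
      ⊔ Ideal.span {f0})

end

section Koszul

variable {k : Type} [Field k]

/-- A variable outside `s` is a nonzerodivisor modulo the variables in `s`. -/
theorem mem_span_X_of_X_mul_mem {s : Set (Fin 4)} {i : Fin 4} (hi : i ∉ s) {e : R4 k}
    (h : X i * e ∈ Ideal.span (X '' s : Set (R4 k))) :
    e ∈ Ideal.span (X '' s : Set (R4 k)) := by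
  rw [mem_ideal_span_X_image] at h ⊢
  intro m hm
  have h1 : Finsupp.single i 1 + m ∈ (X i * e).support := by
    rw [mem_support_iff, coeff_X_mul]
    exact mem_support_iff.mp hm
  obtain ⟨j, hj, hne⟩ := h _ h1
  refine ⟨j, hj, ?_⟩
  have : i ≠ j := fun h => hi (h ▸ hj)
  simpa [Finsupp.single_apply, this] using hne

/-- Three elements whose Koszul complex is exact. -/
structure KoszulTriple (l : Fin 3 → R4 k) : Prop where
  ne : l 0 ≠ 0
  reg₁ : ∀ e, l 0 ∣ l 1 * e → l 0 ∣ e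
  reg₂ : ∀ e, l 2 * e ∈ Ideal.span {l 0, l 1} → e ∈ Ideal.span {l 0, l 1}

theorem koszulTriple_X {σ : Fin 3 → Fin 4} (hσ : Function.Injective σ) :
    KoszulTriple (fun i => (X (σ i) : R4 k)) where
  ne := X_ne_zero _
  reg₁ := by
    intro e h
    rw [← Ideal.mem_span_singleton] at h ⊢
    have h01 : σ 1 ∉ ({σ 0} : Set (Fin 4)) := by simp [hσ.eq_iff]
    have := @mem_span_X_of_X_mul_mem k _ {σ 0} (σ 1) h01 e
    simp only [Set.image_singleton] at this
    exact this h
  reg₂ := by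
    intro e h
    have h01 : σ 2 ∉ ({σ 0, σ 1} : Set (Fin 4)) := by simp [hσ.eq_iff]
    have := @mem_span_X_of_X_mul_mem k _ {σ 0, σ 1} (σ 2) h01 e
    simp only [Set.image_insert_eq, Set.image_singleton] at this
    exact this h

theorem KoszulTriple.map {l : Fin 3 → R4 k} (hl : KoszulTriple l) (φ : R4 k ≃ₐ[k] R4 k) :
    KoszulTriple (fun i => φ (l i)) where
  ne := by simpa using hl.ne
  reg₁ := by
    intro e h
    have := hl.reg₁ (φ.symm e) (by
      obtain ⟨c, hc⟩ := h
      exact ⟨φ.symm c, φ.injective (by simpa using hc)⟩)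
    obtain ⟨c, hc⟩ := this
    exact ⟨φ c, by rw [← map_mul, ← hc]; simp⟩
  reg₂ := by
    intro e h
    have := hl.reg₂ (φ.symm e) (by
      rw [Ideal.mem_span_pair] at h ⊢
      obtain ⟨a, b, hab⟩ := h
      exact ⟨φ.symm a, φ.symm b, φ.injective (by simpa using hab)⟩)
    rw [Ideal.mem_span_pair] at this ⊢
    obtain ⟨a, b, hab⟩ := this
    exact ⟨φ a, φ b, by rw [← map_mul, ← map_mul, ← map_add, hab]; simp⟩

theorem KoszulTriple.exists_cross {l : Fin 3 → R4 k} (hl : KoszulTriple l) {e₀ e₁ e₂ : R4 k}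
    (h : l 0 * e₀ + l 1 * e₁ + l 2 * e₂ = 0) :
    ∃ t₀ t₁ t₂, e₀ = l 1 * t₂ - l 2 * t₁ ∧ e₁ = l 2 * t₀ - l 0 * t₂ ∧
      e₂ = l 0 * t₁ - l 1 * t₀ := by
  have h2 := hl.reg₂ e₂ (Ideal.mem_span_pair.mpr ⟨-e₀, -e₁, by linear_combination -h⟩)
  obtain ⟨u, v, huv⟩ := Ideal.mem_span_pair.mp h2
  obtain ⟨w, hw⟩ := hl.reg₁ (e₁ + l 2 * v) ⟨-(e₀ + l 2 * u), by
    linear_combination h + l 2 * huv⟩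
  refine ⟨-v, u, -w, ?_, by linear_combination hw, by linear_combination -huv⟩
  apply mul_left_cancel₀ hl.ne
  linear_combination h + l 2 * huv - l 1 * hw

theorem KoszulTriple.exists_smul {l : Fin 3 → R4 k} (hl : KoszulTriple l) {b₀ b₁ b₂ : R4 k}
    (h₁ : l 0 * b₁ = l 1 * b₀) (h₂ : l 0 * b₂ = l 2 * b₀) :
    ∃ ρ, b₀ = l 0 * ρ ∧ b₁ = l 1 * ρ ∧ b₂ = l 2 * ρ := by
  obtain ⟨ρ, hρ⟩ := hl.reg₁ b₀ ⟨b₁, h₁.symm⟩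
  refine ⟨ρ, hρ, ?_, ?_⟩ <;> apply mul_left_cancel₀ hl.ne
  · linear_combination h₁ + l 1 * hρ
  · linear_combination h₂ + l 2 * hρ

/-- First exactness of the Koszul complex modulo a nonzero element `f`. -/
theorem KoszulTriple.exists_smul_mod {l : Fin 3 → R4 k} (hl : KoszulTriple l) {f : R4 k}
    (hf : f ≠ 0) {a : Fin 3 → R4 k} (h : ∀ i j, f ∣ l j * a i - l i * a j) :
    ∃ ρ, ∀ i, f ∣ a i - l i * ρ := by
  obtain ⟨c₀, h₀⟩ := h 2 1
  obtain ⟨c₁, h₁⟩ := h 0 2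
  obtain ⟨c₂, h₂⟩ := h 1 0
  obtain ⟨t₀, t₁, t₂, e₀, e₁, e₂⟩ := hl.exists_cross (e₀ := c₀) (e₁ := c₁) (e₂ := c₂) (by
    apply mul_left_cancel₀ hf
    linear_combination -l 0 * h₀ - l 1 * h₁ - l 2 * h₂)
  obtain ⟨ρ, r₀, r₁, r₂⟩ := hl.exists_smul (b₀ := a 0 - f * t₀) (b₁ := a 1 - f * t₁)
    (b₂ := a 2 - f * t₂) (by linear_combination h₂ + f * e₂)
    (by linear_combination -h₁ - f * e₁)
  refine ⟨ρ, fun i => ?_⟩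
  fin_cases i
  · change f ∣ a 0 - l 0 * ρ
    exact ⟨t₀, by linear_combination r₀⟩
  · change f ∣ a 1 - l 1 * ρ
    exact ⟨t₁, by linear_combination r₁⟩
  · change f ∣ a 2 - l 2 * ρ
    exact ⟨t₂, by linear_combination r₂⟩

/-- Alternating `4 × 4` arrays. -/
structure Alt4 {M : Type} [AddGroup M] (U : Fin 4 → Fin 4 → M) : Prop where
  diag : ∀ i, U i i = 0
  swap : ∀ i j, U i j = -U j i

theorem Alt4.sum_sum {U : Fin 4 → Fin 4 → R4 k} (h : Alt4 U) :
    ∑ i, X i * ∑ j, X j * U i j = 0 := by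
  simp only [Fin.sum_univ_four, h.diag, h.swap 1 0, h.swap 2 0, h.swap 2 1, h.swap 3 0,
    h.swap 3 1, h.swap 3 2]
  ring

/-- The alternating array with the six given entries. -/
def alt4 {M : Type} [AddGroup M] (a b c d e f : M) : Fin 4 → Fin 4 → M :=
  ![![0, a, b, c], ![-a, 0, d, e], ![-b, -d, 0, f], ![-c, -e, -f, 0]]

theorem alt4_alt {M : Type} [AddGroup M] (a b c d e f : M) : Alt4 (alt4 a b c d e f) where
  diag := by intro i; fin_cases i <;> rfl
  swap := by intro i j; fin_cases i <;> fin_cases j <;> simp [alt4]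

theorem exists_alt_of_sum_X_mul_eq_zero {e : Fin 4 → R4 k} (h : ∑ i, X i * e i = 0) :
    ∃ U : Fin 4 → Fin 4 → R4 k, Alt4 U ∧ ∀ i, e i = ∑ j, X j * U i j := by
  have hX := koszulTriple_X (k := k) (Fin.castSucc_injective 3)
  rw [Fin.sum_univ_four] at h
  have h3 : e 3 ∈ Ideal.span (X '' {0, 1, 2} : Set (R4 k)) := by
    apply mem_span_X_of_X_mul_mem (i := 3) (by decide)
    have : X 3 * e 3 = -e 0 * X 0 + (-e 1 * X 1 + -e 2 * X 2) := by linear_combination h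
    rw [this]
    refine Ideal.add_mem _ (Ideal.mul_mem_left _ _ (Ideal.subset_span ⟨0, by simp, rfl⟩))
      (Ideal.add_mem _ (Ideal.mul_mem_left _ _ (Ideal.subset_span ⟨1, by simp, rfl⟩))
        (Ideal.mul_mem_left _ _ (Ideal.subset_span ⟨2, by simp, rfl⟩)))
  simp only [Set.image_insert_eq, Set.image_singleton] at h3
  obtain ⟨u₀, y, hy, h3⟩ := Ideal.mem_span_insert.mp h3
  obtain ⟨u₁, u₂, h4⟩ := Ideal.mem_span_pair.mp hy
  obtain ⟨t₀, t₁, t₂, r₀, r₁, r₂⟩ := hX.exists_cross (e₀ := e 0 + X 3 * u₀)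
    (e₁ := e 1 + X 3 * u₁) (e₂ := e 2 + X 3 * u₂) (by
      change X 0 * _ + X 1 * _ + X 2 * _ = _
      linear_combination h - X 3 * h3 + X 3 * h4)
  change _ = X 1 * _ - X 2 * _ at r₀
  change _ = X 2 * _ - X 0 * _ at r₁
  change _ = X 0 * _ - X 1 * _ at r₂
  refine ⟨alt4 t₂ (-t₁) (-u₀) t₀ (-u₁) (-u₂), alt4_alt .., fun i => ?_⟩
  rw [Fin.sum_univ_four]
  fin_cases i <;> simp [alt4]
  · linear_combination r₀
  · linear_combination r₁
  · linear_combination r₂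
  · linear_combination h3 - h4

/-- The Koszul differential from alternating three-tensors (written as vectors) to alternating
two-tensors. -/
noncomputable def koszul3 (τ : Fin 4 → R4 k) : Fin 4 → Fin 4 → R4 k :=
  alt4 (X 2 * τ 3 - X 3 * τ 2) (X 3 * τ 1 - X 1 * τ 3) (X 1 * τ 2 - X 2 * τ 1)
    (X 0 * τ 3 - X 3 * τ 0) (X 2 * τ 0 - X 0 * τ 2) (X 0 * τ 1 - X 1 * τ 0)

theorem koszul3_alt (τ : Fin 4 → R4 k) : Alt4 (koszul3 τ) := alt4_alt ..

theorem sum_X_mul_koszul3 (τ : Fin 4 → R4 k) (i : Fin 4) : ∑ j, X j * koszul3 τ i j = 0 := by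
  rw [Fin.sum_univ_four]
  fin_cases i <;> simp [koszul3, alt4] <;> ring

theorem exists_koszul3_of_sum_X_mul_eq_zero {y : Fin 4 → Fin 4 → R4 k} (hy : Alt4 y)
    (h : ∀ i, ∑ j, X j * y i j = 0) : ∃ τ, y = koszul3 τ := by
  have hX := koszulTriple_X (k := k) (Fin.succ_injective 3)
  have h0 := h 0
  have h1 := h 1
  have h2 := h 2
  have h3 := h 3
  simp only [Fin.sum_univ_four, hy.diag, hy.swap 1 0, hy.swap 2 0, hy.swap 2 1, hy.swap 3 0,
    hy.swap 3 1, hy.swap 3 2] at h0 h1 h2 h3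
  obtain ⟨t₁, t₂, t₃, r₁, r₂, r₃⟩ := hX.exists_cross (e₀ := y 0 1) (e₁ := y 0 2) (e₂ := y 0 3) (by
    change X 1 * _ + X 2 * _ + X 3 * _ = _
    linear_combination h0)
  change _ = X 2 * _ - X 3 * _ at r₁
  change _ = X 3 * _ - X 1 * _ at r₂
  change _ = X 1 * _ - X 2 * _ at r₃
  obtain ⟨ρ, s₁, s₂, s₃⟩ := hX.exists_smul (b₀ := y 2 3 - X 0 * t₁) (b₁ := -(y 1 3 + X 0 * t₂))
    (b₂ := y 1 2 - X 0 * t₃) (by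
      change X 1 * _ = X 2 * _
      linear_combination h3 + X 0 * r₃) (by
      change X 1 * _ = X 3 * _
      linear_combination -h2 - X 0 * r₂)
  change _ = X 1 * _ at s₁
  change _ = X 2 * _ at s₂
  change _ = X 3 * _ at s₃
  refine ⟨![-ρ, t₁, t₂, t₃], ?_⟩
  funext i j
  have key : ∀ i j, i < j → y i j = koszul3 ![-ρ, t₁, t₂, t₃] i j := by
    intro i j hij
    fin_cases i <;> fin_cases j <;> first | (exact absurd hij (by decide)) | skip
    all_goals simp [koszul3, alt4]
    · linear_combination r₁
    · linear_combination r₂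
    · linear_combination r₃
    · linear_combination s₃
    · linear_combination -s₂
    · linear_combination s₁
  rcases lt_trichotomy i j with hij | rfl | hij
  · exact key i j hij
  · rw [hy.diag, (koszul3_alt _).diag]
  · rw [hy.swap, (koszul3_alt _).swap, key j i hij]

theorem exists_koszul3_mod {f : R4 k} (hf : f ≠ 0) {y : Fin 4 → Fin 4 → R4 k} (hy : Alt4 y)
    (h : ∀ i, f ∣ ∑ j, X j * y i j) : ∃ τ, ∀ i j, f ∣ y i j - koszul3 τ i j := by
  choose c hc using h
  obtain ⟨U, hU, hcU⟩ := exists_alt_of_sum_X_mul_eq_zero (e := c) (by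
    apply mul_left_cancel₀ hf
    rw [Finset.mul_sum, mul_zero, ← hy.sum_sum]
    exact Finset.sum_congr rfl fun i _ => by rw [hc]; ring)
  obtain ⟨τ, hτ⟩ := exists_koszul3_of_sum_X_mul_eq_zero (y := fun i j => y i j - f * U i j)
    ⟨fun i => by rw [hy.diag, hU.diag]; ring, fun i j => by rw [hy.swap, hU.swap]; ring⟩ (by
      intro i
      have : ∑ j, X j * (y i j - f * U i j) = ∑ j, X j * y i j - f * ∑ j, X j * U i j := by
        rw [Finset.mul_sum, ← Finset.sum_sub_distrib]
        exact Finset.sum_congr rfl fun j _ => by ring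
      rw [this, hc, hcU, sub_self])
  refine ⟨τ, fun i j => ⟨U i j, ?_⟩⟩
  rw [← hτ]; ring

end Koszul

section HomogeneousParts

variable {k : Type} [Field k]

theorem homogeneousComponent_mul_of_isHomogeneous {σ : Type*} {R : Type*} [CommSemiring R]
    {p q : MvPolynomial σ R} {m : ℕ} (hp : p.IsHomogeneous m) (n : ℕ) :
    homogeneousComponent (m + n) (p * q) = p * homogeneousComponent n q := by
  conv_lhs => rw [← sum_homogeneousComponent q, Finset.mul_sum, map_sum]
  have h : ∀ i, homogeneousComponent (m + n) (p * homogeneousComponent i q) =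
      if i = n then p * homogeneousComponent n q else 0 := by
    intro i
    rw [homogeneousComponent_of_mem
      (show _ ∈ homogeneousSubmodule σ R (m + i) from hp.mul (homogeneousComponent_isHomogeneous i q))]
    by_cases hi : i = n
    · simp [hi]
    · simp [hi, Ne.symm hi]
  simp_rw [h]
  rw [Finset.sum_ite_eq']
  split_ifs with h1
  · rfl
  · rw [homogeneousComponent_eq_zero, mul_zero]
    simpa using h1

theorem homogeneousComponent_mul_of_lt {σ : Type*} {R : Type*} [CommSemiring R]
    {p q : MvPolynomial σ R} {m d : ℕ} (hp : p.IsHomogeneous m) (hd : d < m) :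
    homogeneousComponent d (p * q) = 0 := by
  conv_lhs => rw [← sum_homogeneousComponent q, Finset.mul_sum, map_sum]
  refine Finset.sum_eq_zero fun i _ => ?_
  rw [homogeneousComponent_of_mem
      (show _ ∈ homogeneousSubmodule σ R (m + i) from hp.mul (homogeneousComponent_isHomogeneous i q)),
      if_neg (by omega)]

theorem homogeneousComponent_succ_X_mul (i : Fin 4) (p : R4 k) (d : ℕ) :
    homogeneousComponent (d + 1) (X i * p) = X i * homogeneousComponent d p := by
  rw [add_comm]
  exact homogeneousComponent_mul_of_isHomogeneous (isHomogeneous_X k i) d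

theorem homogeneousComponent_of_isHomogeneous {p : R4 k} {d : ℕ} (hp : p.IsHomogeneous d) :
    homogeneousComponent d p = p := by
  rw [homogeneousComponent_of_mem (n := d) hp, if_pos rfl]

theorem dvd_homogeneousComponent {f : R4 k} {m : ℕ} (hf : f.IsHomogeneous m) {p : R4 k}
    (h : f ∣ p) (d : ℕ) : f ∣ homogeneousComponent d p := by
  obtain ⟨c, rfl⟩ := h
  rcases lt_or_ge d m with hd | hd
  · rw [homogeneousComponent_mul_of_lt hf hd]; exact dvd_zero _
  · obtain ⟨e, rfl⟩ := Nat.exists_eq_add_of_le hd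
    rw [homogeneousComponent_mul_of_isHomogeneous hf]; exact dvd_mul_right _ _

theorem exists_homogeneous_of_dvd {f p : R4 k} {m e : ℕ} (hf : f.IsHomogeneous m) (h : f ∣ p)
    (hp : p.IsHomogeneous (m + e)) : ∃ c : R4 k, c.IsHomogeneous e ∧ p = f * c := by
  obtain ⟨c, rfl⟩ := h
  refine ⟨homogeneousComponent e c, homogeneousComponent_isHomogeneous _ _, ?_⟩
  rw [← homogeneousComponent_mul_of_isHomogeneous hf, homogeneousComponent_of_isHomogeneous hp]

theorem eq_zero_of_dvd_of_lt {f p : R4 k} {m d : ℕ} (hf : f.IsHomogeneous m) (h : f ∣ p)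
    (hp : p.IsHomogeneous d) (hd : d < m) : p = 0 := by
  obtain ⟨c, rfl⟩ := h
  rw [← homogeneousComponent_of_isHomogeneous hp, homogeneousComponent_mul_of_lt hf hd]

theorem aeval_mul_of_isHomogeneous {σ R S : Type*} [CommSemiring R] [CommSemiring S] [Algebra R S]
    {p : MvPolynomial σ R} {d : ℕ} (hp : p.IsHomogeneous d) (t : S) (s : σ → S) :
    aeval (fun j => t * s j) p = t ^ d * aeval s p := by
  rw [aeval_def, aeval_def, eval₂_eq, eval₂_eq, Finset.mul_sum]
  refine Finset.sum_congr rfl fun m hm => ?_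
  rw [Finset.prod_congr rfl fun i _ => mul_pow t (s i) (m i), Finset.prod_mul_distrib,
    Finset.prod_pow_eq_pow_sum]
  have : ∑ i ∈ m.support, m i = d := by
    have := hp (mem_support_iff.mp hm)
    rw [← this, Finsupp.weight_apply, Finsupp.sum]
    simp
  rw [this]; ring

theorem eval_smul_of_isHomogeneous {σ : Type*} {p : MvPolynomial σ k} {d : ℕ}
    (hp : p.IsHomogeneous d) (t : k) (v : σ → k) : eval (t • v) p = t ^ d * eval v p := by
  have := aeval_mul_of_isHomogeneous hp t v
  rw [aeval_eq_eval] at this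
  exact this

theorem mem_span_X_of_isHomogeneous {p : R4 k} {d : ℕ} (hp : p.IsHomogeneous d) (hd : d ≠ 0) :
    p ∈ Ideal.span (Set.range (X : Fin 4 → R4 k)) := by
  rw [← Set.image_univ, mem_ideal_span_X_image]
  intro m hm
  by_contra! hcon
  have hm0 : m = 0 := by ext i; simpa using hcon i trivial
  have := hp (mem_support_iff.mp hm)
  simp [hm0] at this
  exact hd this.symm

theorem exists_sum_X_mul_of_isHomogeneous {p : R4 k} {d : ℕ} (hp : p.IsHomogeneous (d + 1)) :
    ∃ q : Fin 4 → R4 k, (∀ i, (q i).IsHomogeneous d) ∧ p = ∑ i, X i * q i := by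
  obtain ⟨c, hc⟩ := Ideal.mem_span_range_iff_exists_fun.mp
    (mem_span_X_of_isHomogeneous hp d.succ_ne_zero)
  refine ⟨fun i => homogeneousComponent d (c i),
    fun i => homogeneousComponent_isHomogeneous _ _, ?_⟩
  rw [← homogeneousComponent_of_isHomogeneous hp, ← hc, map_sum]
  exact Finset.sum_congr rfl fun i _ => by rw [mul_comm, homogeneousComponent_succ_X_mul]

theorem Alt4.map {M N : Type} [AddGroup M] [AddGroup N] {U : Fin 4 → Fin 4 → M} (h : Alt4 U)
    (φ : M →+ N) : Alt4 (fun i j => φ (U i j)) where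
  diag i := by rw [h.diag, map_zero]
  swap i j := by rw [h.swap, map_neg]

theorem homogeneousComponent_sum_X_mul (q : Fin 4 → R4 k) (d : ℕ) :
    homogeneousComponent (d + 1) (∑ i, X i * q i) = ∑ i, X i * homogeneousComponent d (q i) := by
  rw [map_sum]
  exact Finset.sum_congr rfl fun i _ => homogeneousComponent_succ_X_mul ..

theorem homogeneousComponent_koszul3 (τ : Fin 4 → R4 k) (d : ℕ) (i j : Fin 4) :
    homogeneousComponent (d + 1) (koszul3 τ i j) =
      koszul3 (fun l => homogeneousComponent d (τ l)) i j := by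
  fin_cases i <;> fin_cases j <;> simp [koszul3, alt4, homogeneousComponent_succ_X_mul]

/-- Graded Koszul exactness in degree one. -/
theorem exists_homogeneous_alt {e : Fin 4 → R4 k} {d : ℕ} (he : ∀ i, (e i).IsHomogeneous (d + 1))
    (h : ∑ i, X i * e i = 0) :
    ∃ U : Fin 4 → Fin 4 → R4 k, Alt4 U ∧ (∀ i j, (U i j).IsHomogeneous d) ∧
      ∀ i, e i = ∑ j, X j * U i j := by
  obtain ⟨U, hU, heU⟩ := exists_alt_of_sum_X_mul_eq_zero h
  refine ⟨_, hU.map (homogeneousComponent d).toAddMonoidHom,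
    fun i j => homogeneousComponent_isHomogeneous _ _, fun i => ?_⟩
  rw [← homogeneousComponent_of_isHomogeneous (he i), heU, homogeneousComponent_sum_X_mul]
  rfl

theorem eq_zero_of_sum_X_mul_eq_zero_of_degree_zero {e : Fin 4 → R4 k}
    (he : ∀ i, (e i).IsHomogeneous 0) (h : ∑ i, X i * e i = 0) (i : Fin 4) : e i = 0 := by
  obtain ⟨U, hU, heU⟩ := exists_alt_of_sum_X_mul_eq_zero h
  rw [← homogeneousComponent_of_isHomogeneous (he i), heU, map_sum]
  exact Finset.sum_eq_zero fun j _ =>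
    homogeneousComponent_mul_of_lt (isHomogeneous_X k j) one_pos

/-- Graded Koszul exactness modulo `f` in degree one. -/
theorem exists_homogeneous_alt_mod {f : R4 k} {m : ℕ} (hf : f.IsHomogeneous m)
    {e : Fin 4 → R4 k} {d : ℕ} (hd : m < d + 2) (he : ∀ i, (e i).IsHomogeneous (d + 1))
    (h : f ∣ ∑ i, X i * e i) :
    ∃ U : Fin 4 → Fin 4 → R4 k, Alt4 U ∧ (∀ i j, (U i j).IsHomogeneous d) ∧
      ∀ i, f ∣ e i - ∑ j, X j * U i j := by
  have hs : (∑ i, X i * e i).IsHomogeneous (m + ((d + 1 - m) + 1)) := by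
    refine IsHomogeneous.sum _ _ _ fun i _ => ?_
    have := (isHomogeneous_X k i).mul (he i)
    convert this using 1; omega
  obtain ⟨c, hc, hfc⟩ := exists_homogeneous_of_dvd hf h hs
  obtain ⟨c', -, hcc'⟩ := exists_sum_X_mul_of_isHomogeneous hc
  obtain ⟨U, hU, heU⟩ := exists_alt_of_sum_X_mul_eq_zero (e := fun i => e i - f * c' i) (by
    simp only [mul_sub, Finset.sum_sub_distrib]
    rw [hfc, hcc', Finset.mul_sum, sub_eq_zero]
    exact Finset.sum_congr rfl fun i _ => by ring)
  refine ⟨_, hU.map (homogeneousComponent d).toAddMonoidHom,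
    fun i j => homogeneousComponent_isHomogeneous _ _, fun i => ?_⟩
  have h1 : f ∣ e i - ∑ j, X j * U i j := ⟨c' i, by rw [← heU]; ring⟩
  have h2 := dvd_homogeneousComponent hf h1 (d + 1)
  rwa [map_sub, homogeneousComponent_of_isHomogeneous (he i), homogeneousComponent_sum_X_mul] at h2

/-- Graded Koszul exactness modulo `f` in degree two. -/
theorem exists_homogeneous_koszul3_mod {f : R4 k} {m : ℕ} (hf : f.IsHomogeneous m) (hf0 : f ≠ 0)
    {y : Fin 4 → Fin 4 → R4 k} {d : ℕ} (hy : Alt4 y) (hyd : ∀ i j, (y i j).IsHomogeneous (d + 1))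
    (h : ∀ i, f ∣ ∑ j, X j * y i j) :
    ∃ τ : Fin 4 → R4 k, (∀ l, (τ l).IsHomogeneous d) ∧ ∀ i j, f ∣ y i j - koszul3 τ i j := by
  obtain ⟨τ, hτ⟩ := exists_koszul3_mod hf0 hy h
  refine ⟨fun l => homogeneousComponent d (τ l),
    fun l => homogeneousComponent_isHomogeneous _ _, fun i j => ?_⟩
  have h2 := dvd_homogeneousComponent hf (hτ i j) (d + 1)
  rwa [map_sub, homogeneousComponent_of_isHomogeneous (hyd i j), homogeneousComponent_koszul3] at h2

end HomogeneousParts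

section ZariskiNeighbourhoods

variable {k : Type} [Field k]

/-- The filter of Zariski neighbourhoods of a point of affine space. -/
def zariskiNhds {σ : Type*} (c : σ → k) : Filter (σ → k) where
  sets := {U | ∃ g : MvPolynomial σ k, eval c g ≠ 0 ∧ ∀ x, eval x g ≠ 0 → x ∈ U}
  univ_sets := ⟨1, by simp, fun _ _ => trivial⟩
  sets_of_superset := by
    rintro U V ⟨g, hg, h⟩ hUV
    exact ⟨g, hg, fun x hx => hUV (h x hx)⟩
  inter_sets := by
    rintro U V ⟨g, hg, h⟩ ⟨g', hg', h'⟩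
    refine ⟨g * g', by simp [hg, hg'], fun x hx => ?_⟩
    rw [map_mul] at hx
    exact ⟨h x (left_ne_zero_of_mul hx), h' x (right_ne_zero_of_mul hx)⟩

theorem eventually_zariskiNhds {σ : Type*} {c : σ → k} {P : (σ → k) → Prop} :
    (∀ᶠ x in zariskiNhds c, P x) ↔
      ∃ g : MvPolynomial σ k, eval c g ≠ 0 ∧ ∀ x, eval x g ≠ 0 → P x := Iff.rfl

theorem eventually_eval_ne_zero {σ : Type*} {c : σ → k} {g : MvPolynomial σ k}
    (hg : eval c g ≠ 0) : ∀ᶠ x in zariskiNhds c, eval x g ≠ 0 := ⟨g, hg, fun _ hx => hx⟩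

theorem eval_bind₁ {σ τ : Type*} (φ : τ → MvPolynomial σ k) (g : MvPolynomial τ k) (x : σ → k) :
    eval x (bind₁ φ g) = eval (fun t => eval x (φ t)) g := by
  rw [eval, eval₂Hom_bind₁]
  rfl

/-- A polynomial matrix which is injective at a point is injective nearby. -/
theorem eventually_injective {σ I J : Type*} [Fintype I] [Fintype J] (c : σ → k)
    (φ : I → J → MvPolynomial σ k)
    (h : ∀ w : J → k, (∀ i, ∑ j, eval c (φ i j) * w j = 0) → w = 0) :
    ∀ᶠ x in zariskiNhds c, ∀ w : J → k, (∀ i, ∑ j, eval x (φ i j) * w j = 0) → w = 0 := by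
  classical
  let M : Matrix I J (MvPolynomial σ k) := Matrix.of φ
  have hM : ∀ x i w, (M.map (eval x)).mulVec w i = ∑ j, eval x (φ i j) * w j := by
    intro x i w; rfl
  have hinj : LinearMap.ker (M.map (eval c)).mulVecLin = ⊥ := by
    rw [LinearMap.ker_eq_bot']
    intro w hw
    exact h w fun i => by rw [← hM]; exact congrFun hw i
  obtain ⟨g, hg⟩ := LinearMap.exists_leftInverse_of_injective _ hinj
  let L : Matrix J I k := LinearMap.toMatrix' g
  have hL : L * M.map (eval c) = 1 := by
    have := congrArg LinearMap.toMatrix' hg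
    rwa [LinearMap.toMatrix'_comp, LinearMap.toMatrix'_id, ← Matrix.toLin'_apply',
      LinearMap.toMatrix'_toLin'] at this
  let L' : Matrix J I (MvPolynomial σ k) := Matrix.of fun j i => C (L j i)
  let N : Matrix J J (MvPolynomial σ k) := L' * M
  have hdet : ∀ x, eval x N.det = (L * M.map (eval x)).det := by
    intro x
    rw [RingHom.map_det, RingHom.mapMatrix_apply]
    congr 1
    ext i j
    simp [N, L', Matrix.mul_apply]
  refine ⟨N.det, by rw [hdet, hL]; simp, fun x hx w hw => ?_⟩
  rw [hdet] at hx
  have hMw : (M.map (eval x)).mulVec w = 0 := funext fun i => by rw [hM]; exact hw i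
  have : (L * M.map (eval x)).mulVec w = 0 := by
    rw [← Matrix.mulVec_mulVec, hMw, Matrix.mulVec_zero]
  exact Matrix.eq_zero_of_mulVec_eq_zero hx this

theorem eval_eq_sum_finsuppAntidiag {p : R4 k} {d : ℕ} (hp : p.IsHomogeneous d) (x : Fin 4 → k) :
    eval x p = ∑ m ∈ Finset.finsuppAntidiag Finset.univ d, coeff m p * ∏ i, x i ^ m i := by
  rw [eval_eq']
  refine Finset.sum_subset (fun m hm => ?_) (fun m _ hm => ?_)
  · have := hp (mem_support_iff.mp hm)
    rw [Finset.mem_finsuppAntidiag]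
    refine ⟨?_, Finset.subset_univ _⟩
    rw [← this, Finsupp.weight_apply, Finsupp.sum_fintype _ _ (by simp)]
    simp
  · rw [notMem_support_iff.mp hm, zero_mul]

theorem degree_of_mem_finsuppAntidiag {d : ℕ} {m : Fin 4 →₀ ℕ}
    (hm : m ∈ Finset.finsuppAntidiag Finset.univ d) : m.degree = d := by
  rw [Finset.mem_finsuppAntidiag] at hm
  rw [← hm.1, Finsupp.degree_eq_sum]

theorem eval_homogeneousComponent_mul_eq_zero {p q : R4 k} {d : ℕ} (hq : q.IsHomogeneous d)
    {x : Fin 4 → k} (h : eval x q = 0) (n : ℕ) : eval x (homogeneousComponent n (q * p)) = 0 := by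
  rcases lt_or_ge n d with hd | hd
  · rw [homogeneousComponent_mul_of_lt hq hd, map_zero]
  · obtain ⟨e, rfl⟩ := Nat.exists_eq_add_of_le hd
    rw [homogeneousComponent_mul_of_isHomogeneous hq, map_mul, h, zero_mul]

/-- An ideal with no nonzero zero contains a power of the irrelevant ideal. -/
theorem exists_pow_le_of_no_zero [IsAlgClosed k] {I : Ideal (R4 k)}
    (h : ∀ x : Fin 4 → k, x ≠ 0 → ∃ p ∈ I, eval x p ≠ 0) :
    ∃ N, Ideal.span (Set.range (X : Fin 4 → R4 k)) ^ N ≤ I := by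
  refine Ideal.exists_pow_le_of_le_radical_of_fg ?_ (Submodule.fg_span (Set.finite_range _))
  rw [Ideal.span_le, ← vanishingIdeal_zeroLocus_eq_radical (K := k)]
  rintro _ ⟨i, rfl⟩ x hx
  by_cases hx0 : x = 0
  · simp [hx0]
  · obtain ⟨p, hp, hne⟩ := h x hx0
    refine absurd ?_ hne
    have := (mem_zeroLocus_iff.mp hx) p hp
    rwa [aeval_eq_eval] at this

/-- Having no nontrivial common zero is an open condition on the coefficients. -/
theorem eventually_no_common_zero [IsAlgClosed k] {σ ι : Type*} [Fintype ι] (c : σ → k)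
    (Φ : ι → MvPolynomial (Fin 4) (MvPolynomial σ k)) (D : ι → ℕ)
    (hD : ∀ s, (Φ s).IsHomogeneous (D s))
    (h : ∀ x : Fin 4 → k, x ≠ 0 → ∃ s, eval x (map (eval c) (Φ s)) ≠ 0) :
    ∀ᶠ y in zariskiNhds c, ∀ x : Fin 4 → k, x ≠ 0 → ∃ s, eval x (map (eval y) (Φ s)) ≠ 0 := by
  classical
  obtain ⟨N, hN⟩ := exists_pow_le_of_no_zero
    (I := Ideal.span (Set.range fun s => map (eval c) (Φ s))) (by
      intro x hx
      obtain ⟨s, hs⟩ := h x hx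
      exact ⟨_, Ideal.subset_span ⟨s, rfl⟩, hs⟩)
  have hmon : ∀ m ∈ Finset.finsuppAntidiag (Finset.univ : Finset (Fin 4)) N,
      ∃ A : ι → R4 k, ∑ s, A s * map (eval c) (Φ s) = monomial m 1 := by
    intro m hm
    rw [← Ideal.mem_span_range_iff_exists_fun]
    apply hN
    rw [Finset.mem_finsuppAntidiag] at hm
    rw [monomial_eq, C_1, one_mul, ← hm.1, Finsupp.prod_fintype _ _ (by simp),
      ← Finset.prod_pow_eq_pow_sum]
    exact Ideal.prod_mem_prod fun i _ => Ideal.pow_mem_pow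
      (Ideal.subset_span (Set.mem_range_self i)) _
  choose! A hA using hmon
  let T := {m // m ∈ Finset.finsuppAntidiag (Finset.univ : Finset (Fin 4)) N}
  let P : Matrix T T (MvPolynomial σ k) :=
    Matrix.of fun m n => coeff n.1 (∑ s, map C (A m.1 s) * Φ s)
  have hP : ∀ y (m n : T), eval y (P m n) =
      coeff n.1 (homogeneousComponent N (∑ s, A m.1 s * map (eval y) (Φ s))) := by
    intro y m n
    rw [coeff_homogeneousComponent, if_pos (degree_of_mem_finsuppAntidiag n.2)]
    change eval y (coeff n.1 (∑ s, map C (A m.1 s) * Φ s)) = _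
    rw [← coeff_map, map_sum]
    congr 1
    refine Finset.sum_congr rfl fun s _ => ?_
    rw [map_mul, map_map]
    congr 1
    conv_rhs => rw [← map_id (A m.1 s)]
    congr 2
    ext; simp
  refine ⟨P.det, ?_, fun y hy x hx => ?_⟩
  · have : P.map (eval c) = 1 := by
      ext m n
      rw [Matrix.map_apply, hP, hA _ m.2, coeff_homogeneousComponent,
        if_pos (degree_of_mem_finsuppAntidiag n.2), coeff_monomial, Matrix.one_apply]
      congr 1
      exact propext Subtype.ext_iff.symm
    rw [RingHom.map_det, RingHom.mapMatrix_apply, this, Matrix.det_one]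
    exact one_ne_zero
  · by_contra! hcon
    rw [RingHom.map_det, RingHom.mapMatrix_apply] at hy
    have hw : (P.map (eval y)).mulVec (fun n : T => ∏ i, x i ^ n.1 i) = 0 := by
      funext m
      change ∑ n : T, eval y (P m n) * _ = 0
      simp_rw [hP]
      rw [Finset.sum_coe_sort (Finset.finsuppAntidiag Finset.univ N)
        (fun n => coeff n (homogeneousComponent N (∑ s, A m.1 s * map (eval y) (Φ s))) *
          ∏ i, x i ^ n i), ← eval_eq_sum_finsuppAntidiag (homogeneousComponent_isHomogeneous _ _),
        map_sum, map_sum]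
      refine Finset.sum_eq_zero fun s _ => ?_
      rw [mul_comm]
      exact eval_homogeneousComponent_mul_eq_zero ((hD s).map _) (hcon s) N
    have h0 := Matrix.eq_zero_of_mulVec_eq_zero hy hw
    obtain ⟨i, hi⟩ := Function.ne_iff.mp hx
    have hT : Finsupp.single i N ∈ Finset.finsuppAntidiag (Finset.univ : Finset (Fin 4)) N := by
      rw [Finset.mem_finsuppAntidiag]
      simp [Finsupp.single_apply]
    have h1 := congrFun h0 ⟨_, hT⟩
    simp only [Pi.zero_apply, Finset.prod_eq_zero_iff, Finset.mem_univ, true_and] at h1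
    obtain ⟨j, hj⟩ := h1
    have := eq_zero_of_pow_eq_zero hj
    by_cases hij : i = j
    · exact hi (hij ▸ this)
    · rw [Finsupp.single_apply, if_neg hij, pow_zero] at hj
      exact one_ne_zero hj

/-- A set on which two polynomials that are each somewhere nonzero are simultaneously nonzero. -/
def ZariskiIrreducible {σ : Type*} (V : Set (σ → k)) : Prop :=
  ∀ p q : MvPolynomial σ k, (∃ x ∈ V, eval x p ≠ 0) → (∃ x ∈ V, eval x q ≠ 0) →
    ∃ x ∈ V, eval x p ≠ 0 ∧ eval x q ≠ 0

theorem zariskiIrreducible_zeroLocus [IsAlgClosed k] {f : R4 k} (hf : Irreducible f) :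
    ZariskiIrreducible {x | eval x f = 0} := by
  intro p q ⟨x, hx, hxp⟩ ⟨y, hy, hyq⟩
  by_contra! hcon
  have hprime : (Ideal.span {f}).IsPrime :=
    (Ideal.span_singleton_prime hf.ne_zero).mpr hf.prime
  have hmem : p * q ∈ Ideal.span {f} := by
    rw [← IsPrime.vanishingIdeal_zeroLocus (K := k) (Ideal.span {f})]
    intro z hz
    have hz' : eval z f = 0 := by
      have := (mem_zeroLocus_iff.mp hz) f (Ideal.mem_span_singleton_self f)
      rwa [aeval_eq_eval] at this
    rw [aeval_eq_eval, map_mul]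
    by_cases h : eval z p = 0
    · rw [h, zero_mul]
    · rw [hcon z hz' h, mul_zero]
  rcases hprime.mem_or_mem hmem with h | h <;> obtain ⟨c, rfl⟩ := Ideal.mem_span_singleton.mp h
  · exact hxp (by rw [map_mul, show eval x f = 0 from hx, zero_mul])
  · exact hyq (by rw [map_mul, show eval y f = 0 from hy, zero_mul])

theorem ZariskiIrreducible.pi {V : Set (Fin 4 → k)} (hV : ZariskiIrreducible V) {m : ℕ}
    {P Q : MvPolynomial (Fin m × Fin 4) k} {u v : Fin m → Fin 4 → k} (hu : ∀ p, u p ∈ V)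
    (hv : ∀ p, v p ∈ V) (hP : eval (fun q => u q.1 q.2) P ≠ 0)
    (hQ : eval (fun q => v q.1 q.2) Q ≠ 0) :
    ∃ w : Fin m → Fin 4 → k, (∀ p, w p ∈ V) ∧ eval (fun q => w q.1 q.2) P ≠ 0 ∧
      eval (fun q => w q.1 q.2) Q ≠ 0 := by
  classical
  have key : ∀ s : Finset (Fin m), ∃ u v : Fin m → Fin 4 → k, (∀ p, u p ∈ V) ∧ (∀ p, v p ∈ V) ∧
      eval (fun q => u q.1 q.2) P ≠ 0 ∧ eval (fun q => v q.1 q.2) Q ≠ 0 ∧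
      ∀ p ∈ s, u p = v p := by
    intro s
    induction s using Finset.induction_on with
    | empty => exact ⟨u, v, hu, hv, hP, hQ, by simp⟩
    | insert p s _ ih =>
      obtain ⟨u, v, hu, hv, hP, hQ, heq⟩ := ih
      let sub (w : Fin m → Fin 4 → k) (q : Fin m × Fin 4) : R4 k :=
        if q.1 = p then X q.2 else C (w q.1 q.2)
      have hsub : ∀ (w : Fin m → Fin 4 → k) (R : MvPolynomial (Fin m × Fin 4) k) x,
          eval x (aeval (sub w) R) = eval (fun q => Function.update w p x q.1 q.2) R := by
        intro w R x
        change eval x (bind₁ (sub w) R) = _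
        rw [eval_bind₁]
        congr 2
        funext q
        by_cases h : q.1 = p
        · simp [sub, h]
        · simp [sub, h]
      obtain ⟨x, hx, hxP, hxQ⟩ := hV (aeval (sub u) P) (aeval (sub v) Q)
        ⟨u p, hu p, by rw [hsub, Function.update_eq_self]; exact hP⟩
        ⟨v p, hv p, by rw [hsub, Function.update_eq_self]; exact hQ⟩
      rw [hsub] at hxP hxQ
      refine ⟨Function.update u p x, Function.update v p x, fun q => ?_, fun q => ?_, hxP, hxQ, ?_⟩
      · by_cases h : q = p
        · subst h; simpa using hx
        · simpa [h] using hu q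
      · by_cases h : q = p
        · subst h; simpa using hx
        · simpa [h] using hv q
      · intro q hq
        by_cases h : q = p
        · subst h; simp
        · simpa [h] using heq q ((Finset.mem_insert.mp hq).resolve_left h)
  obtain ⟨u, v, hu, -, hP, hQ, heq⟩ := key Finset.univ
  have : u = v := funext fun p => heq p (Finset.mem_univ p)
  subst this
  exact ⟨u, hu, hP, hQ⟩

end ZariskiNeighbourhoods

section CompleteIntersection

variable {k : Type} [Field k]

theorem dvd_of_eq_combo₁ {f p r : R4 k} (c : R4 k) (hp : f ∣ p) (h : r = c * p) : f ∣ r :=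
  h ▸ hp.mul_left c

theorem dvd_of_eq_combo₂ {f p q r : R4 k} (c d : R4 k) (hp : f ∣ p) (hq : f ∣ q)
    (h : r = c * p + d * q) : f ∣ r :=
  h ▸ dvd_add (hp.mul_left c) (hq.mul_left d)

theorem dvd_of_eq_combo₃ {f p q s r : R4 k} (c d e : R4 k) (hp : f ∣ p) (hq : f ∣ q) (hs : f ∣ s)
    (h : r = c * p + d * q + e * s) : f ∣ r :=
  h ▸ dvd_add (dvd_add (hp.mul_left c) (hq.mul_left d)) (hs.mul_left e)

theorem mem_span_pair_iff_dvd {f g q : R4 k} :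
    q ∈ Ideal.span {f, g} ↔ ∃ α, f ∣ q - α * g := by
  rw [Ideal.mem_span_pair]
  constructor
  · rintro ⟨c, α, rfl⟩; exact ⟨α, c, by ring⟩
  · rintro ⟨α, c, hc⟩; exact ⟨c, α, by linear_combination -hc⟩

theorem mem_span_triple_iff_dvd {f g h q : R4 k} :
    q ∈ Ideal.span {f, g, h} ↔ ∃ α β, f ∣ q - (α * g + β * h) := by
  rw [Ideal.mem_span_insert]
  constructor
  · rintro ⟨c, z, hz, rfl⟩
    obtain ⟨α, β, rfl⟩ := Ideal.mem_span_pair.mp hz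
    exact ⟨α, β, c, by ring⟩
  · rintro ⟨α, β, c, hc⟩
    exact ⟨c, _, Ideal.mem_span_pair.mpr ⟨α, β, rfl⟩, by linear_combination hc⟩

/-- A saturated ideal with no nonzero zero is the unit ideal. -/
theorem one_mem_of_saturated_of_no_zero [IsAlgClosed k] {J : Ideal (R4 k)}
    (hsat : ∀ r, (∀ i, X i * r ∈ J) → r ∈ J)
    (h : ∀ x : Fin 4 → k, x ≠ 0 → ∃ p ∈ J, eval x p ≠ 0) : 1 ∈ J := by
  obtain ⟨N, hN⟩ := exists_pow_le_of_no_zero h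
  induction N with
  | zero => exact hN (by simp)
  | succ N ih =>
    refine ih fun r hr => hsat r fun i => hN ?_
    rw [pow_succ']
    exact Ideal.mul_mem_mul (Ideal.subset_span ⟨i, rfl⟩) hr

theorem not_dvd_of_degree_one {f l : R4 k} (hf : f.IsHomogeneous 3) (hl : l.IsHomogeneous 1)
    (h : l ≠ 0) : ¬ f ∣ l := fun hd => h (eq_zero_of_dvd_of_lt hf hd hl (by norm_num))

theorem mem_span_pair_of_koszulTriple {f g : R4 k} (hf : Prime f) {l : Fin 3 → R4 k}
    (hl : KoszulTriple l) (hl0 : ¬ f ∣ l 0) (hg : ¬ f ∣ g) {w : R4 k}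
    (h : ∀ i, l i * w ∈ Ideal.span {f, g}) : w ∈ Ideal.span {f, g} := by
  simp only [mem_span_pair_iff_dvd] at h ⊢
  choose ρ hρ using h
  obtain ⟨α, hα⟩ := hl.exists_smul_mod hf.ne_zero (a := ρ) (fun i j => by
    refine (hf.dvd_or_dvd (?_ : f ∣ _ * g)).resolve_right hg
    exact dvd_of_eq_combo₂ (l i) (-l j) (hρ j) (hρ i) (by ring))
  refine ⟨α, (hf.dvd_or_dvd (?_ : f ∣ l 0 * _)).resolve_left hl0⟩
  exact dvd_of_eq_combo₂ 1 g (hρ 0) (hα 0) (by ring)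

theorem exists_smul_mod_X {f : R4 k} (hf : Prime f) (hf3 : f.IsHomogeneous 3) {a : Fin 4 → R4 k}
    (h : ∀ i j, f ∣ X j * a i - X i * a j) : ∃ ρ, ∀ i, f ∣ a i - X i * ρ := by
  obtain ⟨ρ, hρ⟩ := (koszulTriple_X (k := k) (Fin.castSucc_injective 3)).exists_smul_mod
    hf.ne_zero (a := fun i => a i.castSucc) (fun i j => h _ _)
  refine ⟨ρ, fun i => ?_⟩
  refine (hf.dvd_or_dvd (?_ : f ∣ X 0 * _)).resolve_left
    (not_dvd_of_degree_one hf3 (isHomogeneous_X k 0) (X_ne_zero 0))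
  exact dvd_of_eq_combo₂ (X i) 1 (hρ 0) (h i 0) (by simp; ring)

/-- The three linear forms cutting out a point `z` with `z c ≠ 0`. -/
noncomputable def pointForms (z : Fin 4 → k) (c : Fin 4) (i : Fin 3) : R4 k :=
  X (c.succAbove i) - C (z (c.succAbove i) / z c) * X c

theorem pointForms_isHomogeneous (z : Fin 4 → k) (c : Fin 4) (i : Fin 3) :
    (pointForms z c i).IsHomogeneous 1 :=
  (isHomogeneous_X k _).sub (isHomogeneous_C_mul_X _ _)

theorem eval_pointForms {z : Fin 4 → k} {c : Fin 4} (hc : z c ≠ 0) (i : Fin 3) :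
    eval z (pointForms z c i) = 0 := by
  simp [pointForms, hc]

theorem koszulTriple_pointForms (z : Fin 4 → k) (c : Fin 4) : KoszulTriple (pointForms z c) := by
  let s : k → Fin 4 → R4 k := fun t j => if j = c then X c else X j + C (t * (z j / z c)) * X c
  have hsc : ∀ t, s t c = X c := fun t => if_pos rfl
  have hsj : ∀ t j, j ≠ c → s t j = X j + C (t * (z j / z c)) * X c := fun t j hj => if_neg hj
  have h : ∀ t t' : k, t + t' = 0 → (aeval (R := k) (s t)).comp (aeval (s t')) = AlgHom.id k _ := by
    intro t t' htt
    ext1 j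
    rw [AlgHom.comp_apply, aeval_X, AlgHom.id_apply]
    by_cases hj : j = c
    · rw [hj, hsc, aeval_X, hsc]
    · rw [hsj _ j hj, map_add, map_mul, aeval_X, aeval_X, hsc, hsj _ j hj, aeval_C, algebraMap_eq,
        add_assoc, ← add_mul, ← C_add, ← add_mul, htt]
      simp
  let ψ : R4 k ≃ₐ[k] R4 k := AlgEquiv.ofAlgHom (aeval (s (-1))) (aeval (s 1))
    (h _ _ (by ring)) (h _ _ (by ring))
  have := (koszulTriple_X (k := k) (Fin.succAbove_right_injective (p := c))).map ψ
  have hψ : (fun i => ψ (X (c.succAbove i))) = pointForms z c := by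
    funext i
    change aeval (s (-1)) (X (c.succAbove i)) = _
    rw [aeval_X, hsj _ _ (Fin.succAbove_ne c i), pointForms, neg_one_mul, C_neg]
    ring
  exact hψ ▸ this

theorem mem_span_pointForms {z : Fin 4 → k} {c : Fin 4} (hc : z c ≠ 0) {p : R4 k} {d : ℕ}
    (hp : p.IsHomogeneous d) (h : eval z p = 0) :
    p ∈ Ideal.span (Set.range (pointForms z c)) := by
  set I := Ideal.span (Set.range (pointForms z c)) with hI
  rw [← Ideal.Quotient.eq_zero_iff_mem]
  have h1 : ∀ j, Ideal.Quotient.mkₐ k I (X j) =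
      Ideal.Quotient.mkₐ k I (X c) * algebraMap k (R4 k ⧸ I) (z j / z c) := by
    intro j
    by_cases hj : j = c
    · subst hj; simp [hc]
    · obtain ⟨i, rfl⟩ := Fin.exists_succAbove_eq hj
      have : pointForms z c i ∈ I := Ideal.subset_span ⟨i, rfl⟩
      have h2 := Ideal.Quotient.eq_zero_iff_mem.mpr this
      rw [pointForms, map_sub, sub_eq_zero] at h2
      rw [Ideal.Quotient.mkₐ_eq_mk, h2, map_mul, mul_comm]
      rfl
  have h2 : Ideal.Quotient.mkₐ k I p = 0 := by
    conv_lhs => rw [← aeval_X_left_apply p]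
    rw [comp_aeval_apply, show (fun j => Ideal.Quotient.mkₐ k I (X j)) = _ from funext h1]
    rw [aeval_mul_of_isHomogeneous hp]
    change _ * aeval (algebraMap k (R4 k ⧸ I) ∘ fun j => z j / z c) p = 0
    rw [aeval_algebraMap_apply]
    have h3 : (fun j => z j / z c) = (z c)⁻¹ • z := by
      funext j; simp [div_eq_inv_mul]
    rw [aeval_eq_eval, h3, eval_smul_of_isHomogeneous hp, h]
    simp
  exact h2

/-- The gradient of `p` at `z`. -/
noncomputable def gradAt (p : R4 k) (z : Fin 4 → k) : Fin 4 → k := fun i => eval z (pderiv i p)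

/-- Two forms of degree `a` meeting an irreducible cubic transversally. -/
structure TransversalCI (f g₁ g₂ : R4 k) (a : ℕ) : Prop where
  prime : Prime f
  hf : f.IsHomogeneous 3
  h₁ : g₁.IsHomogeneous a
  h₂ : g₂.IsHomogeneous a
  n₁ : ¬ f ∣ g₁
  n₂ : ¬ f ∣ g₂
  jac : ∀ z : Fin 4 → k, z ≠ 0 → eval z f = 0 → eval z g₁ = 0 → eval z g₂ = 0 →
    LinearIndependent k ![gradAt f z, gradAt g₁ z, gradAt g₂ z]

namespace TransversalCI

variable {f g₁ g₂ : R4 k} {a : ℕ}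

theorem exists_mul_pointForms_mem (hG : TransversalCI f g₁ g₂ a) {z : Fin 4 → k} {c : Fin 4}
    (hc : z c ≠ 0) (hzf : eval z f = 0) (hz₁ : eval z g₁ = 0) (hz₂ : eval z g₂ = 0) :
    ∃ r, eval z r ≠ 0 ∧ ∀ i, r * pointForms z c i ∈ Ideal.span {f, g₁, g₂} := by
  have hF : ∀ s : Fin 3, ∃ M : Fin 3 → R4 k, ∑ i, M i * pointForms z c i = ![f, g₁, g₂] s := by
    intro s
    rw [← Ideal.mem_span_range_iff_exists_fun]
    fin_cases s
    · exact mem_span_pointForms hc hG.hf hzf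
    · exact mem_span_pointForms hc hG.h₁ hz₁
    · exact mem_span_pointForms hc hG.h₂ hz₂
  choose M hM using hF
  let N : Matrix (Fin 3) (Fin 3) (R4 k) := Matrix.of M
  have hN : N.mulVec (pointForms z c) = ![f, g₁, g₂] := funext hM
  refine ⟨N.det, fun h0 => ?_, fun i => ?_⟩
  · rw [RingHom.map_det, RingHom.mapMatrix_apply] at h0
    obtain ⟨w, hw, hw0⟩ := Matrix.exists_vecMul_eq_zero_iff.mpr h0
    have hz : z ≠ 0 := fun h => hc (by rw [h]; rfl)
    have hli := Fintype.linearIndependent_iff.mp (hG.jac z hz hzf hz₁ hz₂) w (by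
      have hgrad : ∀ s j, ![gradAt f z, gradAt g₁ z, gradAt g₂ z] s j =
          ∑ i, eval z (M s i) * eval z (pderiv j (pointForms z c i)) := by
        intro s j
        have : ![gradAt f z, gradAt g₁ z, gradAt g₂ z] s j =
            eval z (pderiv j (![f, g₁, g₂] s)) := by
          fin_cases s <;> rfl
        rw [this, ← hM, map_sum, map_sum]
        refine Finset.sum_congr rfl fun i _ => ?_
        rw [Derivation.leibniz]
        simp [eval_pointForms hc]
      funext j
      simp only [Finset.sum_apply, Pi.smul_apply, smul_eq_mul, Pi.zero_apply]
      simp_rw [hgrad, Finset.mul_sum]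
      rw [Finset.sum_comm]
      refine Finset.sum_eq_zero fun i _ => ?_
      have := congrFun hw0 i
      simp only [Matrix.vecMul, dotProduct, Pi.zero_apply] at this
      calc _ = (∑ s, w s * eval z (M s i)) * eval z (pderiv j (pointForms z c i)) := by
            rw [Finset.sum_mul]
            exact Finset.sum_congr rfl fun s _ => by ring
        _ = 0 := by
            have h2 : ∑ s, w s * eval z (M s i) = 0 := this
            rw [h2, zero_mul])
    exact hw (funext hli)
  · have h1 : N.adjugate.mulVec (N.mulVec (pointForms z c)) = N.det • pointForms z c := by
      rw [Matrix.mulVec_mulVec, Matrix.adjugate_mul, Matrix.smul_mulVec, Matrix.one_mulVec]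
    have h2 := congrFun h1 i
    rw [hN] at h2
    simp only [Pi.smul_apply, smul_eq_mul] at h2
    rw [← h2]
    change ∑ s, N.adjugate i s * ![f, g₁, g₂] s ∈ _
    refine Ideal.sum_mem _ fun s _ => Ideal.mul_mem_left _ _ (Ideal.subset_span (α := R4 k) ?_)
    fin_cases s
    · exact Set.mem_insert _ _
    · exact Set.mem_insert_of_mem _ (Set.mem_insert _ _)
    · exact Set.mem_insert_of_mem _ (Set.mem_insert_of_mem _ rfl)

theorem exists_of_syzygy [IsAlgClosed k] (hG : TransversalCI f g₁ g₂ a) {u v : R4 k}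
    (h : f ∣ u * g₁ + v * g₂) : ∃ e, f ∣ u - e * g₂ := by
  rw [← mem_span_pair_iff_dvd]
  let J : Ideal (R4 k) := Submodule.comap (LinearMap.toSpanSingleton (R4 k) (R4 k) u) (Ideal.span {f, g₂})
  have hJ : ∀ r, r ∈ J ↔ r * u ∈ Ideal.span {f, g₂} := fun r => Iff.rfl
  have hI : ∀ r ∈ Ideal.span {f, g₁, g₂}, r * u ∈ Ideal.span {f, g₂} := by
    intro r hr
    obtain ⟨α, β, hr⟩ := mem_span_triple_iff_dvd.mp hr
    rw [mem_span_pair_iff_dvd]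
    exact ⟨β * u - α * v, dvd_of_eq_combo₂ u α hr h (by ring)⟩
  have hone := one_mem_of_saturated_of_no_zero (J := J) (by
      intro r hr
      rw [hJ]
      refine mem_span_pair_of_koszulTriple hG.prime
        (koszulTriple_X (k := k) (Fin.castSucc_injective 3))
        (not_dvd_of_degree_one hG.hf (isHomogeneous_X k _) (X_ne_zero _)) hG.n₂ fun i => ?_
      have := (hJ _).mp (hr i.castSucc)
      rwa [mul_assoc] at this) (by
      intro z hz
      by_cases h0 : eval z f = 0 ∧ eval z g₁ = 0 ∧ eval z g₂ = 0
      · obtain ⟨c, hc⟩ := Function.ne_iff.mp hz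
        obtain ⟨r, hr, hrI⟩ := hG.exists_mul_pointForms_mem hc h0.1 h0.2.1 h0.2.2
        refine ⟨r, (hJ r).mpr ?_, hr⟩
        have hK := koszulTriple_pointForms z c
        refine mem_span_pair_of_koszulTriple hG.prime hK
          (not_dvd_of_degree_one hG.hf (pointForms_isHomogeneous z c 0) hK.ne) hG.n₂ fun i => ?_
        have := hI _ (hrI i)
        rwa [mul_comm r, mul_assoc] at this
      · by_contra! hcon
        refine h0 ⟨hcon f ?_, hcon g₁ ?_, hcon g₂ ?_⟩ <;> rw [hJ] <;> apply hI <;>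
          exact Ideal.subset_span (by simp))
  simpa [hJ] using hone

/-- From the syzygies `p j * A i - p i * A j ≡ E i j * g₂`, deduce the analogous relations for the
second coefficients. -/
theorem dvd_second_of_first (hG : TransversalCI f g₁ g₂ a) {u v e : R4 k}
    (h : f ∣ u * g₁ + v * g₂) (he : f ∣ u - e * g₂) : f ∣ v + e * g₁ := by
  refine (hG.prime.dvd_or_dvd (?_ : f ∣ g₂ * _)).resolve_left hG.n₂
  exact dvd_of_eq_combo₂ 1 (-g₁) h he (by ring)

theorem mem_of_X_mul_mem [IsAlgClosed k] (hG : TransversalCI f g₁ g₂ a) {q : R4 k}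
    (h : ∀ i, X i * q ∈ Ideal.span {f, g₁, g₂}) : q ∈ Ideal.span {f, g₁, g₂} := by
  simp only [mem_span_triple_iff_dvd] at h ⊢
  choose A B hAB using h
  have hs : ∀ i j, f ∣ (X j * A i - X i * A j) * g₁ + (X j * B i - X i * B j) * g₂ := fun i j =>
    dvd_of_eq_combo₂ (X i) (-X j) (hAB j) (hAB i) (by ring)
  choose e he using fun i j => hG.exists_of_syzygy (hs i j)
  have he' := fun i j => hG.dvd_second_of_first (hs i j) (he i j)
  have hcoc : ∀ i j l, f ∣ X l * e i j + X i * e j l - X j * e i l := by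
    intro i j l
    refine (hG.prime.dvd_or_dvd (?_ : f ∣ g₂ * _)).resolve_left hG.n₂
    exact dvd_of_eq_combo₃ (-X l) (-X i) (X j) (he i j) (he j l) (he i l) (by ring)
  obtain ⟨τ, hτ⟩ := exists_koszul3_mod hG.prime.ne_zero
    (alt4_alt (e 2 3) (-e 1 3) (e 1 2) (e 0 3) (-e 0 2) (e 0 1)) (by
      intro i
      rw [Fin.sum_univ_four]
      fin_cases i <;> simp only [alt4]
      · exact dvd_of_eq_combo₁ 1 (hcoc 1 2 3) (by simp; ring)
      · exact dvd_of_eq_combo₁ (-1) (hcoc 0 2 3) (by simp; ring)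
      · exact dvd_of_eq_combo₁ 1 (hcoc 0 1 3) (by simp; ring)
      · exact dvd_of_eq_combo₁ (-1) (hcoc 0 1 2) (by simp; ring))
  have hlt : ∀ i j, i < j → f ∣ e i j - (X i * τ j - X j * τ i) := by
    intro i j hij
    have h01 := hτ 2 3
    have h02 := hτ 1 3
    have h03 := hτ 1 2
    have h12 := hτ 0 3
    have h13 := hτ 0 2
    have h23 := hτ 0 1
    simp [koszul3, alt4] at h01 h02 h03 h12 h13 h23
    fin_cases i <;> fin_cases j <;> first | (exact absurd hij (by decide)) | skip
    · exact h01
    · exact dvd_of_eq_combo₁ (-1) h02 (by simp; ring)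
    · exact h03
    · exact h12
    · exact dvd_of_eq_combo₁ (-1) h13 (by simp; ring)
    · exact h23
  have hA : ∀ i j, i < j → f ∣ X j * (A i + τ i * g₂) - X i * (A j + τ j * g₂) := fun i j hij =>
    dvd_of_eq_combo₂ 1 g₂ (he i j) (hlt i j hij) (by ring)
  have hB : ∀ i j, i < j → f ∣ X j * (B i - τ i * g₁) - X i * (B j - τ j * g₁) := fun i j hij =>
    dvd_of_eq_combo₂ 1 (-g₁) (he' i j) (hlt i j hij) (by ring)
  have hall : ∀ D : Fin 4 → R4 k, (∀ i j, i < j → f ∣ X j * D i - X i * D j) →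
      ∀ i j, f ∣ X j * D i - X i * D j := by
    intro D hD i j
    rcases lt_trichotomy i j with hij | rfl | hij
    · exact hD i j hij
    · simp
    · exact dvd_of_eq_combo₁ (-1) (hD j i hij) (by ring)
  obtain ⟨α, hα⟩ := exists_smul_mod_X hG.prime hG.hf (hall _ hA)
  obtain ⟨β, hβ⟩ := exists_smul_mod_X hG.prime hG.hf (hall _ hB)
  refine ⟨α, β, (hG.prime.dvd_or_dvd (?_ : f ∣ X 0 * _)).resolve_left
    (not_dvd_of_degree_one hG.hf (isHomogeneous_X k 0) (X_ne_zero 0))⟩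
  exact dvd_of_eq_combo₃ 1 g₁ g₂ (hAB 0) (hα 0) (hβ 0) (by ring)

/-- The ideal of a transversal complete intersection contains every form vanishing on it. -/
theorem mem_of_vanish [IsAlgClosed k] (hG : TransversalCI f g₁ g₂ a) {q : R4 k} {d : ℕ}
    (hq : q.IsHomogeneous d)
    (h : ∀ z : Fin 4 → k, z ≠ 0 → eval z f = 0 → eval z g₁ = 0 → eval z g₂ = 0 → eval z q = 0) :
    q ∈ Ideal.span {f, g₁, g₂} := by
  let J : Ideal (R4 k) := 
    Submodule.comap (LinearMap.toSpanSingleton (R4 k) (R4 k) q) (Ideal.span {f, g₁, g₂})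
  have hJ : ∀ r, r ∈ J ↔ r * q ∈ Ideal.span {f, g₁, g₂} := fun r => Iff.rfl
  have hone := one_mem_of_saturated_of_no_zero (J := J) (by
      intro r hr
      rw [hJ]
      refine hG.mem_of_X_mul_mem fun i => ?_
      have := (hJ _).mp (hr i)
      rwa [mul_assoc] at this) (by
      intro z hz
      by_cases h0 : eval z f = 0 ∧ eval z g₁ = 0 ∧ eval z g₂ = 0
      · obtain ⟨c, hc⟩ := Function.ne_iff.mp hz
        obtain ⟨r, hr, hrI⟩ := hG.exists_mul_pointForms_mem hc h0.1 h0.2.1 h0.2.2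
        refine ⟨r, (hJ r).mpr ?_, hr⟩
        obtain ⟨b, hb⟩ := Ideal.mem_span_range_iff_exists_fun.mp
          (mem_span_pointForms hc hq (h z hz h0.1 h0.2.1 h0.2.2))
        rw [← hb, Finset.mul_sum]
        refine Ideal.sum_mem _ fun i _ => ?_
        rw [mul_left_comm]
        exact Ideal.mul_mem_left _ _ (hrI i)
      · by_contra! hcon
        refine h0 ⟨hcon f ?_, hcon g₁ ?_, hcon g₂ ?_⟩ <;> rw [hJ] <;>
          exact Ideal.mul_mem_right _ _ (Ideal.subset_span (by simp)))
  simpa [hJ] using hone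

end TransversalCI

end CompleteIntersection

section CayleyBacharach

variable {k : Type} [Field k]

/-- Cayley–Bacharach: a form of degree `2a - 1` vanishing at all points but one of a transversal
complete intersection of type `(3, a, a)` vanishes at the remaining point. -/
theorem TransversalCI.eval_eq_zero_of_vanish_of_ne [IsAlgClosed k] {f g₁ g₂ : R4 k} {a : ℕ}
    (hG : TransversalCI f g₁ g₂ a) {q : R4 k} {d : ℕ} (hd : 1 + d = a + a)
    (hq : q.IsHomogeneous d) {z₀ : Fin 4 → k} (hz₀ : z₀ ≠ 0) (hzf : eval z₀ f = 0)
    (hz₁ : eval z₀ g₁ = 0) (hz₂ : eval z₀ g₂ = 0)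
    (h : ∀ z : Fin 4 → k, z ≠ 0 → eval z f = 0 → eval z g₁ = 0 → eval z g₂ = 0 →
      (∀ t : k, z ≠ t • z₀) → eval z q = 0) : eval z₀ q = 0 := by
  obtain ⟨c, hc⟩ := Function.ne_iff.mp hz₀
  have hl := pointForms_isHomogeneous z₀ c
  have hK := koszulTriple_pointForms z₀ c
  have hl0 := not_dvd_of_degree_one hG.hf (hl 0) hK.ne
  set l := pointForms z₀ c with hldef
  have hmem : ∀ i, l i * q ∈ Ideal.span {f, g₁, g₂} := by
    intro i
    refine hG.mem_of_vanish ((hl i).mul hq) fun z hz hf h1 h2 => ?_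
    rw [map_mul]
    by_cases hp : ∃ t : k, z = t • z₀
    · obtain ⟨t, rfl⟩ := hp
      rw [eval_smul_of_isHomogeneous (hl i), eval_pointForms hc, mul_zero, zero_mul]
    · rw [h z hz hf h1 h2 (not_exists.mp hp), mul_zero]
  have hAB' : ∀ i, ∃ A B : R4 k, A.IsHomogeneous a ∧ B.IsHomogeneous a ∧
      f ∣ l i * q - (A * g₁ + B * g₂) := by
    intro i
    obtain ⟨A, B, hAB⟩ := mem_span_triple_iff_dvd.mp (hmem i)
    refine ⟨homogeneousComponent a A, homogeneousComponent a B,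
      homogeneousComponent_isHomogeneous _ _, homogeneousComponent_isHomogeneous _ _, ?_⟩
    have := dvd_homogeneousComponent hG.hf hAB (a + a)
    rw [map_sub, map_add, ← hd, homogeneousComponent_of_isHomogeneous ((hl i).mul hq), hd,
      mul_comm A, mul_comm B, homogeneousComponent_mul_of_isHomogeneous hG.h₁,
      homogeneousComponent_mul_of_isHomogeneous hG.h₂] at this
    rwa [mul_comm _ g₁, mul_comm _ g₂]
  choose A B hA hB hAB using hAB'
  have hs : ∀ i j, f ∣ (l j * A i - l i * A j) * g₁ + (l j * B i - l i * B j) * g₂ := fun i j =>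
    dvd_of_eq_combo₂ (l i) (-l j) (hAB j) (hAB i) (by ring)
  have he0 : ∀ i j, ∃ e : R4 k, e.IsHomogeneous 1 ∧ f ∣ (l j * A i - l i * A j) - e * g₂ := by
    intro i j
    obtain ⟨e, he⟩ := hG.exists_of_syzygy (hs i j)
    refine ⟨homogeneousComponent 1 e, homogeneousComponent_isHomogeneous _ _, ?_⟩
    have := dvd_homogeneousComponent hG.hf he (a + 1)
    rw [map_sub, mul_comm e, homogeneousComponent_mul_of_isHomogeneous hG.h₂, add_comm a 1,
      homogeneousComponent_of_isHomogeneous (((hl j).mul (hA i)).sub ((hl i).mul (hA j)))] at this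
    rwa [mul_comm _ g₂]
  choose e hed he using he0
  have he' := fun i j => hG.dvd_second_of_first (hs i j) (he i j)
  have hcoc : l 0 * e 1 2 + l 1 * (-e 0 2) + l 2 * e 0 1 = 0 := by
    refine eq_zero_of_dvd_of_lt hG.hf (d := 2) ?_ ?_ (by norm_num)
    · refine (hG.prime.dvd_or_dvd (?_ : f ∣ g₂ * _)).resolve_left hG.n₂
      exact dvd_of_eq_combo₃ (-l 0) (-l 2) (l 1) (he 1 2) (he 0 1) (he 0 2) (by ring)
    · exact (((hl 0).mul (hed 1 2)).add ((hl 1).mul (hed 0 2).neg)).add ((hl 2).mul (hed 0 1))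
  obtain ⟨t₀, t₁, t₂, r₀, r₁, r₂⟩ := hK.exists_cross hcoc
  have hlt : ∀ i j, i < j → e i j = l i * ![t₀, t₁, t₂] j - l j * ![t₀, t₁, t₂] i := by
    intro i j hij
    fin_cases i <;> fin_cases j <;> first | (exact absurd hij (by decide)) | skip
    · exact r₂
    · change e 0 2 = l 0 * t₂ - l 2 * t₀
      linear_combination -r₁
    · exact r₀
  set t := ![t₀, t₁, t₂]
  have hall : ∀ D : Fin 3 → R4 k, (∀ i j, i < j → f ∣ l j * D i - l i * D j) →
      ∀ i j, f ∣ l j * D i - l i * D j := by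
    intro D hD i j
    rcases lt_trichotomy i j with hij | rfl | hij
    · exact hD i j hij
    · simp
    · exact dvd_of_eq_combo₁ (-1) (hD j i hij) (by ring)
  obtain ⟨α, hα⟩ := hK.exists_smul_mod hG.prime.ne_zero (a := fun i => A i + t i * g₂)
    (hall _ fun i j hij => dvd_of_eq_combo₁ 1 (he i j) (by rw [hlt i j hij]; ring))
  obtain ⟨β, hβ⟩ := hK.exists_smul_mod hG.prime.ne_zero (a := fun i => B i - t i * g₁)
    (hall _ fun i j hij => dvd_of_eq_combo₁ 1 (he' i j) (by rw [hlt i j hij]; ring))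
  obtain ⟨r, hr⟩ : f ∣ q - (α * g₁ + β * g₂) := by
    refine (hG.prime.dvd_or_dvd (?_ : f ∣ l 0 * _)).resolve_left hl0
    exact dvd_of_eq_combo₃ 1 g₁ g₂ (hAB 0) (hα 0) (hβ 0) (by ring)
  rw [sub_eq_iff_eq_add] at hr
  simp [hr, hzf, hz₁, hz₂]

end CayleyBacharach

section Liaison

variable {k : Type} [Field k]

/-- `p` vanishes at every vector of the family `v`. -/
def VanishesOn {ι : Type} (v : ι → Fin 4 → k) (p : R4 k) : Prop := ∀ i, eval (v i) p = 0

/-- Every family of `d`-forms through `v` that is a first order Koszul cycle modulo `f` is a Koszul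
boundary of forms through `v`. -/
def KoszulExact₁ (f : R4 k) {ι : Type} (v : ι → Fin 4 → k) (d : ℕ) : Prop :=
  ∀ y : Fin 4 → R4 k, (∀ i, (y i).IsHomogeneous (d + 1)) → (∀ i, VanishesOn v (y i)) →
    f ∣ ∑ i, X i * y i → ∃ U : Fin 4 → Fin 4 → R4 k, Alt4 U ∧ (∀ i j, (U i j).IsHomogeneous d) ∧
      (∀ i j, VanishesOn v (U i j)) ∧ ∀ i, f ∣ y i - ∑ j, X j * U i j

/-- Forms `F i` of degree `a` through `w` with `∑ X i * F i` divisible by `f` are all divisible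
by `f`. -/
def KoszulInjective (f : R4 k) {ι : Type} (w : ι → Fin 4 → k) (a : ℕ) : Prop :=
  ∀ F : Fin 4 → R4 k, (∀ i, (F i).IsHomogeneous a) → (∀ i, VanishesOn w (F i)) →
    f ∣ ∑ i, X i * F i → ∀ i, f ∣ F i

theorem TransversalCI.eval_eq_zero_of_koszulExact [IsAlgClosed k] {f g₁ g₂ : R4 k} {a : ℕ}
    (hG : TransversalCI f g₁ g₂ a) (ha : 1 ≤ a) {ι κ : Type} {v : ι → Fin 4 → k}
    {w : κ → Fin 4 → k} (hv0 : ∀ i, v i ≠ 0) (hvf : VanishesOn v f) (hv₁ : VanishesOn v g₁)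
    (hv₂ : VanishesOn v g₂)
    (hcover : ∀ z : Fin 4 → k, z ≠ 0 → eval z f = 0 → eval z g₁ = 0 → eval z g₂ = 0 →
      (∃ i, ∃ t : k, z = t • v i) ∨ ∃ i, ∃ t : k, z = t • w i)
    (hsep : ∀ i, ∃ e : R4 k, e.IsHomogeneous a ∧ eval (v i) e = 1 ∧ ∀ j ≠ i, eval (v j) e = 0)
    (hex : KoszulExact₁ f v a) {F : Fin 4 → R4 k} (hF : ∀ i, (F i).IsHomogeneous a)
    (hFw : ∀ i, VanishesOn w (F i)) (hfF : f ∣ ∑ i, X i * F i) (i₀ : ι) (s : Fin 4) :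
    eval (v i₀) (F s) = 0 := by
  obtain ⟨e, he, he1, he0⟩ := hsep i₀
  set z := v i₀ with hz
  suffices h : ∀ u : Fin 4 → k, ∑ i, eval z (F i) * u i = 0 by
    have := h (Pi.single s 1)
    rwa [Finset.sum_eq_single s (fun i _ hi => by rw [Pi.single_eq_of_ne hi, mul_zero])
      (fun h => absurd (Finset.mem_univ s) h), Pi.single_eq_same, mul_one] at this
  intro u
  have hFz : ∑ i, z i * eval z (F i) = 0 := by
    obtain ⟨c, hc⟩ := hfF
    have := congrArg (eval z) hc
    rw [map_mul, show eval z f = 0 from hvf i₀, zero_mul, map_sum] at this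
    simpa using this
  let τ : Fin 4 → Fin 4 → k := alt4 (z 2 * u 3 - z 3 * u 2) (z 3 * u 1 - z 1 * u 3)
    (z 1 * u 2 - z 2 * u 1) (z 0 * u 3 - z 3 * u 0) (z 2 * u 0 - z 0 * u 2) (z 0 * u 1 - z 1 * u 0)
  have hτ : Alt4 τ := alt4_alt ..
  have hτz : ∀ i, ∑ j, z j * τ i j = 0 := by
    intro i
    rw [Fin.sum_univ_four]
    fin_cases i <;> simp [τ, alt4] <;> ring
  have hT : Alt4 fun i j => C (τ i j) * e :=
    ⟨fun i => by rw [hτ.diag]; simp, fun i j => by rw [hτ.swap]; simp⟩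
  have hTd : ∀ i j, (C (τ i j) * e).IsHomogeneous a := fun i j => by
    simpa using (isHomogeneous_C (Fin 4) (τ i j)).mul he
  obtain ⟨U, hU, hUd, hUv, hUy⟩ := hex (fun i => ∑ j, X j * (C (τ i j) * e))
    (fun i => IsHomogeneous.sum _ _ _ fun j _ => by
      rw [add_comm]; exact (isHomogeneous_X k j).mul (hTd i j))
    (fun i p => by
      by_cases hp : p = i₀
      · subst hp
        have : ∑ j, z j * (τ i j * eval z e) = (∑ j, z j * τ i j) * eval z e := by
          rw [Finset.sum_mul]
          exact Finset.sum_congr rfl fun j _ => by ring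
        simp only [map_sum, map_mul, eval_X, eval_C]
        rw [this, hτz, zero_mul]
      · simp [he0 p hp])
    (by rw [hT.sum_sum]; exact dvd_zero f)
  let T : Fin 4 → Fin 4 → R4 k := fun i j => C (τ i j) * e - U i j
  have hTalt : Alt4 T := ⟨fun i => by simp [T, hτ.diag, hU.diag], fun i j => by
    simp only [T]; rw [hτ.swap, hU.swap]; simp; ring⟩
  have hTd' : ∀ i j, (T i j).IsHomogeneous a := fun i j => (hTd i j).sub (hUd i j)
  have hTX : ∀ i, f ∣ ∑ j, X j * T i j := fun i => by
    have := hUy i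
    rwa [← Finset.sum_sub_distrib, Finset.sum_congr rfl fun j _ => (mul_sub (X j) _ _).symm] at this
  have hTz : ∀ i j, eval z (T i j) = τ i j := fun i j => by
    have : eval z (U i j) = 0 := hUv i j i₀
    simp [T, he1, this]
  have hTv : ∀ p, p ≠ i₀ → ∀ i j, eval (v p) (T i j) = 0 := fun p hp i j => by
    have : eval (v p) (U i j) = 0 := hUv i j p
    simp [T, he0 p hp, this]
  let A : Fin 4 → R4 k := ![F 1 * T 2 3 - F 2 * T 1 3 + F 3 * T 1 2,
    -(F 0 * T 2 3 - F 2 * T 0 3 + F 3 * T 0 2), F 0 * T 1 3 - F 1 * T 0 3 + F 3 * T 0 1,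
    -(F 0 * T 1 2 - F 1 * T 0 2 + F 2 * T 0 1)]
  have hA : ∀ i, (A i).IsHomogeneous (a + a) := by
    have h := fun i j l => (hF i).mul (hTd' j l)
    intro i
    fin_cases i
    · exact ((h _ _ _).sub (h _ _ _)).add (h _ _ _)
    · exact (((h _ _ _).sub (h _ _ _)).add (h _ _ _)).neg
    · exact ((h _ _ _).sub (h _ _ _)).add (h _ _ _)
    · exact (((h _ _ _).sub (h _ _ _)).add (h _ _ _)).neg
  have hAX : ∀ i j, i < j → f ∣ X j * A i - X i * A j := by
    have h0 := hTX 0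
    have h1 := hTX 1
    have h2 := hTX 2
    have h3 := hTX 3
    simp only [Fin.sum_univ_four, hTalt.diag, hTalt.swap 1 0, hTalt.swap 2 0, hTalt.swap 2 1,
      hTalt.swap 3 0, hTalt.swap 3 1, hTalt.swap 3 2] at h0 h1 h2 h3 hfF
    intro i j hij
    fin_cases i <;> fin_cases j <;> first | (exact absurd hij (by decide)) | skip
    · exact dvd_of_eq_combo₃ (T 2 3) (F 2) (-F 3) hfF h3 h2 (by simp [A]; ring)
    · exact dvd_of_eq_combo₃ (-T 1 3) (-F 1) (F 3) hfF h3 h1 (by simp [A]; ring)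
    · exact dvd_of_eq_combo₃ (T 1 2) (F 1) (-F 2) hfF h2 h1 (by simp [A]; ring)
    · exact dvd_of_eq_combo₃ (T 0 3) (F 0) (-F 3) hfF h3 h0 (by simp [A]; ring)
    · exact dvd_of_eq_combo₃ (-T 0 2) (-F 0) (F 2) hfF h2 h0 (by simp [A]; ring)
    · exact dvd_of_eq_combo₃ (T 0 1) (F 0) (-F 1) hfF h1 h0 (by simp [A]; ring)
  obtain ⟨p', hp'⟩ := exists_smul_mod_X hG.prime hG.hf (a := A) fun i j => by
    rcases lt_trichotomy i j with hij | rfl | hij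
    · exact hAX i j hij
    · simp
    · exact dvd_of_eq_combo₁ (-1) (hAX j i hij) (by ring)
  set p := homogeneousComponent (a + a - 1) p' with hpdef
  have hpA : ∀ i, f ∣ A i - X i * p := fun i => by
    have := dvd_homogeneousComponent hG.hf (hp' i) ((a + a - 1) + 1)
    rwa [map_sub, homogeneousComponent_succ_X_mul, Nat.sub_add_cancel (by omega),
      homogeneousComponent_of_isHomogeneous (hA i)] at this
  have hpz : ∀ x : Fin 4 → k, eval x f = 0 → ∀ i, eval x (A i) = x i * eval x p := by
    intro x hx i
    obtain ⟨c, hc⟩ := hpA i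
    have := congrArg (eval x) hc
    rw [map_mul, hx, zero_mul, map_sub, sub_eq_zero] at this
    simpa using this
  have hpd : p.IsHomogeneous (a + a - 1) := homogeneousComponent_isHomogeneous _ _
  have hp0 : eval z p = 0 := by
    refine hG.eval_eq_zero_of_vanish_of_ne (d := a + a - 1) (by omega) hpd (hv0 i₀) (hvf i₀)
      (hv₁ i₀) (hv₂ i₀) fun x hx hxf h1 h2 hne => ?_
    obtain ⟨c, hc⟩ := Function.ne_iff.mp hx
    suffices h : eval x (A c) = 0 by
      rw [hpz x hxf] at h
      exact (mul_eq_zero.mp h).resolve_left hc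
    rcases hcover x hx hxf h1 h2 with ⟨i, t, rfl⟩ | ⟨i, t, rfl⟩
    · have hi : i ≠ i₀ := fun h => hne t (by rw [h])
      rw [eval_smul_of_isHomogeneous (hA c)]
      have := hTv i hi
      fin_cases c <;> simp [A, this]
    · rw [eval_smul_of_isHomogeneous (hA c)]
      have : ∀ s, eval (w i) (F s) = 0 := fun s => hFw s i
      fin_cases c <;> simp [A, this]
  obtain ⟨c, hc⟩ := Function.ne_iff.mp (hv0 i₀)
  suffices h : z c * ∑ i, eval z (F i) * u i = 0 from (mul_eq_zero.mp h).resolve_left hc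
  have hAc := hpz z (hvf i₀) c
  rw [hp0, mul_zero] at hAc
  rw [← hAc]
  rw [Fin.sum_univ_four] at hFz ⊢
  fin_cases c <;> simp [A, hTz] <;> simp [τ, alt4]
  · linear_combination u 0 * hFz
  · linear_combination u 1 * hFz
  · linear_combination u 2 * hFz
  · linear_combination u 3 * hFz

theorem TransversalCI.koszulInjective [IsAlgClosed k] {f g₁ g₂ : R4 k} {a : ℕ}
    (hG : TransversalCI f g₁ g₂ a) (ha : 2 ≤ a) {ι κ : Type} {v : ι → Fin 4 → k}
    {w : κ → Fin 4 → k} (hv0 : ∀ i, v i ≠ 0) (hvf : VanishesOn v f) (hv₁ : VanishesOn v g₁)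
    (hv₂ : VanishesOn v g₂)
    (hcover : ∀ z : Fin 4 → k, z ≠ 0 → eval z f = 0 → eval z g₁ = 0 → eval z g₂ = 0 →
      (∃ i, ∃ t : k, z = t • v i) ∨ ∃ i, ∃ t : k, z = t • w i)
    (hsep : ∀ i, ∃ e : R4 k, e.IsHomogeneous a ∧ eval (v i) e = 1 ∧ ∀ j ≠ i, eval (v j) e = 0)
    (hex : KoszulExact₁ f v a) : KoszulInjective f w a := by
  intro F hF hFw hfF
  have hmem : ∀ s, ∃ A B : R4 k, A.IsHomogeneous 0 ∧ B.IsHomogeneous 0 ∧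
      f ∣ F s - (A * g₁ + B * g₂) := by
    intro s
    have : F s ∈ Ideal.span {f, g₁, g₂} := by
      refine hG.mem_of_vanish (hF s) fun z hz hzf h1 h2 => ?_
      rcases hcover z hz hzf h1 h2 with ⟨i, t, rfl⟩ | ⟨i, t, rfl⟩
      · rw [eval_smul_of_isHomogeneous (hF s), hG.eval_eq_zero_of_koszulExact (by omega) hv0 hvf
          hv₁ hv₂ hcover hsep hex hF hFw hfF, mul_zero]
      · rw [eval_smul_of_isHomogeneous (hF s), hFw s i, mul_zero]
    obtain ⟨A, B, hAB⟩ := mem_span_triple_iff_dvd.mp this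
    refine ⟨homogeneousComponent 0 A, homogeneousComponent 0 B,
      homogeneousComponent_isHomogeneous _ _, homogeneousComponent_isHomogeneous _ _, ?_⟩
    have := dvd_homogeneousComponent hG.hf hAB (a + 0)
    rw [map_sub, map_add, mul_comm A, mul_comm B, homogeneousComponent_mul_of_isHomogeneous hG.h₁,
      homogeneousComponent_mul_of_isHomogeneous hG.h₂, add_zero,
      homogeneousComponent_of_isHomogeneous (hF s)] at this
    rwa [mul_comm _ g₁, mul_comm _ g₂]
  choose A B hA hB hAB using hmem
  have hs : f ∣ (∑ i, X i * A i) * g₁ + (∑ i, X i * B i) * g₂ := by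
    have h1 : f ∣ ∑ i, X i * (F i - (A i * g₁ + B i * g₂)) :=
      Finset.dvd_sum fun i _ => (hAB i).mul_left _
    refine dvd_of_eq_combo₂ 1 (-1) hfF h1 ?_
    simp only [Fin.sum_univ_four]; ring
  obtain ⟨e, he⟩ := hG.exists_of_syzygy hs
  have he' := hG.dvd_second_of_first hs he
  have hlow : ∀ g : R4 k, g.IsHomogeneous a → homogeneousComponent 1 (e * g) = 0 := fun g hg => by
    rw [mul_comm]; exact homogeneousComponent_mul_of_lt hg (by omega)
  have hlin : ∀ D : Fin 4 → R4 k, (∀ i, (D i).IsHomogeneous 0) → ∀ r,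
      homogeneousComponent 1 r = 0 → f ∣ (∑ i, X i * D i) + r → ∀ i, D i = 0 := by
    intro D hD r hr hdvd
    have hsum : (∑ i, X i * D i).IsHomogeneous 1 :=
      IsHomogeneous.sum _ _ _ fun i _ => (isHomogeneous_X k i).mul (hD i)
    have := dvd_homogeneousComponent hG.hf hdvd 1
    rw [map_add, hr, add_zero, homogeneousComponent_of_isHomogeneous hsum] at this
    exact eq_zero_of_sum_X_mul_eq_zero_of_degree_zero hD
      (eq_zero_of_dvd_of_lt hG.hf this hsum (by norm_num))
  have hA0 := hlin A hA (-(e * g₂)) (by rw [map_neg, hlow _ hG.h₂, neg_zero])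
    (by rwa [← sub_eq_add_neg])
  have hB0 := hlin B hB (e * g₁) (hlow _ hG.h₁) he'
  intro i
  have := hAB i
  rwa [hA0, hB0, zero_mul, zero_mul, add_zero, sub_zero] at this

end Liaison

section FromResolution

variable {k : Type} [Field k]

theorem EntryOk.isHomogeneous {d c : ℕ} {q : R4 k} (h : EntryOk k (d + c) d q) :
    q.IsHomogeneous c := by
  rcases h.1 with rfl | ⟨e, he, hq⟩
  · exact isHomogeneous_zero _ _ _
  · obtain rfl : c = e := by omega
    exact hq

theorem homogeneousComponent_sum_mul {ι : Type} [Fintype ι] (u M : ι → R4 k) {c : ℕ}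
    (hM : ∀ i, (M i).IsHomogeneous c) (d : ℕ) :
    homogeneousComponent (d + c) (∑ i, u i * M i) = ∑ i, homogeneousComponent d (u i) * M i := by
  rw [map_sum]
  refine Finset.sum_congr rfl fun i _ => ?_
  rw [mul_comm, add_comm, homogeneousComponent_mul_of_isHomogeneous (hM i), mul_comm]

theorem sum_sum_mul_comm {R ι κ : Type*} [CommSemiring R] [Fintype ι] [Fintype κ] (x : ι → R)
    (w : ι → κ → R) (g : κ → R) :
    ∑ r, (∑ i, x i * w i r) * g r = ∑ i, x i * ∑ r, w i r * g r := by
  simp only [Finset.mul_sum, Finset.sum_mul, mul_assoc]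
  exact Finset.sum_comm

theorem Res3Body.koszulExact₁ {f : R4 k} (hf : f.IsHomogeneous 3) {I : Ideal (R4 k)} {ι : Type}
    {v : ι → Fin 4 → k} (hI : ∀ (p : R4 k) (d : ℕ), p.IsHomogeneous d → (p ∈ I ↔ VanishesOn v p))
    {n1 n2 n3 a : ℕ} {d3 : Fin n3 → ℕ} {g : Fin n1 → R4 k} {M2 : Fin n2 → Fin n1 → R4 k}
    {M3 : Fin n3 → Fin n2 → R4 k}
    (h : Res3Body k (Ideal.span {f}) I (fun _ => a) (fun _ => a + 1) d3 g M2 M3) :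
    KoszulExact₁ f v a := by
  obtain ⟨hg, hgen, hM2, -, hsyz, -, -⟩ := h
  have hM : ∀ s r, (M2 s r).IsHomogeneous 1 := fun s r => (hM2 s r).isHomogeneous
  have hrow : ∀ s, f ∣ ∑ r, M2 s r * g r := fun s => Ideal.mem_span_singleton.mp <|
    (hsyz (M2 s)).mpr ⟨Pi.single s 1, fun r => by
      rw [Finset.sum_eq_single s (fun i _ hi => by rw [Pi.single_eq_of_ne hi, zero_mul])
        (fun h => absurd (Finset.mem_univ s) h), Pi.single_eq_same, one_mul]⟩
  intro y hy hyv hfy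
  have hw : ∀ i, ∃ w : Fin n1 → R4 k, (∀ r, (w r).IsHomogeneous 1) ∧
      f ∣ y i - ∑ r, w r * g r := by
    intro i
    obtain ⟨w, hw⟩ := hgen (y i) ((hI _ _ (hy i)).mpr (hyv i))
    refine ⟨fun r => homogeneousComponent 1 (w r),
      fun r => homogeneousComponent_isHomogeneous _ _, ?_⟩
    have := dvd_homogeneousComponent hf (Ideal.mem_span_singleton.mp hw) (a + 1)
    rwa [map_sub, homogeneousComponent_of_isHomogeneous (hy i), add_comm,
      homogeneousComponent_sum_mul _ _ fun r => (hg r).2] at this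
  choose w hw1 hw using hw
  obtain ⟨u, hu⟩ := (hsyz fun r => ∑ i, X i * w i r).mp (by
    rw [Ideal.mem_span_singleton]
    have h1 : f ∣ ∑ i, X i * (y i - ∑ r, w i r * g r) :=
      Finset.dvd_sum fun i _ => (hw i).mul_left _
    refine dvd_of_eq_combo₂ 1 (-1) hfy h1 ?_
    rw [sum_sum_mul_comm]
    simp only [mul_sub, Finset.sum_sub_distrib]
    ring)
  have hc : ∀ s, ∃ c : Fin 4 → R4 k, (∀ i, (c i).IsHomogeneous 0) ∧
      homogeneousComponent 1 (u s) = ∑ i, X i * c i :=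
    fun s => exists_sum_X_mul_of_isHomogeneous (homogeneousComponent_isHomogeneous 1 (u s))
  choose c hc hcu using hc
  have hu2 : ∀ r, ∑ i, X i * w i r = ∑ s, (∑ i, X i * c s i) * M2 s r := by
    intro r
    have h1 := congrArg (homogeneousComponent 2) (hu r)
    rw [homogeneousComponent_of_isHomogeneous (IsHomogeneous.sum _ _ _ fun i _ =>
      (isHomogeneous_X k i).mul (hw1 i r)), homogeneousComponent_sum_mul _ _ fun s => hM s r] at h1
    simpa only [hcu] using h1
  have hV : ∀ r, ∃ V : Fin 4 → Fin 4 → R4 k, Alt4 V ∧ (∀ i j, (V i j).IsHomogeneous 0) ∧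
      ∀ i, w i r - ∑ s, c s i * M2 s r = ∑ j, X j * V i j := by
    intro r
    refine exists_homogeneous_alt (fun i => (hw1 i r).sub (IsHomogeneous.sum _ _ _ fun s _ => ?_)) ?_
    · simpa using (hc s i).mul (hM s r)
    · simp only [mul_sub, Finset.sum_sub_distrib]
      rw [hu2, sub_eq_zero]
      simp only [Finset.sum_mul, Finset.mul_sum, mul_assoc]
      exact Finset.sum_comm
  choose V hV hV0 hVw using hV
  have hU0 : ∀ i j, (∑ r, V r i j * g r).IsHomogeneous a := fun i j =>
    IsHomogeneous.sum _ _ _ fun r _ => by simpa using (hV0 r i j).mul (hg r).2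
  refine ⟨fun i j => ∑ r, V r i j * g r, ⟨fun i => ?_, fun i j => ?_⟩, hU0, fun i j => ?_,
    fun i => ?_⟩
  · simp only [(hV _).diag, zero_mul, Finset.sum_const_zero]
  · rw [← Finset.sum_neg_distrib]
    exact Finset.sum_congr rfl fun r _ => by rw [(hV r).swap]; ring
  · exact (hI _ _ (hU0 i j)).mp (Ideal.sum_mem _ fun r _ => Ideal.mul_mem_left _ _ (hg r).1)
  · have h1 : f ∣ ∑ s, c s i * ∑ r, M2 s r * g r := Finset.dvd_sum fun s _ => (hrow s).mul_left _
    refine dvd_of_eq_combo₂ 1 1 (hw i) h1 ?_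
    have h2 : ∑ r, w i r * g r - ∑ s, c s i * ∑ r, M2 s r * g r =
        ∑ r, (w i r - ∑ s, c s i * M2 s r) * g r := by
      rw [← sum_sum_mul_comm, ← Finset.sum_sub_distrib]
      exact Finset.sum_congr rfl fun r _ => by ring
    rw [← sum_sum_mul_comm]
    simp only [← hVw]
    rw [← h2]
    ring

theorem not_res3Body_linear {f : R4 k} {I : Ideal (R4 k)} {d3 : Fin 0 → ℕ} {g : Fin 3 → R4 k}
    {n2 : ℕ} {M2 : Fin n2 → Fin 3 → R4 k} {M3 : Fin 0 → Fin n2 → R4 k} :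
    ¬ Res3Body k (Ideal.span {f}) I (fun _ => 1) (fun _ => 1 + 1) d3 g M2 M3 := by
  rintro ⟨hg, -, hM2, -, hsyz, hsyz2, -⟩
  have hM : ∀ s r, (M2 s r).IsHomogeneous 1 := fun s r => (hM2 s r).isHomogeneous
  have hinj : ∀ u : Fin n2 → R4 k, (∀ j, ∑ i, u i * M2 i j = 0) → ∀ i, u i = 0 := by
    intro u hu i
    obtain ⟨t, ht⟩ := (hsyz2 u).mp hu
    simpa using ht i
  have hconst : ∀ w : Fin 3 → R4 k, (∀ j, (w j).IsHomogeneous 0) →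
      ∑ j, w j * g j = 0 → ∀ j, w j = 0 := by
    intro w hw hw0 j
    obtain ⟨u, hu⟩ := (hsyz w).mp (by rw [hw0]; exact Ideal.zero_mem _)
    have := congrArg (homogeneousComponent 0) (hu j)
    rw [homogeneousComponent_of_isHomogeneous (hw j), map_sum] at this
    rw [this]
    exact Finset.sum_eq_zero fun i _ => by
      rw [mul_comm]; exact homogeneousComponent_mul_of_lt (hM i j) one_pos
  have hκ : ∀ w : Fin 3 → R4 k, (∀ j, (w j).IsHomogeneous 1) → ∑ j, w j * g j = 0 →
      ∃ c : Fin n2 → R4 k, (∀ s, (c s).IsHomogeneous 0) ∧ ∀ j, w j = ∑ s, c s * M2 s j := by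
    intro w hw hw0
    obtain ⟨u, hu⟩ := (hsyz w).mp (by rw [hw0]; exact Ideal.zero_mem _)
    refine ⟨fun s => homogeneousComponent 0 (u s), fun s => homogeneousComponent_isHomogeneous _ _,
      fun j => ?_⟩
    have := congrArg (homogeneousComponent (0 + 1)) (hu j)
    rwa [homogeneousComponent_of_isHomogeneous (hw j),
      homogeneousComponent_sum_mul _ _ fun s => hM s j] at this
  have hg1 := fun j => (hg j).2
  have hz := isHomogeneous_zero (Fin 4) k 1
  obtain ⟨p, hp0, hp⟩ := hκ ![g 1, -g 0, 0] (by
    intro j; fin_cases j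
    exacts [hg1 1, (hg1 0).neg, hz]) (by simp [Fin.sum_univ_three]; ring)
  obtain ⟨q, hq0, hq⟩ := hκ ![g 2, 0, -g 0] (by
    intro j; fin_cases j
    exacts [hg1 2, hz, (hg1 0).neg]) (by simp [Fin.sum_univ_three]; ring)
  obtain ⟨r, hr0, hr⟩ := hκ ![0, g 2, -g 1] (by
    intro j; fin_cases j
    exacts [hz, hg1 2, (hg1 1).neg]) (by simp [Fin.sum_univ_three]; ring)
  have hrel := hinj (fun s => g 2 * p s - g 1 * q s + g 0 * r s) (by
    intro j
    have : ∑ s, (g 2 * p s - g 1 * q s + g 0 * r s) * M2 s j =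
        g 2 * (∑ s, p s * M2 s j) - g 1 * (∑ s, q s * M2 s j) + g 0 * ∑ s, r s * M2 s j := by
      simp only [Finset.mul_sum, ← Finset.sum_sub_distrib, ← Finset.sum_add_distrib]
      exact Finset.sum_congr rfl fun s _ => by ring
    rw [this, ← hp, ← hq, ← hr]
    fin_cases j <;> simp <;> ring)
  have hcoef : ∀ s, p s = 0 ∧ q s = 0 := by
    intro s
    have := hconst ![r s, -q s, p s] (by
      intro j; fin_cases j
      exacts [hr0 s, (hq0 s).neg, hp0 s]) (by
      rw [Fin.sum_univ_three]
      exact (by simp; ring : _ = g 2 * p s - g 1 * q s + g 0 * r s).trans (hrel s))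
    exact ⟨this 2, neg_eq_zero.mp (this 1)⟩
  have h0 : ∀ j, g j = 0 := by
    have h1 := hp 0
    have h2 := hp 1
    have h3 := hq 0
    simp [hcoef] at h1 h2 h3
    intro j; fin_cases j
    exacts [h2, h1, h3]
  have := hconst (fun _ => 1) (fun _ => isHomogeneous_one _ _) (by simp [h0]) 0
  exact one_ne_zero this

end FromResolution

section Interpolation

variable {k : Type} [Field k]

/-- Forms of degree `d` take arbitrary values at the vectors `w i`. -/
def Interpolates {ι : Type} (w : ι → Fin 4 → k) (d : ℕ) : Prop :=
  ∀ c : ι → k, ∃ p : R4 k, p.IsHomogeneous d ∧ ∀ i, eval (w i) p = c i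

theorem exists_dual_family {ι : Type} {w : ι → Fin 4 → k} (hw : ∀ i, w i ≠ 0) :
    ∃ μ : ι → Fin 4 → k, ∀ i, ∑ j, μ i j * w i j = 1 := by
  have h : ∀ i, ∃ j, w i j ≠ 0 := fun i => Function.ne_iff.mp (hw i)
  choose c hc using h
  refine ⟨fun i => Pi.single (c i) (w i (c i))⁻¹, fun i => ?_⟩
  change ∑ j, (Pi.single (c i) (w i (c i))⁻¹ : Fin 4 → k) j * w i j = 1
  rw [Finset.sum_eq_single (c i) (fun j _ hj => by rw [Pi.single_eq_of_ne hj, zero_mul])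
    (fun h => absurd (Finset.mem_univ _) h), Pi.single_eq_same, inv_mul_cancel₀ (hc i)]

/-- Lift an alternating array along a relation compatible with zero and negation. -/
theorem Alt4.exists_lift {M N : Type} [AddGroup M] [AddGroup N] {y : Fin 4 → Fin 4 → M}
    (hy : Alt4 y) {P : M → N → Prop} (h0 : P 0 0) (hneg : ∀ m n, P m n → P (-m) (-n))
    (h : ∀ i j, ∃ n, P (y i j) n) : ∃ V : Fin 4 → Fin 4 → N, Alt4 V ∧ ∀ i j, P (y i j) (V i j) := by
  choose v hv using h
  refine ⟨alt4 (v 0 1) (v 0 2) (v 0 3) (v 1 2) (v 1 3) (v 2 3), alt4_alt .., fun i j => ?_⟩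
  fin_cases i <;> fin_cases j <;> simp only [alt4] <;>
    first
    | exact hv _ _
    | exact (hy.diag _).symm ▸ h0
    | (have := hneg _ _ (hv 0 1); rw [← hy.swap] at this; exact this)
    | (have := hneg _ _ (hv 0 2); rw [← hy.swap] at this; exact this)
    | (have := hneg _ _ (hv 0 3); rw [← hy.swap] at this; exact this)
    | (have := hneg _ _ (hv 1 2); rw [← hy.swap] at this; exact this)
    | (have := hneg _ _ (hv 1 3); rw [← hy.swap] at this; exact this)
    | (have := hneg _ _ (hv 2 3); rw [← hy.swap] at this; exact this)

theorem Interpolates.exists_alt {ι : Type} {w : ι → Fin 4 → k} {d : ℕ} (h : Interpolates w d)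
    {u : Fin 4 → Fin 4 → ι → k} (hu : Alt4 u) :
    ∃ U : Fin 4 → Fin 4 → R4 k, Alt4 U ∧ ∀ i j, (U i j).IsHomogeneous d ∧
      ∀ p, eval (w p) (U i j) = u i j p :=
  hu.exists_lift (P := fun c (U : R4 k) => U.IsHomogeneous d ∧ ∀ p, eval (w p) U = c p)
    ⟨isHomogeneous_zero _ _ _, fun _ => by simp⟩
    (fun m n hn => ⟨hn.1.neg, fun p => by rw [map_neg, hn.2]; rfl⟩) (fun i j => h _)

theorem Interpolates.exists_sum_X_mul {ι : Type} {w : ι → Fin 4 → k} (hw : ∀ i, w i ≠ 0) {d : ℕ}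
    (h : Interpolates w d) {y : R4 k} (hy : y.IsHomogeneous (d + 2)) (hyw : VanishesOn w y) :
    ∃ q : Fin 4 → R4 k, (∀ i, (q i).IsHomogeneous (d + 1)) ∧ (∀ i, VanishesOn w (q i)) ∧
      y = ∑ i, X i * q i := by
  obtain ⟨μ, hμ⟩ := exists_dual_family hw
  obtain ⟨q, hq, rfl⟩ := exists_sum_X_mul_of_isHomogeneous hy
  have hq0 : ∀ p, ∑ i, w p i * eval (w p) (q i) = 0 := fun p => by simpa using hyw p
  obtain ⟨U, hU, hUd⟩ := h.exists_alt
    (u := fun i j p => μ p j * eval (w p) (q i) - μ p i * eval (w p) (q j))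
    ⟨fun i => by funext p; simp, fun i j => by funext p; simp⟩
  refine ⟨fun i => q i - ∑ j, X j * U i j, fun i => (hq i).sub (IsHomogeneous.sum _ _ _ fun j _ => by
    rw [add_comm]; exact (isHomogeneous_X k j).mul (hUd i j).1), fun i p => ?_, ?_⟩
  · simp only [map_sub, map_sum, map_mul, eval_X, (hUd _ _).2]
    have h1 := hq0 p
    have h2 := hμ p
    rw [Fin.sum_univ_four] at h1 h2 ⊢
    linear_combination (-eval (w p) (q i)) * h2 + μ p i * h1
  · simp only [mul_sub, Finset.sum_sub_distrib, hU.sum_sum, sub_zero]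

theorem alt4_induction {M : Type} [AddGroup M] {P : M → Prop} (h0 : P 0)
    (hneg : ∀ m, P m → P (-m)) {a b c d e f : M} (ha : P a) (hb : P b) (hc : P c) (hd : P d)
    (he : P e) (hf : P f) (i j : Fin 4) : P (alt4 a b c d e f i j) := by
  fin_cases i <;> fin_cases j <;> first
    | exact h0
    | assumption
    | exact hneg _ ‹_›

theorem koszul3_isHomogeneous {τ : Fin 4 → R4 k} {d : ℕ} (h : ∀ l, (τ l).IsHomogeneous d)
    (i j : Fin 4) : (koszul3 τ i j).IsHomogeneous (d + 1) := by
  have h' : ∀ l m n o, (X l * τ m - X n * τ o : R4 k).IsHomogeneous (d + 1) := fun l m n o => by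
    rw [add_comm]
    exact ((isHomogeneous_X k l).mul (h m)).sub ((isHomogeneous_X k n).mul (h o))
  exact alt4_induction (P := fun p : R4 k => p.IsHomogeneous (d + 1)) (isHomogeneous_zero _ _ _)
    (fun _ h => h.neg) (h' _ _ _ _) (h' _ _ _ _) (h' _ _ _ _) (h' _ _ _ _) (h' _ _ _ _)
    (h' _ _ _ _) i j

theorem Interpolates.koszulExact₁ {ι : Type} {w : ι → Fin 4 → k} (hw : ∀ i, w i ≠ 0) {d : ℕ}
    (hd : 1 ≤ d) (h : Interpolates w d) {f : R4 k} (hf : f.IsHomogeneous 3) (hfw : VanishesOn w f) :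
    KoszulExact₁ f w (d + 1) := by
  intro y hy hyw hfy
  obtain ⟨μ, hμ⟩ := exists_dual_family hw
  obtain ⟨U, hU, hUd, hUy⟩ := exists_homogeneous_alt_mod hf (by omega) hy hfy
  have hU0 : ∀ p i, ∑ j, w p j * eval (w p) (U i j) = 0 := by
    intro p i
    obtain ⟨c, hc⟩ := hUy i
    have := congrArg (eval (w p)) hc
    rw [map_mul, show eval (w p) f = 0 from hfw p, zero_mul, map_sub, hyw i p] at this
    simpa using this
  let T : Fin 4 → Fin 4 → Fin 4 → ι → k := fun i j l p => μ p l * eval (w p) (U i j) +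
    μ p i * eval (w p) (U j l) - μ p j * eval (w p) (U i l)
  have hτ : ∀ l, ∃ t : R4 k, t.IsHomogeneous d ∧ ∀ p, eval (w p) t =
      ![-T 1 2 3 p, T 0 2 3 p, -T 0 1 3 p, T 0 1 2 p] l := fun l => h _
  choose τ hτd hτ using hτ
  refine ⟨fun i j => U i j - koszul3 τ i j, ⟨fun i => ?_, fun i j => ?_⟩, fun i j =>
    (hUd i j).sub (koszul3_isHomogeneous hτd i j), fun i j p => ?_, fun i => ?_⟩
  · rw [hU.diag, (koszul3_alt τ).diag, sub_zero]
  · rw [hU.swap, (koszul3_alt τ).swap]; ring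
  · have h0 := hU0 p 0
    have h1 := hU0 p 1
    have h2 := hU0 p 2
    have h3 := hU0 p 3
    have hm := hμ p
    simp only [Fin.sum_univ_four, hU.diag, hU.swap 1 0, hU.swap 2 0, hU.swap 2 1, hU.swap 3 0,
      hU.swap 3 1, hU.swap 3 2, map_neg, map_zero] at h0 h1 h2 h3 hm
    have key : ∀ i j, i < j → eval (w p) (U i j - koszul3 τ i j) = 0 := by
      intro i j hij
      fin_cases i <;> fin_cases j <;> first | (exact absurd hij (by decide)) | skip
      all_goals simp [koszul3, alt4, hτ, T]
      · linear_combination (-eval (w p) (U 0 1)) * hm + μ p 1 * h0 - μ p 0 * h1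
      · linear_combination (-eval (w p) (U 0 2)) * hm + μ p 2 * h0 - μ p 0 * h2
      · linear_combination (-eval (w p) (U 0 3)) * hm + μ p 3 * h0 - μ p 0 * h3
      · linear_combination (-eval (w p) (U 1 2)) * hm + μ p 2 * h1 - μ p 1 * h2
      · linear_combination (-eval (w p) (U 1 3)) * hm + μ p 3 * h1 - μ p 1 * h3
      · linear_combination (-eval (w p) (U 2 3)) * hm + μ p 3 * h2 - μ p 2 * h3
    change eval (w p) (U i j - koszul3 τ i j) = 0
    rcases lt_trichotomy i j with hij | rfl | hij
    · exact key i j hij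
    · simp [hU.diag, (koszul3_alt τ).diag]
    · have := key j i hij
      rw [hU.swap, (koszul3_alt τ).swap]
      simp only [map_sub, map_neg] at this ⊢
      linear_combination -this
  · simp only [mul_sub, Finset.sum_sub_distrib, sum_X_mul_koszul3, sub_zero]
    exact hUy i

theorem koszul3_sub_X_mul (τ : Fin 4 → R4 k) (σ : R4 k) :
    koszul3 (fun l => τ l - X l * σ) = koszul3 τ := by
  funext i j
  fin_cases i <;> fin_cases j <;> simp [koszul3, alt4] <;> ring

theorem proportional_of_koszul3 {x t : Fin 4 → k} {τ : Fin 4 → R4 k}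
    (ht : ∀ l, eval x (τ l) = t l) (h : ∀ i j, eval x (koszul3 τ i j) = 0) (i j : Fin 4) :
    x i * t j = x j * t i := by
  have h01 := h 0 1
  have h02 := h 0 2
  have h03 := h 0 3
  have h12 := h 1 2
  have h13 := h 1 3
  have h23 := h 2 3
  simp [koszul3, alt4, ht] at h01 h02 h03 h12 h13 h23
  have key : ∀ i j, i < j → x i * t j = x j * t i := by
    intro i j hij
    fin_cases i <;> fin_cases j <;> first | (exact absurd hij (by decide)) | skip
    all_goals simp
    · linear_combination h23
    · linear_combination -h13
    · linear_combination h12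
    · linear_combination h03
    · linear_combination -h02
    · linear_combination h01
  rcases lt_trichotomy i j with hij | rfl | hij
  · exact key i j hij
  · rfl
  · exact (key j i hij).symm

theorem Interpolates.exists_koszul3 {ι : Type} {w : ι → Fin 4 → k} (hw : ∀ i, w i ≠ 0) {d : ℕ}
    (h : Interpolates w d) {f : R4 k} (hf : f.IsHomogeneous 3) (hf0 : f ≠ 0) (hfw : VanishesOn w f)
    {y : Fin 4 → Fin 4 → R4 k} (hy : Alt4 y) (hyd : ∀ i j, (y i j).IsHomogeneous (d + 2))
    (hyw : ∀ i j, VanishesOn w (y i j)) (hfy : ∀ i, f ∣ ∑ j, X j * y i j) :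
    ∃ τ : Fin 4 → R4 k, (∀ l, (τ l).IsHomogeneous (d + 1)) ∧ (∀ l, VanishesOn w (τ l)) ∧
      ∀ i j, f ∣ y i j - koszul3 τ i j := by
  obtain ⟨μ, hμ⟩ := exists_dual_family hw
  obtain ⟨τ, hτd, hτ⟩ := exists_homogeneous_koszul3_mod hf hf0 hy hyd hfy
  obtain ⟨σ, hσd, hσ⟩ := h fun p => ∑ l, μ p l * eval (w p) (τ l)
  refine ⟨fun l => τ l - X l * σ, fun l => (hτd l).sub (by
    rw [add_comm]; exact (isHomogeneous_X k l).mul hσd), fun l p => ?_, fun i j => ?_⟩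
  · have hprop := proportional_of_koszul3 (x := w p) (τ := τ) (fun _ => rfl) fun i j => by
      obtain ⟨c, hc⟩ := hτ i j
      have := congrArg (eval (w p)) hc
      rw [map_mul, show eval (w p) f = 0 from hfw p, zero_mul, map_sub, hyw i j p, zero_sub,
        neg_eq_zero] at this
      exact this
    rw [map_sub, map_mul, eval_X, hσ, Finset.mul_sum, sub_eq_zero]
    calc eval (w p) (τ l) = (∑ i, μ p i * w p i) * eval (w p) (τ l) := by rw [hμ, one_mul]
      _ = _ := by
        rw [Finset.sum_mul]
        exact Finset.sum_congr rfl fun i _ => by linear_combination μ p i * hprop i l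
  · rw [koszul3_sub_X_mul]
    exact hτ i j

end Interpolation

section ResolutionExactness

variable {k : Type} [Field k]

theorem Alt4.sum_smul_smul {M : Type} [AddCommGroup M] [Module (R4 k) M] {U : Fin 4 → Fin 4 → M}
    (hU : Alt4 U) : ∑ i, (X i : R4 k) • ∑ j, (X j : R4 k) • U i j = 0 := by
  simp only [Fin.sum_univ_four, hU.diag, hU.swap 1 0, hU.swap 2 0, hU.swap 2 1, hU.swap 3 0,
    hU.swap 3 1, hU.swap 3 2]
  module

theorem Alt4.sub {M : Type} [AddCommGroup M] {U V : Fin 4 → Fin 4 → M} (hU : Alt4 U)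
    (hV : Alt4 V) : Alt4 fun i j => U i j - V i j :=
  ⟨fun i => by rw [hU.diag, hV.diag, sub_zero], fun i j => by rw [hU.swap, hV.swap]; abel⟩

/-- The Koszul differential `koszul3` with coefficients in a module. -/
noncomputable def koszul3Smul {M : Type} [AddCommGroup M] [Module (R4 k) M] (τ : Fin 4 → M) :
    Fin 4 → Fin 4 → M :=
  alt4 ((X 2 : R4 k) • τ 3 - (X 3 : R4 k) • τ 2) ((X 3 : R4 k) • τ 1 - (X 1 : R4 k) • τ 3)
    ((X 1 : R4 k) • τ 2 - (X 2 : R4 k) • τ 1) ((X 0 : R4 k) • τ 3 - (X 3 : R4 k) • τ 0)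
    ((X 2 : R4 k) • τ 0 - (X 0 : R4 k) • τ 2) ((X 0 : R4 k) • τ 1 - (X 1 : R4 k) • τ 0)

section

variable {M N : Type} [AddCommGroup M] [Module (R4 k) M] [AddCommGroup N] [Module (R4 k) N]

theorem koszul3Smul_alt (τ : Fin 4 → M) : Alt4 (koszul3Smul (k := k) τ) := alt4_alt ..

theorem sum_X_smul_koszul3Smul (τ : Fin 4 → M) (i : Fin 4) :
    ∑ j, (X j : R4 k) • koszul3Smul (k := k) τ i j = 0 := by
  rw [Fin.sum_univ_four]
  fin_cases i <;> simp [koszul3Smul, alt4] <;> module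

theorem map_koszul3Smul (L : M →ₗ[R4 k] N) (τ : Fin 4 → M) (i j : Fin 4) :
    L (koszul3Smul (k := k) τ i j) = koszul3Smul (k := k) (fun l => L (τ l)) i j := by
  fin_cases i <;> fin_cases j <;> simp [koszul3Smul, alt4]

theorem koszul3Smul_sub_X_smul (τ : Fin 4 → M) (σ : M) :
    koszul3Smul (k := k) (fun l => τ l - (X l : R4 k) • σ) = koszul3Smul (k := k) τ := by
  funext i j
  fin_cases i <;> fin_cases j <;> simp [koszul3Smul, alt4] <;> module

end

theorem koszul3Smul_apply {α : Type} (τ : Fin 4 → α → R4 k) (i j : Fin 4) (r : α) :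
    koszul3Smul (k := k) τ i j r = koszul3 (fun l => τ l r) i j := by
  fin_cases i <;> fin_cases j <;> simp [koszul3Smul, koszul3, alt4]

theorem koszul3Smul_eq_koszul3 (τ : Fin 4 → R4 k) : koszul3Smul (k := k) τ = koszul3 τ := rfl

/-- The degree `d` component of a vector of polynomials. -/
noncomputable def vecComponent {α : Type} (d : ℕ) (w : α → R4 k) : α → R4 k :=
  fun j => homogeneousComponent d (w j)

theorem vecComponent_isHomogeneous {α : Type} (d : ℕ) (w : α → R4 k) (j : α) :
    (vecComponent d w j).IsHomogeneous d := homogeneousComponent_isHomogeneous _ _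

theorem vecComponent_eq_self {α : Type} {d : ℕ} {w : α → R4 k} (h : ∀ j, (w j).IsHomogeneous d) :
    vecComponent d w = w := funext fun j => homogeneousComponent_of_isHomogeneous (h j)

theorem vecComponent_succ_sum_X_smul {α : Type} (d : ℕ) (w : Fin 4 → α → R4 k) :
    vecComponent (d + 1) (∑ i, (X i : R4 k) • w i) = ∑ i, (X i : R4 k) • vecComponent d (w i) := by
  funext j
  simp only [vecComponent, Finset.sum_apply, Pi.smul_apply, smul_eq_mul]
  exact homogeneousComponent_sum_X_mul (fun i => w i j) d

theorem vecComponent_zero {α : Type} (d : ℕ) : vecComponent d (0 : α → R4 k) = 0 :=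
  funext fun _ => map_zero _

theorem mem_of_vecComponent_mem {α : Type} [Fintype α] {w : α → R4 k}
    (P : AddSubmonoid (α → R4 k)) (h : ∀ d, vecComponent d w ∈ P) : w ∈ P := by
  have : w = ∑ d ∈ Finset.range ((Finset.univ.sup fun j => (w j).totalDegree) + 1),
      vecComponent d w := by
    funext j
    rw [Finset.sum_apply]
    conv_lhs => rw [← sum_homogeneousComponent (w j)]
    refine Finset.sum_subset (Finset.range_subset_range.mpr (Nat.succ_le_succ
      (Finset.le_sup (f := fun j => (w j).totalDegree) (Finset.mem_univ j)))) fun d _ hd => ?_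
    exact homogeneousComponent_eq_zero _ _ (by simpa using hd)
  rw [this]
  exact sum_mem fun d _ => h d

theorem exists_vec_sum_X_smul {α : Type} {w : α → R4 k} {d : ℕ}
    (hw : ∀ j, (w j).IsHomogeneous (d + 1)) :
    ∃ q : Fin 4 → α → R4 k, (∀ i j, (q i j).IsHomogeneous d) ∧ w = ∑ i, (X i : R4 k) • q i := by
  choose q hq h using fun j => exists_sum_X_mul_of_isHomogeneous (hw j)
  refine ⟨fun i j => q j i, fun i j => hq j i, funext fun j => ?_⟩
  rw [h j, Finset.sum_apply]; rfl

theorem exists_vec_alt {α : Type} {e : Fin 4 → α → R4 k} {d : ℕ}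
    (he : ∀ i j, (e i j).IsHomogeneous (d + 1)) (h : ∑ i, (X i : R4 k) • e i = 0) :
    ∃ U : Fin 4 → Fin 4 → α → R4 k, Alt4 U ∧ (∀ i j r, (U i j r).IsHomogeneous d) ∧
      ∀ i, e i = ∑ j, (X j : R4 k) • U i j := by
  choose U hU hUd hUe using fun r => exists_homogeneous_alt (e := fun i => e i r) (he · r) (by
    simpa using congrFun h r)
  refine ⟨fun i j r => U r i j, ⟨fun i => funext fun r => (hU r).diag i,
    fun i j => funext fun r => (hU r).swap i j⟩, fun i j r => hUd r i j, fun i => funext fun r => ?_⟩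
  rw [hUe, Finset.sum_apply]; rfl

theorem exists_vec_koszul3 {α : Type} {y : Fin 4 → Fin 4 → α → R4 k} {d : ℕ} (hy : Alt4 y)
    (hyd : ∀ i j r, (y i j r).IsHomogeneous (d + 1)) (h : ∀ i, ∑ j, (X j : R4 k) • y i j = 0) :
    ∃ τ : Fin 4 → α → R4 k, (∀ l r, (τ l r).IsHomogeneous d) ∧ y = koszul3Smul (k := k) τ := by
  choose τ hτ using fun r => exists_koszul3_of_sum_X_mul_eq_zero (y := fun i j => y i j r)
    ⟨fun i => congrFun (hy.diag i) r, fun i j => congrFun (hy.swap i j) r⟩ (fun i => by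
      simpa using congrFun (h i) r)
  refine ⟨fun l r => homogeneousComponent d (τ r l),
    fun _ _ => homogeneousComponent_isHomogeneous _ _, ?_⟩
  funext i j r
  rw [koszul3Smul_apply, ← homogeneousComponent_koszul3, ← hτ r,
    homogeneousComponent_of_isHomogeneous (hyd i j r)]

/-- Graded maps `L₂`, `L₁` of degrees `2`, `a` which form, in low degrees, a presentation of the
ideal of `w` modulo `f`. -/
structure LowPresentation {ι α β : Type} (f : R4 k) (w : ι → Fin 4 → k) (a : ℕ)
    (L₁ : (α → R4 k) →ₗ[R4 k] R4 k) (L₂ : (β → R4 k) →ₗ[R4 k] (α → R4 k)) : Prop where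
  prime : Prime f
  cubic : f.IsHomogeneous 3
  ne_zero : ∀ i, w i ≠ 0
  vanish : VanishesOn w f
  interp : ∀ d, a ≤ d → Interpolates w d
  comp₁ : ∀ d x, homogeneousComponent (a + d) (L₁ x) = L₁ (vecComponent d x)
  vanish₁ : ∀ x, VanishesOn w (L₁ x)
  gen₁ : ∀ d x, x.IsHomogeneous (a + d) → VanishesOn w x →
    ∃ W : α → R4 k, (∀ j, (W j).IsHomogeneous d) ∧ f ∣ x - L₁ W
  low₁ : ∀ d ≤ 1, ∀ W : α → R4 k, (∀ j, (W j).IsHomogeneous d) → f ∣ L₁ W → W = 0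
  comp₂ : ∀ d u, vecComponent (d + 2) (L₂ u) = L₂ (vecComponent d u)
  syz₂ : ∀ u, f ∣ L₁ (L₂ u)
  gen₂ : ∀ W : α → R4 k, (∀ j, (W j).IsHomogeneous 2) → f ∣ L₁ W → ∃ u, W = L₂ u
  low₂ : ∀ u : β → R4 k, (∀ j, (u j).IsHomogeneous 0) → L₂ u = 0 → u = 0

/-- Graded maps `L₃`, `L₂`, `L₁` of degrees `1`, `2`, `a` which form, in low degrees, a resolution of
the ideal of `w` modulo `f`. -/
structure LowResolution {ι α β γ : Type} (f : R4 k) (w : ι → Fin 4 → k) (a : ℕ)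
    (L₁ : (α → R4 k) →ₗ[R4 k] R4 k) (L₂ : (β → R4 k) →ₗ[R4 k] (α → R4 k))
    (L₃ : (γ → R4 k) →ₗ[R4 k] (β → R4 k)) : Prop extends LowPresentation f w a L₁ L₂ where
  comp₃ : ∀ d t, vecComponent (d + 1) (L₃ t) = L₃ (vecComponent d t)
  syz₃ : ∀ t, L₂ (L₃ t) = 0
  gen₃ : ∀ u : β → R4 k, (∀ j, (u j).IsHomogeneous 1) → L₂ u = 0 → ∃ t, u = L₃ t
  low₃ : ∀ t : γ → R4 k, (∀ j, (t j).IsHomogeneous 0) → L₃ t = 0 → t = 0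

theorem dvd_of_dvd_koszul3 {f : R4 k} {τ : Fin 4 → R4 k} (h : ∀ i j, f ∣ koszul3 τ i j)
    (i j : Fin 4) : f ∣ X j * τ i - X i * τ j := by
  have key : ∀ i j : Fin 4, i < j → f ∣ X j * τ i - X i * τ j := by
    intro i j hij
    fin_cases i <;> fin_cases j <;> first | (exact absurd hij (by decide)) | skip
    · exact dvd_of_eq_combo₂ (-1) 0 (h 2 3) (h 2 3) (by simp [koszul3, alt4])
    · exact dvd_of_eq_combo₂ 1 0 (h 1 3) (h 2 3) (by simp [koszul3, alt4])
    · exact dvd_of_eq_combo₂ (-1) 0 (h 1 2) (h 2 3) (by simp [koszul3, alt4])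
    · exact dvd_of_eq_combo₂ (-1) 0 (h 0 3) (h 2 3) (by simp [koszul3, alt4])
    · exact dvd_of_eq_combo₂ 1 0 (h 0 2) (h 2 3) (by simp [koszul3, alt4])
    · exact dvd_of_eq_combo₂ (-1) 0 (h 0 1) (h 2 3) (by simp [koszul3, alt4])
  rcases lt_trichotomy i j with hij | rfl | hij
  · exact key i j hij
  · rw [sub_self]; exact dvd_zero _
  · rw [← neg_sub, dvd_neg]; exact key j i hij

namespace LowPresentation

variable {ι α β : Type} {f : R4 k} {w : ι → Fin 4 → k} {a : ℕ}
  {L₁ : (α → R4 k) →ₗ[R4 k] R4 k} {L₂ : (β → R4 k) →ₗ[R4 k] (α → R4 k)}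

theorem exists_map₂_of_isHomogeneous (H : LowPresentation f w a L₁ L₂) (ha : 1 ≤ a) (e : ℕ) :
    ∀ W : α → R4 k, (∀ j, (W j).IsHomogeneous e) → f ∣ L₁ W → ∃ u, W = L₂ u := by
  induction e using Nat.strong_induction_on with
  | _ e ih =>
  intro W hW hf
  match e, ih, hW with
  | 0, _, hW => exact ⟨0, by rw [H.low₁ 0 zero_le_one W hW hf, map_zero]⟩
  | 1, _, hW => exact ⟨0, by rw [H.low₁ 1 le_rfl W hW hf, map_zero]⟩
  | 2, _, hW => exact H.gen₂ W hW hf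
  | E + 3, ih, hW =>
    obtain ⟨q, hq, rfl⟩ := exists_vec_sum_X_smul hW
    have hL : ∀ e (x : α → R4 k), (∀ j, (x j).IsHomogeneous e) → (L₁ x).IsHomogeneous (a + e) :=
      fun e x hx => by
        rw [← vecComponent_eq_self hx, ← H.comp₁]
        exact homogeneousComponent_isHomogeneous _ _
    obtain ⟨U, hU, hUd, hUw, hUy⟩ := (H.interp (a + E) (by omega)).koszulExact₁ H.ne_zero (by omega)
      H.cubic H.vanish (fun i => L₁ (q i)) (fun i => hL _ _ (hq i)) (fun i => H.vanish₁ _) (by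
        simpa using hf)
    obtain ⟨V, hV, hVU⟩ := hU.exists_lift (N := α → R4 k)
      (P := fun u v => (∀ r, (v r).IsHomogeneous (E + 1)) ∧ f ∣ u - L₁ v)
      ⟨fun _ => isHomogeneous_zero _ _ _, by simp⟩
      (fun m n h => ⟨fun r => (h.1 r).neg, by
        rw [map_neg, ← neg_sub', dvd_neg]; exact h.2⟩)
      (fun i j => H.gen₁ (E + 1) _ (hUd i j) (hUw i j))
    choose u hu using fun i => ih (E + 2) (by omega) (q i - ∑ l, (X l : R4 k) • V i l)
      (fun r => by
        simp only [Pi.sub_apply, Finset.sum_apply, Pi.smul_apply, smul_eq_mul]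
        refine (hq i r).sub (IsHomogeneous.sum _ _ _ fun l _ => ?_)
        have := (isHomogeneous_X k l).mul ((hVU i l).1 r)
        rwa [show 1 + (E + 1) = E + 2 by ring] at this)
      (by
        have : L₁ (q i - ∑ l, (X l : R4 k) • V i l) =
            (L₁ (q i) - ∑ l, X l * U i l) + ∑ l, X l * (U i l - L₁ (V i l)) := by
          simp [mul_sub]
        rw [this]
        exact dvd_add (hUy i) (Finset.dvd_sum fun l _ => ((hVU i l).2).mul_left _))
    refine ⟨∑ i, (X i : R4 k) • u i, ?_⟩
    rw [map_sum]
    simp only [map_smul, ← hu, smul_sub, Finset.sum_sub_distrib, hV.sum_smul_smul, sub_zero]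

theorem exists_map₂ [Fintype α] (H : LowPresentation f w a L₁ L₂) (ha : 1 ≤ a) {W : α → R4 k}
    (hf : f ∣ L₁ W) : ∃ u, W = L₂ u := by
  have := mem_of_vecComponent_mem (w := W) L₂.range.toAddSubmonoid fun d => by
    obtain ⟨u, hu⟩ := H.exists_map₂_of_isHomogeneous ha d (vecComponent d W)
      (vecComponent_isHomogeneous d W) (by
        rw [← H.comp₁]; exact dvd_homogeneousComponent H.cubic hf _)
    exact ⟨u, hu.symm⟩
  obtain ⟨u, hu⟩ := this
  exact ⟨u, hu.symm⟩

end LowPresentation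

namespace LowResolution

variable {ι α β γ : Type} {f : R4 k} {w : ι → Fin 4 → k} {a : ℕ}
  {L₁ : (α → R4 k) →ₗ[R4 k] R4 k} {L₂ : (β → R4 k) →ₗ[R4 k] (α → R4 k)}
  {L₃ : (γ → R4 k) →ₗ[R4 k] (β → R4 k)}

theorem vecComponent_mem_range₃ [Fintype α] (H : LowResolution f w a L₁ L₂ L₃) (ha : 1 ≤ a)
    (e : ℕ) : ∀ u : β → R4 k, L₂ u = 0 → ∃ t, vecComponent e u = L₃ t := by
  induction e using Nat.strong_induction_on with
  | _ e ih =>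
  intro u hu
  have hu' : L₂ (vecComponent e u) = 0 := by rw [← H.comp₂, hu, vecComponent_zero]
  have huh := vecComponent_isHomogeneous e u
  match e, ih with
  | 0, _ => exact ⟨0, by rw [map_zero]; exact H.low₂ _ huh hu'⟩
  | 1, _ => exact H.gen₃ _ huh hu'
  | E + 2, ih =>
    obtain ⟨q, hq, hqu⟩ := exists_vec_sum_X_smul huh
    rw [hqu] at hu' ⊢
    have hL : ∀ e (x : β → R4 k), (∀ j, (x j).IsHomogeneous e) →
        ∀ j, (L₂ x j).IsHomogeneous (e + 2) := fun e x hx => by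
      rw [← vecComponent_eq_self hx, ← H.comp₂]
      exact vecComponent_isHomogeneous _ _
    have hL1 : ∀ e (x : α → R4 k), (∀ j, (x j).IsHomogeneous e) → (L₁ x).IsHomogeneous (a + e) :=
      fun e x hx => by
        rw [← vecComponent_eq_self hx, ← H.comp₁]
        exact homogeneousComponent_isHomogeneous _ _
    obtain ⟨W, hW, hWd, hWq⟩ := exists_vec_alt (e := fun l => L₂ (q l)) (d := E + 2)
      (fun l => hL (E + 1) (q l) (hq l)) (by simpa using hu')
    obtain ⟨τ, hτd, hτw, hτ⟩ := (H.interp (a + E) (by omega)).exists_koszul3 H.ne_zero H.cubic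
      H.prime.ne_zero H.vanish (y := fun l m => L₁ (W l m)) (hW.map L₁.toAddMonoidHom)
      (fun l m => hL1 _ _ (hWd l m)) (fun l m => H.vanish₁ _) (fun l => by
        have : ∑ m, X m * L₁ (W l m) = L₁ (L₂ (q l)) := by rw [hWq]; simp
        rw [this]; exact H.syz₂ _)
    choose T hTd hT using fun l => H.gen₁ (E + 1) (τ l) (hτd l) (hτw l)
    obtain ⟨p, hp, hpW⟩ := (hW.sub (koszul3Smul_alt (k := k) T)).exists_lift (N := β → R4 k)
      (P := fun m n => m = L₂ n) (map_zero _).symm (fun m n h => by rw [map_neg, h])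
      (fun l m => H.exists_map₂ ha (by
        rw [map_sub, map_koszul3Smul, koszul3Smul_eq_koszul3]
        have h1 : koszul3 (fun l => τ l) l m - koszul3 (fun l => L₁ (T l)) l m =
            koszul3 (fun l => τ l - L₁ (T l)) l m := by
          have : ∀ i j : Fin 4, koszul3 (fun l => τ l) i j - koszul3 (fun l => L₁ (T l)) i j =
            koszul3 (fun l => τ l - L₁ (T l)) i j := fun i j => by
              fin_cases i <;> fin_cases j <;> simp [koszul3, alt4] <;> ring
          exact this l m
        have h2 : f ∣ koszul3 (fun l => τ l - L₁ (T l)) l m :=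
          alt4_induction (P := fun p : R4 k => f ∣ p) (dvd_zero _) (fun m h => (dvd_neg).mpr h)
            (dvd_sub ((hT _).mul_left _) ((hT _).mul_left _))
            (dvd_sub ((hT _).mul_left _) ((hT _).mul_left _))
            (dvd_sub ((hT _).mul_left _) ((hT _).mul_left _))
            (dvd_sub ((hT _).mul_left _) ((hT _).mul_left _))
            (dvd_sub ((hT _).mul_left _) ((hT _).mul_left _))
            (dvd_sub ((hT _).mul_left _) ((hT _).mul_left _)) l m
        rw [← h1] at h2
        have := dvd_add (hτ l m) h2
        rwa [sub_add_sub_cancel] at this))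
    choose t ht using fun l => ih (E + 1) (by omega) (q l - ∑ m, (X m : R4 k) • p l m) (by
      simp only [map_sub, map_sum, map_smul, ← hpW, smul_sub, Finset.sum_sub_distrib, hWq,
        sum_X_smul_koszul3Smul, sub_zero, sub_self])
    refine ⟨∑ i, (X i : R4 k) • t i, ?_⟩
    rw [map_sum]
    simp only [map_smul, ← ht]
    rw [← vecComponent_succ_sum_X_smul]
    simp only [smul_sub, Finset.sum_sub_distrib, hp.sum_smul_smul, sub_zero]
    rw [vecComponent_succ_sum_X_smul]
    exact Finset.sum_congr rfl fun i _ => by rw [vecComponent_eq_self (hq i)]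

theorem exists_map₃ [Fintype α] [Fintype β] (H : LowResolution f w a L₁ L₂ L₃) (ha : 1 ≤ a)
    {u : β → R4 k} (hu : L₂ u = 0) : ∃ t, u = L₃ t := by
  have := mem_of_vecComponent_mem (w := u) L₃.range.toAddSubmonoid fun d => by
    obtain ⟨t, ht⟩ := H.vecComponent_mem_range₃ ha d u hu
    exact ⟨t, ht.symm⟩
  obtain ⟨t, ht⟩ := this
  exact ⟨t, ht.symm⟩

theorem vecComponent_eq_zero [Fintype α] [Fintype β] (H : LowResolution f w a L₁ L₂ L₃)
    (ha : 1 ≤ a) (e : ℕ) : ∀ t : γ → R4 k, L₃ t = 0 → vecComponent e t = 0 := by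
  induction e with
  | zero =>
    intro t ht
    exact H.low₃ _ (vecComponent_isHomogeneous 0 t) (by rw [← H.comp₃, ht, vecComponent_zero])
  | succ E ih =>
    intro t ht
    have ht' : L₃ (vecComponent (E + 1) t) = 0 := by rw [← H.comp₃, ht, vecComponent_zero]
    obtain ⟨q, hq, hqt⟩ := exists_vec_sum_X_smul (vecComponent_isHomogeneous (E + 1) t)
    rw [hqt] at ht' ⊢
    have hL3 : ∀ e (x : γ → R4 k), (∀ j, (x j).IsHomogeneous e) →
        ∀ j, (L₃ x j).IsHomogeneous (e + 1) := fun e x hx => by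
      rw [← vecComponent_eq_self hx, ← H.comp₃]
      exact vecComponent_isHomogeneous _ _
    have hL : ∀ e (x : β → R4 k), (∀ j, (x j).IsHomogeneous e) →
        ∀ j, (L₂ x j).IsHomogeneous (e + 2) := fun e x hx => by
      rw [← vecComponent_eq_self hx, ← H.comp₂]
      exact vecComponent_isHomogeneous _ _
    have hL1 : ∀ e (x : α → R4 k), (∀ j, (x j).IsHomogeneous e) → (L₁ x).IsHomogeneous (a + e) :=
      fun e x hx => by
        rw [← vecComponent_eq_self hx, ← H.comp₁]
        exact homogeneousComponent_isHomogeneous _ _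
    obtain ⟨U, hU, hUd, hUq⟩ := exists_vec_alt (e := fun l => L₃ (q l)) (d := E)
      (fun l => hL3 E (q l) (hq l)) (by simpa using ht')
    obtain ⟨V, hVd, hV⟩ := exists_vec_koszul3 (y := fun l m => L₂ (U l m)) (d := E + 1)
      (hU.map L₂.toAddMonoidHom) (fun l m => hL E (U l m) (hUd l m)) (fun l => by
        have : ∑ m, (X m : R4 k) • L₂ (U l m) = L₂ (L₃ (q l)) := by rw [hUq]; simp
        rw [this]; exact H.syz₃ _)
    have hkos : ∀ i j, f ∣ koszul3 (fun l => L₁ (V l)) i j := fun i j => by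
      rw [← koszul3Smul_eq_koszul3, ← map_koszul3Smul, ← hV]; exact H.syz₂ _
    obtain ⟨ρ', hρ'⟩ := exists_smul_mod_X H.prime H.cubic (a := fun l => L₁ (V l))
      (dvd_of_dvd_koszul3 hkos)
    have hρ : ∀ l, f ∣ L₁ (V l) - X l * homogeneousComponent (a + E) ρ' := fun l => by
      have := dvd_homogeneousComponent H.cubic (hρ' l) (a + E + 1)
      rwa [map_sub, homogeneousComponent_succ_X_mul, show a + E + 1 = a + (E + 1) from rfl,
        H.comp₁, vecComponent_eq_self (hVd l)] at this
    obtain ⟨r, hrd, hr⟩ := H.gen₁ E _ (homogeneousComponent_isHomogeneous (a + E) ρ') (fun p => by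
      obtain ⟨c, hc⟩ := Function.ne_iff.mp (H.ne_zero p)
      obtain ⟨b, hb⟩ := hρ c
      have := congrArg (eval (w p)) hb
      rw [map_mul, show eval (w p) f = 0 from H.vanish p, zero_mul, map_sub, H.vanish₁ _ p,
        zero_sub, neg_eq_zero, map_mul, eval_X] at this
      exact (mul_eq_zero.mp this).resolve_left hc)
    choose p hp using fun l => H.exists_map₂ ha (W := V l - (X l : R4 k) • r) (by
      rw [map_sub, map_smul, smul_eq_mul]
      exact dvd_of_eq_combo₂ 1 (X l) (hρ l) hr (by ring))
    have hUp : ∀ i j, L₂ (U i j - koszul3Smul (k := k) p i j) = 0 := fun i j => by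
      have h1 : L₂ (U i j) = koszul3Smul (k := k) V i j := congrFun (congrFun hV i) j
      rw [map_sub, map_koszul3Smul, h1, ← koszul3Smul_sub_X_smul V r]
      simp only [hp, sub_self]
    obtain ⟨s, hs, hsU⟩ := (hU.sub (koszul3Smul_alt (k := k) p)).exists_lift (N := γ → R4 k)
      (P := fun m n => m = L₃ n) (map_zero _).symm (fun m n h => by rw [map_neg, h])
      (fun i j => H.exists_map₃ ha (hUp i j))
    have key : ∀ l, vecComponent E (q l - ∑ m, (X m : R4 k) • s l m) = 0 := fun l => ih _ (by
      simp only [map_sub, map_sum, map_smul, ← hsU, smul_sub, Finset.sum_sub_distrib, hUq,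
        sum_X_smul_koszul3Smul, sub_zero, sub_self])
    have hq' : ∑ i, (X i : R4 k) • q i =
        vecComponent (E + 1) (∑ l, (X l : R4 k) • (q l - ∑ m, (X m : R4 k) • s l m)) := by
      simp only [smul_sub, Finset.sum_sub_distrib, hs.sum_smul_smul, sub_zero]
      rw [vecComponent_succ_sum_X_smul]
      exact Finset.sum_congr rfl fun i _ => by rw [vecComponent_eq_self (hq i)]
    rw [hq', vecComponent_succ_sum_X_smul]
    simp [key]

theorem map₃_injective [Fintype α] [Fintype β] (H : LowResolution f w a L₁ L₂ L₃) (ha : 1 ≤ a)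
    {t : γ → R4 k} (ht : L₃ t = 0) : t = 0 := by
  funext j
  rw [← sum_homogeneousComponent (t j)]
  exact Finset.sum_eq_zero fun d _ => congrFun (H.vecComponent_eq_zero ha d t ht) j

end LowResolution

end ResolutionExactness

section Dimensions

variable {k : Type} [Field k]

variable (k) in
/-- The space of forms of degree `d`. -/
abbrev forms (d : ℕ) : Submodule k (R4 k) := homogeneousSubmodule (Fin 4) k d

instance (d : ℕ) : FiniteDimensional k (forms k d) :=
  Module.Finite.iff_fg.mpr (homogeneousSubmodule_fg (Fin 4) k d)

theorem finrank_forms (d : ℕ) : Module.finrank k (forms k d) = (d + 3).choose 3 := by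
  have e : forms k d ≃ₗ[k] ((Finset.finsuppAntidiag (Finset.univ : Finset (Fin 4)) d :
      Finset (Fin 4 →₀ ℕ)) →₀ k) := by
    have h : ((Finset.finsuppAntidiag (Finset.univ : Finset (Fin 4)) d : Finset (Fin 4 →₀ ℕ)) :
        Set (Fin 4 →₀ ℕ)) = {m | m.degree = d} := by
      ext m
      simp [Finset.mem_finsuppAntidiag, Finsupp.degree_eq_sum]
    refine (LinearEquiv.ofEq _ _ ?_).trans (AddMonoidAlgebra.supportedEquivFinsupp
      (R := k) (S := k) (Finset.finsuppAntidiag (Finset.univ : Finset (Fin 4)) d : Set (Fin 4 →₀ ℕ)))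
    rw [h]
    exact homogeneousSubmodule_eq_finsupp_supported (Fin 4) k d
  rw [e.finrank_eq, Module.finrank_finsupp_self, Fintype.card_coe,
    Finset.card_finsuppAntidiag_nat_eq_choose, Finset.card_univ, Fintype.card_fin,
    show 4 + d - 1 = d + 3 by omega]
  exact Nat.choose_symm_add

theorem finrank_map_add_finrank_inf_ker {M N : Type} [AddCommGroup M] [Module k M]
    [AddCommGroup N] [Module k N] (T : M →ₗ[k] N) (S : Submodule k M) [FiniteDimensional k S] :
    Module.finrank k (S.map T) + Module.finrank k (S ⊓ LinearMap.ker T : Submodule k M) =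
      Module.finrank k S := by
  have h := (T.domRestrict S).finrank_range_add_finrank_ker
  rw [LinearMap.range_domRestrict] at h
  rw [← h]
  congr 1
  rw [LinearMap.ker_domRestrict]
  exact (LinearEquiv.finrank_eq (Submodule.equivMapOfInjective S.subtype S.injective_subtype
    (Submodule.comap S.subtype (LinearMap.ker T))|>.trans (LinearEquiv.ofEq _ _
      (by rw [Submodule.map_comap_subtype])))).symm

/-- Reduction modulo `f`. -/
noncomputable def modPoly (f : R4 k) : R4 k →ₗ[k] (R4 k ⧸ Ideal.span {f}) :=
  (Ideal.Quotient.mkₐ k (Ideal.span {f})).toLinearMap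

theorem modPoly_eq_zero {f p : R4 k} : modPoly f p = 0 ↔ f ∣ p := by
  change Ideal.Quotient.mk (Ideal.span {f}) p = 0 ↔ _
  rw [Ideal.Quotient.eq_zero_iff_mem, Ideal.mem_span_singleton]

theorem modPoly_eq {f p q : R4 k} : modPoly f p = modPoly f q ↔ f ∣ p - q := by
  rw [← modPoly_eq_zero, map_sub, sub_eq_zero]

theorem finrank_forms_inf_ker_modPoly {f : R4 k} (hf : f.IsHomogeneous 3) (hf0 : f ≠ 0) (d : ℕ) :
    Module.finrank k (forms k d ⊓ LinearMap.ker (modPoly f) : Submodule k (R4 k)) =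
      d.choose 3 := by
  rcases lt_or_ge d 3 with hd | hd
  · rw [Nat.choose_eq_zero_of_lt hd]
    have : (forms k d ⊓ LinearMap.ker (modPoly f) : Submodule k (R4 k)) = ⊥ := by
      rw [eq_bot_iff]
      rintro p ⟨hp, hfp⟩
      exact eq_zero_of_dvd_of_lt hf (modPoly_eq_zero.mp hfp) hp hd
    rw [this, finrank_bot]
  · obtain ⟨e, rfl⟩ := Nat.exists_eq_add_of_le' hd
    rw [← finrank_forms (k := k) e]
    have : (forms k (e + 3) ⊓ LinearMap.ker (modPoly f) : Submodule k (R4 k)) =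
        (forms k e).map (LinearMap.mulLeft k f) := by
      ext p
      constructor
      · rintro ⟨hp, hfp⟩
        rw [add_comm] at hp
        obtain ⟨c, hc, rfl⟩ := exists_homogeneous_of_dvd hf (modPoly_eq_zero.mp hfp) hp
        exact ⟨c, hc, rfl⟩
      · rintro ⟨c, hc, rfl⟩
        refine ⟨?_, modPoly_eq_zero.mpr (dvd_mul_right _ _)⟩
        change (f * c).IsHomogeneous (e + 3)
        rw [add_comm]
        exact hf.mul hc
    rw [this]
    exact (Submodule.equivMapOfInjective (LinearMap.mulLeft k f) (mul_right_injective₀ hf0)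
      (forms k e)).finrank_eq.symm

theorem choose_three_add (d : ℕ) : (d + 3).choose 3 = d.choose 3 + (3 * (d * (d + 1) / 2) + 1) := by
  induction d with
  | zero => rfl
  | succ d ih =>
    have h1 : (d + 1 + 3).choose 3 = (d + 3).choose 2 + (d + 3).choose 3 := Nat.choose_succ_succ _ _
    have h2 : (d + 1).choose 3 = d.choose 2 + d.choose 3 := Nat.choose_succ_succ _ _
    have h3 : (d + 1) * (d + 1 + 1) / 2 = d * (d + 1) / 2 + (d + 1) := by
      rw [show (d + 1) * (d + 1 + 1) = d * (d + 1) + (d + 1) * 2 by ring,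
        Nat.add_mul_div_right _ _ (by norm_num)]
    have h4 : (d + 3).choose 2 = d.choose 2 + 3 * d + 3 := by
      have e1 : (d + 3).choose 2 = (d + 2).choose 1 + (d + 2).choose 2 := Nat.choose_succ_succ _ _
      have e2 : (d + 2).choose 2 = (d + 1).choose 1 + (d + 1).choose 2 := Nat.choose_succ_succ _ _
      have e3 : (d + 1).choose 2 = d.choose 1 + d.choose 2 := Nat.choose_succ_succ _ _
      simp only [Nat.choose_one_right] at e1 e2 e3
      omega
    omega

/-- Evaluation at the vectors `w i`. -/
noncomputable def evalFamily {ι : Type} (w : ι → Fin 4 → k) : R4 k →ₗ[k] (ι → k) :=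
  LinearMap.pi fun i => (aeval (w i)).toLinearMap

theorem evalFamily_apply {ι : Type} (w : ι → Fin 4 → k) (p : R4 k) (i : ι) :
    evalFamily w p i = eval (w i) p := by
  simp [evalFamily, aeval_eq_eval]

theorem evalFamily_eq_zero {ι : Type} {w : ι → Fin 4 → k} {p : R4 k} :
    evalFamily w p = 0 ↔ VanishesOn w p := by
  rw [funext_iff]
  exact forall_congr' fun i => by rw [evalFamily_apply]; rfl

/-- The space of forms of degree `d` vanishing on the family `w`. -/
noncomputable def formsThrough {ι : Type} (w : ι → Fin 4 → k) (d : ℕ) : Submodule k (R4 k) :=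
  forms k d ⊓ LinearMap.ker (evalFamily w)

theorem mem_formsThrough {ι : Type} {w : ι → Fin 4 → k} {d : ℕ} {p : R4 k} :
    p ∈ formsThrough w d ↔ p.IsHomogeneous d ∧ VanishesOn w p :=
  and_congr_right fun _ => evalFamily_eq_zero

instance {ι : Type} (w : ι → Fin 4 → k) (d : ℕ) : FiniteDimensional k (formsThrough w d) :=
  Submodule.finiteDimensional_of_le (inf_le_left : _ ≤ forms k d)

theorem finrank_map_modPoly_add {ι : Type} [Finite ι] {f : R4 k} (hf : f.IsHomogeneous 3)
    (hf0 : f ≠ 0) {w : ι → Fin 4 → k} (hfw : VanishesOn w f) (d : ℕ) :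
    Module.finrank k ((formsThrough w d).map (modPoly f)) +
      Module.finrank k ((forms k d).map (evalFamily w)) = 3 * (d * (d + 1) / 2) + 1 := by
  have h1 := finrank_map_add_finrank_inf_ker (modPoly f) (formsThrough w d)
  have h2 := finrank_map_add_finrank_inf_ker (evalFamily w) (forms k d)
  have h3 : formsThrough w d ⊓ LinearMap.ker (modPoly f) = forms k d ⊓ LinearMap.ker (modPoly f) := by
    ext p
    constructor
    · rintro ⟨hp, hfp⟩; exact ⟨hp.1, hfp⟩
    · rintro ⟨hp, hfp⟩
      refine ⟨mem_formsThrough.mpr ⟨hp, fun i => ?_⟩, hfp⟩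
      obtain ⟨c, rfl⟩ := modPoly_eq_zero.mp hfp
      rw [map_mul, show eval (w i) f = 0 from hfw i, zero_mul]
  rw [h3, finrank_forms_inf_ker_modPoly hf hf0] at h1
  rw [finrank_forms, choose_three_add] at h2
  change _ + Module.finrank k (formsThrough w d) = _ at h2
  omega

theorem exists_linear_ne_zero [Infinite k] {ι : Type} [Finite ι] {w : ι → Fin 4 → k}
    (hw : ∀ i, w i ≠ 0) : ∃ h : R4 k, h.IsHomogeneous 1 ∧ ∀ i, eval (w i) h ≠ 0 := by
  have := Fintype.ofFinite ι
  have hlin : ∀ i, (∑ j, C (w i j) * X j : R4 k) ≠ 0 := fun i h => by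
    obtain ⟨j, hj⟩ := Function.ne_iff.mp (hw i)
    apply hj
    have := congrArg (eval (Pi.single j 1)) h
    simpa [Pi.single_apply] using this
  obtain ⟨c, hc⟩ : ∃ c, eval c (∏ i, ∑ j, C (w i j) * X j : R4 k) ≠ 0 := by
    by_contra! hcon
    exact Finset.prod_ne_zero_iff.mpr (fun i _ => hlin i) (MvPolynomial.funext fun c => by
      rw [hcon, map_zero])
  refine ⟨∑ j, C (c j) * X j, IsHomogeneous.sum _ _ _ fun j _ => by
    simpa using (isHomogeneous_C (Fin 4) (c j)).mul (isHomogeneous_X k j), fun i => ?_⟩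
  rw [map_prod, Finset.prod_ne_zero_iff] at hc
  have := hc i (Finset.mem_univ i)
  simpa [mul_comm] using this

theorem Interpolates.succ [Infinite k] {ι : Type} [Finite ι] {w : ι → Fin 4 → k} {d : ℕ}
    (hw : ∀ i, w i ≠ 0) (h : Interpolates w d) : Interpolates w (d + 1) := by
  obtain ⟨l, hl, hl0⟩ := exists_linear_ne_zero hw
  intro c
  obtain ⟨p, hp, hpc⟩ := h fun i => (eval (w i) l)⁻¹ * c i
  exact ⟨p * l, hp.mul hl, fun i => by
    rw [map_mul, hpc, mul_comm, mul_inv_cancel_left₀ (hl0 i)]⟩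

theorem Interpolates.of_le [Infinite k] {ι : Type} [Finite ι] {w : ι → Fin 4 → k} {d e : ℕ}
    (hw : ∀ i, w i ≠ 0) (h : Interpolates w d) (hde : d ≤ e) : Interpolates w e := by
  induction e, hde using Nat.le_induction with
  | base => exact h
  | succ e _ ih => exact ih.succ hw

theorem interpolates_iff {ι : Type} [Fintype ι] {w : ι → Fin 4 → k} {d : ℕ} :
    Interpolates w d ↔ Module.finrank k ((forms k d).map (evalFamily w)) = Fintype.card ι := by
  rw [← Module.finrank_fintype_fun_eq_card k (η := ι)]
  constructor
  · intro h
    have : (forms k d).map (evalFamily w) = ⊤ := by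
      rw [eq_top_iff]
      intro c _
      obtain ⟨p, hp, hpc⟩ := h c
      exact ⟨p, hp, funext fun i => by rw [evalFamily_apply, hpc]⟩
    rw [this, finrank_top]
  · intro h c
    have hc : c ∈ (forms k d).map (evalFamily w) := by
      rw [Submodule.eq_top_of_finrank_eq h]; trivial
    obtain ⟨p, hp, rfl⟩ := hc
    exact ⟨p, hp, fun i => (evalFamily_apply w p i).symm⟩

theorem finrank_map_evalFamily_le_succ [Infinite k] {ι : Type} [Finite ι] {w : ι → Fin 4 → k}
    (hw : ∀ i, w i ≠ 0) (d : ℕ) : Module.finrank k ((forms k d).map (evalFamily w)) ≤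
      Module.finrank k ((forms k (d + 1)).map (evalFamily w)) := by
  obtain ⟨l, hl, hl0⟩ := exists_linear_ne_zero hw
  let m : (ι → k) →ₗ[k] (ι → k) := LinearMap.pi fun i => eval (w i) l • LinearMap.proj i
  have hm : Function.Injective m := (injective_iff_map_eq_zero m).mpr fun c hc => funext fun i => by
    have : eval (w i) l * c i = 0 := congrFun hc i
    exact (mul_eq_zero.mp this).resolve_left (hl0 i)
  rw [(Submodule.equivMapOfInjective m hm _).finrank_eq]
  refine Submodule.finrank_mono ?_
  rintro _ ⟨_, ⟨p, hp, rfl⟩, rfl⟩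
  refine ⟨p * l, hp.mul hl, funext fun i => ?_⟩
  rw [evalFamily_apply, map_mul, mul_comm, ← evalFamily_apply w p]
  rfl

end Dimensions

section Generators

variable {k : Type} [Field k]

instance {ι : Type} (w : ι → Fin 4 → k) (d : ℕ) (f : R4 k) :
    FiniteDimensional k ((formsThrough w d).map (modPoly f)) :=
  inferInstance

theorem modPoly_mul (f p q : R4 k) : modPoly f (p * q) = modPoly f p * modPoly f q :=
  map_mul (Ideal.Quotient.mk (Ideal.span {f})) p q

/-- The map `(q₀, …, q₃) ↦ ∑ xᵢ qᵢ` on the degree `d` part of the ideal of `w` modulo `f`. -/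
noncomputable def sumXMul (f : R4 k) {ι : Type} (w : ι → Fin 4 → k) (d : ℕ) :
    (Fin 4 → (formsThrough w d).map (modPoly f)) →ₗ[k] (R4 k ⧸ Ideal.span {f}) :=
  ∑ i, LinearMap.mulLeft k (modPoly f (X i)) ∘ₗ
    ((formsThrough w d).map (modPoly f)).subtype ∘ₗ LinearMap.proj i

theorem sumXMul_apply (f : R4 k) {ι : Type} (w : ι → Fin 4 → k) (d : ℕ)
    (y : Fin 4 → (formsThrough w d).map (modPoly f)) :
    sumXMul f w d y = ∑ i, modPoly f (X i) * (y i : R4 k ⧸ Ideal.span {f}) := by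
  simp [sumXMul]

theorem exists_sumXMul_eq (f : R4 k) {ι : Type} (w : ι → Fin 4 → k) (d : ℕ)
    (y : Fin 4 → (formsThrough w d).map (modPoly f)) :
    ∃ q : Fin 4 → R4 k, (∀ i, q i ∈ formsThrough w d) ∧ (∀ i, modPoly f (q i) = y i) ∧
      sumXMul f w d y = modPoly f (∑ i, X i * q i) := by
  choose q hq hqy using fun i => (y i).2
  refine ⟨q, hq, hqy, ?_⟩
  rw [sumXMul_apply, map_sum]
  exact Finset.sum_congr rfl fun i _ => by rw [modPoly_mul, hqy]

theorem sumXMul_range_le (f : R4 k) {ι : Type} (w : ι → Fin 4 → k) (d : ℕ) :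
    LinearMap.range (sumXMul f w d) ≤ (formsThrough w (d + 1)).map (modPoly f) := by
  rintro _ ⟨y, rfl⟩
  obtain ⟨q, hq, -, h⟩ := exists_sumXMul_eq f w d y
  rw [h]
  refine ⟨_, Submodule.sum_mem _ fun i _ => mem_formsThrough.mpr ⟨?_, fun p => ?_⟩, rfl⟩
  · rw [add_comm]; exact (isHomogeneous_X k i).mul (mem_formsThrough.mp (hq i)).1
  · rw [map_mul, show eval (w p) (q i) = 0 from (mem_formsThrough.mp (hq i)).2 p, mul_zero]

theorem KoszulInjective.sumXMul_injective {f : R4 k} {ι : Type} {w : ι → Fin 4 → k} {a : ℕ}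
    (h : KoszulInjective f w a) : Function.Injective (sumXMul f w a) := by
  rw [← LinearMap.ker_eq_bot, LinearMap.ker_eq_bot']
  intro y hy
  obtain ⟨q, hq, hqy, h'⟩ := exists_sumXMul_eq f w a y
  rw [h', modPoly_eq_zero] at hy
  have := h q (fun i => (mem_formsThrough.mp (hq i)).1) (fun i => (mem_formsThrough.mp (hq i)).2) hy
  funext i
  apply Subtype.ext
  rw [← hqy, modPoly_eq_zero.mpr (this i)]
  rfl

theorem KoszulInjective.four_mul_finrank_le {f : R4 k} {ι : Type} {w : ι → Fin 4 → k} {a : ℕ}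
    (h : KoszulInjective f w a) : 4 * Module.finrank k ((formsThrough w a).map (modPoly f)) ≤
      Module.finrank k ((formsThrough w (a + 1)).map (modPoly f)) := by
  have h1 := LinearMap.finrank_range_of_inj h.sumXMul_injective
  rw [Module.finrank_pi_fintype, Finset.sum_const, Finset.card_univ, Fintype.card_fin,
    smul_eq_mul] at h1
  rw [← h1]
  exact Submodule.finrank_mono (sumXMul_range_le f w a)

theorem triangle_succ (d : ℕ) : (d + 1) * (d + 1 + 1) / 2 = d * (d + 1) / 2 + (d + 1) := by
  rw [show (d + 1) * (d + 1 + 1) = d * (d + 1) + (d + 1) * 2 by ring,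
    Nat.add_mul_div_right _ _ (by norm_num)]

theorem triangle_pred (d : ℕ) : d * (d + 1) / 2 = d * (d - 1) / 2 + d := by
  cases d with
  | zero => rfl
  | succ d => rw [triangle_succ, Nat.add_sub_cancel, mul_comm]

variable {f : R4 k} {ι : Type} [Fintype ι] {w : ι → Fin 4 → k} {a : ℕ}

theorem KoszulInjective.interpolates [Infinite k] (h : KoszulInjective f w a)
    (hf : f.IsHomogeneous 3) (hf0 : f ≠ 0) (hw : ∀ i, w i ≠ 0) (hfw : VanishesOn w f)
    (hcard : Fintype.card ι = 3 * (a * (a - 1) / 2) + 2 * a) : Interpolates w a := by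
  rw [interpolates_iff, hcard]
  have h1 := finrank_map_modPoly_add hf hf0 hfw a
  have h2 := finrank_map_modPoly_add hf hf0 hfw (a + 1)
  have h3 := h.four_mul_finrank_le
  have h4 := finrank_map_evalFamily_le_succ hw a
  have h5 : Module.finrank k ((forms k a).map (evalFamily w)) ≤ Fintype.card ι := by
    rw [← Module.finrank_fintype_fun_eq_card k]
    exact Submodule.finrank_le _
  rw [triangle_succ] at h2
  rw [triangle_pred] at h1 h2
  omega

theorem Interpolates.finrank_map_modPoly (hf : f.IsHomogeneous 3)
    (hf0 : f ≠ 0) (hfw : VanishesOn w f)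
    (hcard : Fintype.card ι = 3 * (a * (a - 1) / 2) + 2 * a) {d : ℕ} (hd : Interpolates w d) :
    Module.finrank k ((formsThrough w d).map (modPoly f)) + (3 * (a * (a - 1) / 2) + 2 * a) =
      3 * (d * (d + 1) / 2) + 1 := by
  have h1 := finrank_map_modPoly_add hf hf0 hfw d
  rw [interpolates_iff] at hd
  omega

theorem KoszulInjective.exists_sum_X_mul [Infinite k] (h : KoszulInjective f w a)
    (hf : f.IsHomogeneous 3) (hf0 : f ≠ 0) (hw : ∀ i, w i ≠ 0) (hfw : VanishesOn w f)
    (hcard : Fintype.card ι = 3 * (a * (a - 1) / 2) + 2 * a) {x : R4 k}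
    (hx : x.IsHomogeneous (a + 1)) (hxw : VanishesOn w x) :
    ∃ q : Fin 4 → R4 k, (∀ i, (q i).IsHomogeneous a) ∧ (∀ i, VanishesOn w (q i)) ∧
      f ∣ x - ∑ i, X i * q i := by
  have hi := h.interpolates hf hf0 hw hfw hcard
  have h0 := Interpolates.finrank_map_modPoly hf hf0 hfw hcard hi
  have h1 := Interpolates.finrank_map_modPoly hf hf0 hfw hcard (hi.succ hw)
  have h2 := LinearMap.finrank_range_of_inj h.sumXMul_injective
  rw [Module.finrank_pi_fintype, Finset.sum_const, Finset.card_univ, Fintype.card_fin,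
    smul_eq_mul] at h2
  have h3 := Submodule.eq_of_le_of_finrank_eq (sumXMul_range_le f w a) (by
    rw [triangle_succ] at h1
    rw [triangle_pred] at h0 h1
    omega)
  obtain ⟨y, hy⟩ : modPoly f x ∈ LinearMap.range (sumXMul f w a) := by
    rw [h3]
    exact ⟨x, mem_formsThrough.mpr ⟨hx, hxw⟩, rfl⟩
  obtain ⟨q, hq, -, hqy⟩ := exists_sumXMul_eq f w a y
  exact ⟨q, fun i => (mem_formsThrough.mp (hq i)).1, fun i => (mem_formsThrough.mp (hq i)).2,
    modPoly_eq.mp (hy.symm.trans hqy)⟩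

end Generators

section Vectors

variable {k : Type} [Field k]

theorem exists_basis_of_finrank_eq {M : Type} [AddCommGroup M] [Module k M] {S : Submodule k M}
    [FiniteDimensional k S] {n : ℕ} (h : Module.finrank k S = n) :
    ∃ b : Fin n → M, (∀ i, b i ∈ S) ∧ (∀ x ∈ S, ∃ c : Fin n → k, x = ∑ i, c i • b i) ∧
      ∀ c : Fin n → k, ∑ i, c i • b i = 0 → c = 0 := by
  let B := Module.finBasisOfFinrankEq k S h
  refine ⟨fun i => B i, fun i => (B i).2, fun x hx => ⟨B.repr ⟨x, hx⟩, ?_⟩, fun c hc => ?_⟩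
  · have := congrArg Subtype.val (B.sum_repr ⟨x, hx⟩)
    rw [Submodule.coe_sum] at this
    exact this.symm
  · have : ∑ i, c i • B i = 0 := Subtype.ext (by simpa using hc)
    exact funext (Fintype.linearIndependent_iff.mp B.linearIndependent c this)

variable (k) in
/-- The space of vectors of forms of degree `d`. -/
noncomputable def vecForms (α : Type) (d : ℕ) : Submodule k (α → R4 k) :=
  Submodule.pi Set.univ fun _ => forms k d

theorem mem_vecForms {α : Type} {d : ℕ} {x : α → R4 k} :
    x ∈ vecForms k α d ↔ ∀ j, (x j).IsHomogeneous d := by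
  simp [vecForms, Submodule.mem_pi]

/-- Vectors of forms, as a family of elements of the spaces of forms. -/
noncomputable def vecFormsEquiv (α : Type) (d : ℕ) : (α → forms k d) ≃ₗ[k] vecForms k α d where
  toFun x := ⟨fun j => x j, mem_vecForms.mpr fun j => (x j).2⟩
  invFun x j := ⟨x.1 j, mem_vecForms.mp x.2 j⟩
  map_add' _ _ := rfl
  map_smul' _ _ := rfl
  left_inv _ := rfl
  right_inv _ := rfl

instance (α : Type) [Finite α] (d : ℕ) : FiniteDimensional k (vecForms k α d) :=
  Module.Finite.equiv (vecFormsEquiv α d)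

theorem finrank_vecForms (α : Type) [Fintype α] (d : ℕ) :
    Module.finrank k (vecForms k α d) = Fintype.card α * (d + 3).choose 3 := by
  rw [← (vecFormsEquiv α d).finrank_eq, Module.finrank_pi_fintype, Finset.sum_const,
    Finset.card_univ, smul_eq_mul, finrank_forms]

theorem vecComponent_linearCombination {α β : Type} [Fintype β] {c : ℕ} (M : β → α → R4 k)
    (hM : ∀ i j, (M i j).IsHomogeneous c) (d : ℕ) (u : β → R4 k) :
    vecComponent (d + c) (Fintype.linearCombination (R4 k) M u) =
      Fintype.linearCombination (R4 k) M (vecComponent d u) := by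
  funext j
  simp only [Fintype.linearCombination_apply, Finset.sum_apply, Pi.smul_apply, smul_eq_mul,
    vecComponent]
  exact homogeneousComponent_sum_mul u (fun i => M i j) (fun i => hM i j) d

theorem linearCombination_C {M : Type} [AddCommGroup M] [Module (R4 k) M] [Module k M]
    [IsScalarTower k (R4 k) M] {β : Type} [Fintype β] (b : β → M) (c : β → k) :
    Fintype.linearCombination (R4 k) b (fun i => C (c i)) = ∑ i, c i • b i := by
  rw [Fintype.linearCombination_apply]
  refine Finset.sum_congr rfl fun i _ => ?_
  rw [← algebraMap_eq, algebraMap_smul]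

theorem exists_C_of_isHomogeneous_zero {β : Type} {u : β → R4 k}
    (hu : ∀ i, (u i).IsHomogeneous 0) : ∃ c : β → k, u = fun i => C (c i) :=
  ⟨fun i => coeff 0 (u i), funext fun i => by
    conv_lhs => rw [← homogeneousComponent_of_isHomogeneous (hu i), homogeneousComponent_zero]⟩

end Vectors

section Resolution

variable {k : Type} [Field k] {f : R4 k} {ι : Type} {w : ι → Fin 4 → k} {a : ℕ}

theorem exists_generators [Infinite k] [Fintype ι] (h : KoszulInjective f w a) (hf : f.IsHomogeneous 3)
    (hf0 : f ≠ 0) (hw : ∀ i, w i ≠ 0) (hfw : VanishesOn w f)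
    (hcard : Fintype.card ι = 3 * (a * (a - 1) / 2) + 2 * a) :
    ∃ g : Fin (a + 1) → R4 k, (∀ j, (g j).IsHomogeneous a ∧ VanishesOn w (g j)) ∧
      (∀ d x, x.IsHomogeneous (a + d) → VanishesOn w x → ∃ W : Fin (a + 1) → R4 k,
        (∀ j, (W j).IsHomogeneous d) ∧ f ∣ x - Fintype.linearCombination (R4 k) g W) ∧
      ∀ d ≤ 1, ∀ W : Fin (a + 1) → R4 k, (∀ j, (W j).IsHomogeneous d) →
        f ∣ Fintype.linearCombination (R4 k) g W → W = 0 := by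
  have hi := h.interpolates hf hf0 hw hfw hcard
  have h0 := Interpolates.finrank_map_modPoly hf hf0 hfw hcard hi
  obtain ⟨b, hb, hspan, hind⟩ := exists_basis_of_finrank_eq (n := a + 1)
    (S := (formsThrough w a).map (modPoly f)) (by rw [triangle_pred] at h0; omega)
  choose g hg hgb using hb
  have hg' := fun j => mem_formsThrough.mp (hg j)
  have hC : ∀ c : Fin (a + 1) → k, modPoly f (Fintype.linearCombination (R4 k) g
      fun i => C (c i)) = ∑ i, c i • b i := fun c => by
    rw [linearCombination_C, map_sum]
    simp only [map_smul, hgb]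
  have hlow0 : ∀ W : Fin (a + 1) → R4 k, (∀ j, (W j).IsHomogeneous 0) →
        f ∣ Fintype.linearCombination (R4 k) g W → W = 0 := by
    intro W hW hfW
    obtain ⟨c, rfl⟩ := exists_C_of_isHomogeneous_zero hW
    rw [hind c (by rw [← hC, modPoly_eq_zero.mpr hfW])]
    funext i
    exact C_0
  have hgen : ∀ d (x : R4 k), x.IsHomogeneous (a + d) → VanishesOn w x →
      ∃ W : Fin (a + 1) → R4 k, (∀ j, (W j).IsHomogeneous d) ∧
        f ∣ x - Fintype.linearCombination (R4 k) g W := by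
    intro d
    have step : ∀ (d : ℕ) (x : R4 k) (q : Fin 4 → R4 k), (∀ i, ∃ W : Fin (a + 1) → R4 k,
        (∀ j, (W j).IsHomogeneous d) ∧ f ∣ q i - Fintype.linearCombination (R4 k) g W) →
        f ∣ x - ∑ i, X i * q i → ∃ W : Fin (a + 1) → R4 k, (∀ j, (W j).IsHomogeneous (d + 1)) ∧
        f ∣ x - Fintype.linearCombination (R4 k) g W := by
      intro d x q hq hx
      choose W hW hWq using hq
      refine ⟨∑ i, (X i : R4 k) • W i, fun j => ?_, ?_⟩
      · rw [Finset.sum_apply, add_comm d 1]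
        exact IsHomogeneous.sum _ _ _ fun i _ => (isHomogeneous_X k i).mul (hW i j)
      · have h1 : f ∣ ∑ i, X i * (q i - Fintype.linearCombination (R4 k) g (W i)) :=
          Finset.dvd_sum fun i _ => (hWq i).mul_left _
        refine dvd_of_eq_combo₂ 1 1 hx h1 ?_
        simp only [map_sum, map_smul, smul_eq_mul, mul_sub, Finset.sum_sub_distrib]
        ring
    induction d with
    | zero =>
      intro x hx hxw
      obtain ⟨c, hc⟩ := hspan (modPoly f x) ⟨x, mem_formsThrough.mpr ⟨hx, hxw⟩, rfl⟩
      exact ⟨fun i => C (c i), fun j => isHomogeneous_C _ _,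
        modPoly_eq.mp (hc.trans (hC c).symm)⟩
    | succ d ih =>
      intro x hx hxw
      cases d with
      | zero =>
        obtain ⟨q, hq, hqw, hqx⟩ := h.exists_sum_X_mul hf hf0 hw hfw hcard hx hxw
        exact step 0 x q (fun i => ih _ (hq i) (hqw i)) hqx
      | succ d =>
        obtain ⟨q, hq, hqw, rfl⟩ := (hi.of_le hw (Nat.le_add_right a d)).exists_sum_X_mul hw hx hxw
        exact step _ _ q (fun i => ih _ (hq i) (hqw i)) (by rw [sub_self]; exact dvd_zero _)
  refine ⟨g, hg', hgen, fun d hd W hW hfW => ?_⟩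
  interval_cases d
  · exact hlow0 W hW hfW
  · obtain ⟨q, hq, rfl⟩ := exists_vec_sum_X_smul hW
    simp only [map_sum, map_smul, smul_eq_mul] at hfW
    have hq' := h _ (fun i => ?_) (fun i p => ?_) hfW
    · refine Finset.sum_eq_zero fun i _ => ?_
      rw [hlow0 (q i) (hq i) (hq' i), smul_zero]
    · rw [Fintype.linearCombination_apply]
      exact IsHomogeneous.sum _ _ _ fun j _ => by simpa using (hq i j).mul (hg' j).1
    · rw [Fintype.linearCombination_apply, map_sum]
      exact Finset.sum_eq_zero fun j _ => by
        rw [smul_eq_mul, map_mul, show eval (w p) (g j) = 0 from (hg' j).2 p, mul_zero]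

theorem finrank_inf_ker_generators {g : Fin (a + 1) → R4 k}
    (hg : ∀ j, (g j).IsHomogeneous a ∧ VanishesOn w (g j)) {d : ℕ}
    (hgen : ∀ x, x.IsHomogeneous (a + d) → VanishesOn w x → ∃ W : Fin (a + 1) → R4 k,
        (∀ j, (W j).IsHomogeneous d) ∧ f ∣ x - Fintype.linearCombination (R4 k) g W) :
    Module.finrank k ((formsThrough w (a + d)).map (modPoly f)) +
      Module.finrank k (vecForms k (Fin (a + 1)) d ⊓ LinearMap.ker
        (modPoly f ∘ₗ (Fintype.linearCombination (R4 k) g).restrictScalars k) : Submodule k _) =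
      (a + 1) * (d + 3).choose 3 := by
  have h1 := finrank_map_add_finrank_inf_ker
    (modPoly f ∘ₗ (Fintype.linearCombination (R4 k) g).restrictScalars k)
    (vecForms k (Fin (a + 1)) d)
  rw [finrank_vecForms, Fintype.card_fin] at h1
  suffices hS : (formsThrough w (a + d)).map (modPoly f) = (vecForms k (Fin (a + 1)) d).map
      (modPoly f ∘ₗ (Fintype.linearCombination (R4 k) g).restrictScalars k) by
    rw [hS]
    exact h1
  ext y
  constructor
  · rintro ⟨x, hx, rfl⟩
    obtain ⟨hx, hxw⟩ := mem_formsThrough.mp hx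
    obtain ⟨W, hW, hWx⟩ := hgen x hx hxw
    exact ⟨W, mem_vecForms.mpr hW, (modPoly_eq.mpr hWx).symm⟩
  · rintro ⟨W, hW, rfl⟩
    have hW := mem_vecForms.mp hW
    refine ⟨_, mem_formsThrough.mpr ⟨?_, fun p => ?_⟩, rfl⟩
    · simp only [LinearMap.restrictScalars_apply, Fintype.linearCombination_apply, smul_eq_mul]
      exact IsHomogeneous.sum _ _ _ fun j _ => add_comm a d ▸ (hW j).mul (hg j).1
    · simp only [LinearMap.restrictScalars_apply, Fintype.linearCombination_apply, map_sum]
      exact Finset.sum_eq_zero fun j _ => by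
        rw [smul_eq_mul, map_mul, show eval (w p) (g j) = 0 from (hg j).2 p, mul_zero]

theorem exists_lowPresentation [Infinite k] [Fintype ι] (h : KoszulInjective f w a) (hfp : Prime f)
    (hf : f.IsHomogeneous 3) (hw : ∀ i, w i ≠ 0) (hfw : VanishesOn w f)
    (hcard : Fintype.card ι = 3 * (a * (a - 1) / 2) + 2 * a) :
    ∃ (g : Fin (a + 1) → R4 k) (M2 : Fin (3 * a) → Fin (a + 1) → R4 k),
      (∀ j, (g j).IsHomogeneous a ∧ VanishesOn w (g j)) ∧ (∀ i j, (M2 i j).IsHomogeneous 2) ∧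
      LowPresentation f w a (Fintype.linearCombination (R4 k) g)
        (Fintype.linearCombination (R4 k) M2) := by
  have hf0 := hfp.ne_zero
  have hi := h.interpolates hf hf0 hw hfw hcard
  obtain ⟨g, hg, hgen, hlow⟩ := exists_generators h hf hf0 hw hfw hcard
  have h1 := finrank_inf_ker_generators hg (hgen 2)
  have h2 := Interpolates.finrank_map_modPoly hf hf0 hfw hcard
    (hi.of_le hw (Nat.le_add_right a 2))
  rw [show a + 2 = a + 1 + 1 from rfl, triangle_succ, triangle_succ, triangle_pred] at h2
  rw [show Nat.choose (2 + 3) 3 = 10 from rfl, show a + 2 = a + 1 + 1 from rfl] at h1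
  obtain ⟨M2, hM2, hspan, hind⟩ := exists_basis_of_finrank_eq (n := 3 * a)
    (S := vecForms k (Fin (a + 1)) 2 ⊓ LinearMap.ker
        (modPoly f ∘ₗ (Fintype.linearCombination (R4 k) g).restrictScalars k)) (by omega)
  have hM2' := fun i => mem_vecForms.mp (hM2 i).1
  have hM2f : ∀ i, f ∣ Fintype.linearCombination (R4 k) g (M2 i) := fun i =>
    modPoly_eq_zero.mp (hM2 i).2
  refine ⟨g, M2, hg, hM2', hfp, hf, hw, hfw, fun d hd => hi.of_le hw hd, fun d x => ?_,
    fun x p => ?_, hgen, hlow, fun d u => vecComponent_linearCombination M2 hM2' d u, fun u => ?_,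
    fun W hW hfW => ?_, fun u hu hu0 => ?_⟩
  · simp only [Fintype.linearCombination_apply, smul_eq_mul]
    rw [add_comm]
    exact homogeneousComponent_sum_mul x g (fun j => (hg j).1) d
  · rw [Fintype.linearCombination_apply, map_sum]
    exact Finset.sum_eq_zero fun j _ => by
      rw [smul_eq_mul, map_mul, show eval (w p) (g j) = 0 from (hg j).2 p, mul_zero]
  · rw [Fintype.linearCombination_apply (R4 k) M2, map_sum]
    exact Finset.dvd_sum fun i _ => by
      rw [map_smul, smul_eq_mul]
      exact (hM2f i).mul_left _
  · obtain ⟨c, hc⟩ := hspan W ⟨mem_vecForms.mpr hW, modPoly_eq_zero.mpr hfW⟩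
    exact ⟨fun i => C (c i), by rw [linearCombination_C]; exact hc⟩
  · obtain ⟨c, rfl⟩ := exists_C_of_isHomogeneous_zero hu
    rw [linearCombination_C] at hu0
    rw [hind c hu0]
    funext i
    exact C_0

theorem exists_lowResolution [Infinite k] [Fintype ι] (h : KoszulInjective f w a) (hfp : Prime f)
    (hf : f.IsHomogeneous 3) (hw : ∀ i, w i ≠ 0) (hfw : VanishesOn w f)
    (hcard : Fintype.card ι = 3 * (a * (a - 1) / 2) + 2 * a) (ha : 1 ≤ a) :
    ∃ (g : Fin (a + 1) → R4 k) (M2 : Fin (3 * a) → Fin (a + 1) → R4 k)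
      (M3 : Fin (2 * a - 1) → Fin (3 * a) → R4 k),
      (∀ j, (g j).IsHomogeneous a) ∧ (∀ i j, (M2 i j).IsHomogeneous 2) ∧
      (∀ l i, (M3 l i).IsHomogeneous 1) ∧
      LowResolution f w a (Fintype.linearCombination (R4 k) g)
        (Fintype.linearCombination (R4 k) M2) (Fintype.linearCombination (R4 k) M3) := by
  have hf0 := hfp.ne_zero
  have hi := h.interpolates hf hf0 hw hfw hcard
  obtain ⟨g, M2, hg, hM2, H⟩ := exists_lowPresentation h hfp hf hw hfw hcard
  have h1 := finrank_inf_ker_generators hg (H.gen₁ 3)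
  have h2 := Interpolates.finrank_map_modPoly hf hf0 hfw hcard
    (hi.of_le hw (Nat.le_add_right a 3))
  rw [show a + 3 = a + 1 + 1 + 1 from rfl, triangle_succ, triangle_succ, triangle_succ,
    triangle_pred] at h2
  rw [show Nat.choose (3 + 3) 3 = 20 from rfl, show a + 3 = a + 1 + 1 + 1 from rfl] at h1
  have h3 := finrank_map_add_finrank_inf_ker
    ((Fintype.linearCombination (R4 k) M2).restrictScalars k) (vecForms k (Fin (3 * a)) 1)
  rw [finrank_vecForms, Fintype.card_fin, show Nat.choose (1 + 3) 3 = 4 from rfl] at h3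
  have h4 : (vecForms k (Fin (3 * a)) 1).map
      ((Fintype.linearCombination (R4 k) M2).restrictScalars k) =
      vecForms k (Fin (a + 1)) 3 ⊓ LinearMap.ker
        (modPoly f ∘ₗ (Fintype.linearCombination (R4 k) g).restrictScalars k) := by
    ext W
    constructor
    · rintro ⟨u, hu, rfl⟩
      have hu := mem_vecForms.mp hu
      refine ⟨mem_vecForms.mpr fun j => ?_, modPoly_eq_zero.mpr (H.syz₂ u)⟩
      rw [LinearMap.restrictScalars_apply, ← vecComponent_eq_self hu, ← H.comp₂]
      exact vecComponent_isHomogeneous _ _ j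
    · rintro ⟨hW, hfW⟩
      obtain ⟨u, rfl⟩ := H.exists_map₂ ha (modPoly_eq_zero.mp hfW)
      refine ⟨vecComponent 1 u, mem_vecForms.mpr (vecComponent_isHomogeneous 1 u), ?_⟩
      rw [LinearMap.restrictScalars_apply, ← H.comp₂]
      exact vecComponent_eq_self (mem_vecForms.mp hW)
  rw [h4] at h3
  obtain ⟨M3, hM3, hspan, hind⟩ := exists_basis_of_finrank_eq (n := 2 * a - 1)
    (S := vecForms k (Fin (3 * a)) 1 ⊓ LinearMap.ker
        ((Fintype.linearCombination (R4 k) M2).restrictScalars k)) (by omega)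
  have hM3' := fun i => mem_vecForms.mp (hM3 i).1
  have hM3f : ∀ i, Fintype.linearCombination (R4 k) M2 (M3 i) = 0 := fun i => (hM3 i).2
  refine ⟨g, M2, M3, fun j => (hg j).1, hM2, hM3', H,
    fun d t => vecComponent_linearCombination M3 hM3' d t, fun t => ?_,
    fun u hu hu0 => ?_, fun t ht ht0 => ?_⟩
  · rw [Fintype.linearCombination_apply (R4 k) M3, map_sum]
    exact Finset.sum_eq_zero fun i _ => by rw [map_smul, hM3f, smul_zero]
  · obtain ⟨c, hc⟩ := hspan u ⟨mem_vecForms.mpr hu, hu0⟩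
    exact ⟨fun i => C (c i), by rw [linearCombination_C]; exact hc⟩
  · obtain ⟨c, rfl⟩ := exists_C_of_isHomogeneous_zero ht
    rw [linearCombination_C] at ht0
    rw [hind c ht0]
    funext i
    exact C_0

end Resolution

section Betti

variable {k : Type} [Field k]

theorem KoszulInjective.dvd_of_lt {f : R4 k} {ι : Type} {w : ι → Fin 4 → k} {a : ℕ}
    (h : KoszulInjective f w a) (hfp : Prime f) (hf : f.IsHomogeneous 3) {p : R4 k} {d : ℕ}
    (hp : p.IsHomogeneous d) (hpw : VanishesOn w p) (hd : d < a) : f ∣ p := by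
  obtain ⟨e, rfl⟩ := Nat.exists_eq_add_of_lt hd
  have hX : ∀ i : Fin 4, ¬ f ∣ X i := fun i hi =>
    X_ne_zero i (eq_zero_of_dvd_of_lt hf hi (isHomogeneous_X k i) (by norm_num))
  have h1 : (X 0 ^ e * p : R4 k).IsHomogeneous (e + d) := by
    simpa using ((isHomogeneous_X k (0 : Fin 4)).pow e).mul hp
  have h2 := h ![X 1 * (X 0 ^ e * p), -(X 0 * (X 0 ^ e * p)), 0, 0] (fun i => ?_) (fun i q => ?_) ?_ 0
  · rcases hfp.dvd_or_dvd h2 with h3 | h3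
    · exact absurd h3 (hX 1)
    · exact (hfp.dvd_or_dvd h3).resolve_left fun h4 => hX 0 (hfp.dvd_of_dvd_pow h4)
  · have e1 : d + e + 1 = 1 + (e + d) := by ring
    rw [e1]
    fin_cases i
    · exact (isHomogeneous_X k (1 : Fin 4)).mul h1
    · exact ((isHomogeneous_X k (0 : Fin 4)).mul h1).neg
    · exact isHomogeneous_zero _ _ _
    · exact isHomogeneous_zero _ _ _
  · have hq : eval (w q) p = 0 := hpw q
    fin_cases i <;> simp [hq]
  · have : ∑ i : Fin 4, X i * (![X 1 * (X 0 ^ e * p), -(X 0 * (X 0 ^ e * p)), 0, 0] : Fin 4 → R4 k) i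
        = 0 := by
      simp only [Fin.sum_univ_four, Matrix.cons_val]
      ring
    rw [this]
    exact dvd_zero f

theorem entryOk_of_isHomogeneous {d e c : ℕ} {q : R4 k} (hq : q.IsHomogeneous c) (hc : c ≠ 0)
    (h : d = e + c) : EntryOk k d e q :=
  ⟨Or.inr ⟨c, h, hq⟩, by
    by_contra h0
    have := hq h0
    simp at this
    exact hc this.symm⟩

theorem LowResolution.res3Body {f : R4 k} {ι : Type} {w : ι → Fin 4 → k} {a n₁ n₂ n₃ : ℕ}
    {g : Fin n₁ → R4 k} {M2 : Fin n₂ → Fin n₁ → R4 k} {M3 : Fin n₃ → Fin n₂ → R4 k}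
    (H : LowResolution f w a (Fintype.linearCombination (R4 k) g)
      (Fintype.linearCombination (R4 k) M2) (Fintype.linearCombination (R4 k) M3)) (ha : 1 ≤ a)
    (hg : ∀ j, (g j).IsHomogeneous a) (hM2 : ∀ i j, (M2 i j).IsHomogeneous 2)
    (hM3 : ∀ l i, (M3 l i).IsHomogeneous 1)
    (hlow : ∀ p d, p.IsHomogeneous d → VanishesOn w p → d < a → f ∣ p) {I : Ideal (R4 k)}
    (hI : ∀ (p : R4 k) (d : ℕ), p.IsHomogeneous d → (p ∈ I ↔ VanishesOn w p))
    (hIc : ∀ p ∈ I, ∀ d, homogeneousComponent d p ∈ I) :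
    Res3Body k (Ideal.span {f}) I (fun _ => a) (fun _ => a + 2) (fun _ => a + 3) g M2 M3 := by
  have e1 : ∀ W : Fin n₁ → R4 k, Fintype.linearCombination (R4 k) g W = ∑ j, W j * g j :=
    fun W => Fintype.linearCombination_apply _ _ _
  have e2 : ∀ (u : Fin n₂ → R4 k) j, Fintype.linearCombination (R4 k) M2 u j =
      ∑ i, u i * M2 i j := fun u j => by
    simp [Fintype.linearCombination_apply]
  have e3 : ∀ (t : Fin n₃ → R4 k) i, Fintype.linearCombination (R4 k) M3 t i =
      ∑ l, t l * M3 l i := fun t j => by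
    simp [Fintype.linearCombination_apply]
  refine ⟨?_, ?_, ?_, ?_, ?_, ?_, ?_⟩
  · intro j
    refine ⟨(hI (g j) a (hg j)).mpr ?_, hg j⟩
    have := H.vanish₁ (Pi.single j 1)
    rwa [Fintype.linearCombination_apply_single, one_smul] at this
  · intro x hx
    have hd : ∀ d, ∃ W, f ∣ homogeneousComponent d x - Fintype.linearCombination (R4 k) g W := by
      intro d
      have hxd := (homogeneousComponent_isHomogeneous d x)
      have hv := (hI _ d hxd).mp (hIc x hx d)
      rcases lt_or_ge d a with hda | hda
      · exact ⟨0, by rw [map_zero, sub_zero]; exact hlow _ _ hxd hv hda⟩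
      · obtain ⟨e, rfl⟩ := Nat.exists_eq_add_of_le hda
        obtain ⟨W, -, hW⟩ := H.gen₁ e _ hxd hv
        exact ⟨W, hW⟩
    choose W hW using hd
    refine ⟨∑ d ∈ Finset.range (x.totalDegree + 1), W d, ?_⟩
    rw [Ideal.mem_span_singleton, ← e1, map_sum]
    have hx' := sum_homogeneousComponent x
    refine (Finset.dvd_sum fun d (_ : d ∈ Finset.range (x.totalDegree + 1)) => hW d).trans ?_
    rw [Finset.sum_sub_distrib, hx']
  · exact fun i j => entryOk_of_isHomogeneous (hM2 i j) two_ne_zero rfl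
  · exact fun l i => entryOk_of_isHomogeneous (hM3 l i) one_ne_zero rfl
  · intro W
    rw [Ideal.mem_span_singleton, ← e1]
    constructor
    · intro hfW
      obtain ⟨u, rfl⟩ := H.exists_map₂ ha hfW
      exact ⟨u, e2 u⟩
    · rintro ⟨u, hu⟩
      have hW : W = Fintype.linearCombination (R4 k) M2 u := funext fun j => by rw [hu, e2]
      rw [hW]
      exact H.syz₂ u
  · intro u
    constructor
    · intro hu
      have hu0 : Fintype.linearCombination (R4 k) M2 u = 0 :=
        funext fun j => by rw [e2, hu j, Pi.zero_apply]
      obtain ⟨t, rfl⟩ := H.exists_map₃ ha hu0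
      exact ⟨t, e3 t⟩
    · rintro ⟨t, ht⟩ j
      have hu : u = Fintype.linearCombination (R4 k) M3 t := funext fun i => by rw [ht, e3]
      rw [← e2, hu, H.syz₃, Pi.zero_apply]
  · intro t ht
    have ht0 : Fintype.linearCombination (R4 k) M3 t = 0 :=
      funext fun i => by rw [e3, ht i, Pi.zero_apply]
    exact H.map₃_injective ha ht0

theorem KoszulInjective.hasMinFreeRes3 [Infinite k] {f : R4 k} {ι : Type} [Fintype ι]
    {w : ι → Fin 4 → k} {a : ℕ} (h : KoszulInjective f w a) (hfp : Prime f)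
    (hf : f.IsHomogeneous 3) (hw : ∀ i, w i ≠ 0) (hfw : VanishesOn w f)
    (hcard : Fintype.card ι = 3 * (a * (a - 1) / 2) + 2 * a) (ha : 1 ≤ a) {I : Ideal (R4 k)}
    (hI : ∀ (p : R4 k) (d : ℕ), p.IsHomogeneous d → (p ∈ I ↔ VanishesOn w p))
    (hIc : ∀ p ∈ I, ∀ d, homogeneousComponent d p ∈ I) :
    HasMinFreeRes3 k (Ideal.span {f}) I (fun _ : Fin (a + 1) => a) (fun _ : Fin (3 * a) => a + 2)
      (fun _ : Fin (2 * a - 1) => a + 3) := by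
  obtain ⟨g, M2, M3, hg, hM2, hM3, H⟩ := exists_lowResolution h hfp hf hw hfw hcard ha
  exact ⟨g, M2, M3, H.res3Body ha hg hM2 hM3
    (fun p d hp hpw hd => h.dvd_of_lt hfp hf hp hpw hd) hI hIc⟩

end Betti

section Points

variable {k : Type} [Field k] {t : ℕ} {Z : Fin t → P3 k} {v : Fin t → Fin 4 → k}

/-- The vectors `v i` are representatives of the points `Z i`. -/
def Represents (v : Fin t → Fin 4 → k) (Z : Fin t → P3 k) : Prop :=
  ∀ i, ∃ hv : v i ≠ 0, Projectivization.mk k (v i) hv = Z i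

theorem Represents.vanishesAt_iff (h : Represents v Z) {p : R4 k} {d : ℕ} (hp : p.IsHomogeneous d)
    (i : Fin t) : VanishesAt k p (Z i) ↔ eval (v i) p = 0 := by
  obtain ⟨hv, hvZ⟩ := h i
  refine ⟨fun H => H _ hv hvZ, fun H u hu huZ => ?_⟩
  rw [← hvZ, Projectivization.mk_eq_mk_iff'] at huZ
  obtain ⟨c, rfl⟩ := huZ
  rw [eval_smul_of_isHomogeneous hp, H, mul_zero]

theorem Represents.mem_pointsIdeal_iff (h : Represents v Z) {p : R4 k} {d : ℕ}
    (hp : p.IsHomogeneous d) : p ∈ pointsIdeal k (Set.range Z) ↔ VanishesOn v p := by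
  change (∀ q ∈ Set.range Z, VanishesAt k p q) ↔ _
  rw [Set.forall_mem_range]
  exact forall_congr' fun i => h.vanishesAt_iff hp i

theorem VanishesAt.homogeneousComponent [Infinite k] {p : R4 k} {q : P3 k}
    (h : VanishesAt k p q) (d : ℕ) : VanishesAt k (homogeneousComponent d p) q := by
  intro u hu huq
  let P : Polynomial k := ∑ e ∈ Finset.range (p.totalDegree + 1),
    Polynomial.C (eval u (MvPolynomial.homogeneousComponent e p)) * Polynomial.X ^ e
  have hP : P = 0 := by
    refine Polynomial.eq_zero_of_infinite_isRoot P (Set.Infinite.mono (s := {0}ᶜ) ?_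
      (Set.finite_singleton _).infinite_compl)
    intro c hc
    have h1 := h (c • u) (smul_ne_zero hc hu) (by
      rw [← huq, Projectivization.mk_eq_mk_iff']
      exact ⟨c, rfl⟩)
    rw [← sum_homogeneousComponent p, map_sum] at h1
    change P.eval c = 0
    rw [← h1, Polynomial.eval_finsetSum]
    refine Finset.sum_congr rfl fun e _ => ?_
    rw [eval_smul_of_isHomogeneous (homogeneousComponent_isHomogeneous e p)]
    rw [Polynomial.eval_mul, Polynomial.eval_C, Polynomial.eval_pow, Polynomial.eval_X, mul_comm]
  rcases lt_or_ge p.totalDegree d with hd | hd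
  · rw [homogeneousComponent_eq_zero _ _ hd, map_zero]
  · have := congrArg (Polynomial.coeff · d) hP
    simpa [P, Polynomial.finsetSum_coeff, Polynomial.coeff_C_mul, Polynomial.coeff_X_pow,
      Nat.lt_succ_iff, hd] using this

end Points

section OpenCondition

variable {k : Type} [Field k]

theorem KoszulInjective.eventually {f : R4 k} {t a : ℕ} {w₀ : Fin t → Fin 4 → k}
    (h : KoszulInjective f w₀ a) : ∀ᶠ x : Fin t × Fin 4 → k in zariskiNhds fun q => w₀ q.1 q.2,
      VanishesOn (fun p i => x (p, i)) f → KoszulInjective f (fun p i => x (p, i)) a := by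
  let T : (Fin 4 → R4 k) →ₗ[k] (R4 k ⧸ Ideal.span {f}) :=
    modPoly f ∘ₗ (Fintype.linearCombination (R4 k) (X : Fin 4 → R4 k)).restrictScalars k
  let U : (Fin 4 → R4 k) →ₗ[k] (Fin 4 → R4 k ⧸ Ideal.span {f}) :=
    LinearMap.pi fun i => modPoly f ∘ₗ LinearMap.proj i
  have hT : ∀ F, T F = 0 ↔ f ∣ ∑ i, X i * F i := fun F => by
    have : ∑ i, X i * F i = Fintype.linearCombination (R4 k) (X : Fin 4 → R4 k) F := by
      rw [Fintype.linearCombination_apply]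
      exact Finset.sum_congr rfl fun i _ => mul_comm _ _
    rw [this]
    exact modPoly_eq_zero
  have hU : ∀ F, U F = 0 ↔ ∀ i, f ∣ F i := fun F => by
    rw [funext_iff]
    exact forall_congr' fun i => modPoly_eq_zero
  obtain ⟨N, hN⟩ : ∃ N, Module.finrank k
    ((vecForms k (Fin 4) a ⊓ LinearMap.ker T).map U) = N := ⟨_, rfl⟩
  obtain ⟨b, hb, hspan, hind⟩ := exists_basis_of_finrank_eq hN
  choose B hB hBb using hb
  have hsum : ∀ c : Fin N → k, U (∑ s, c s • B s) = ∑ s, c s • b s := fun c => by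
    rw [map_sum]
    exact Finset.sum_congr rfl fun s _ => by rw [map_smul, hBb]
  have heval : ∀ (c : Fin N → k) (z : Fin 4 → k) (i : Fin 4),
      eval z ((∑ s, c s • B s) i) = ∑ s, eval z (B s i) * c s := fun c z i => by
    rw [Finset.sum_apply, map_sum]
    exact Finset.sum_congr rfl fun s _ => by rw [Pi.smul_apply, smul_eval, mul_comm]
  refine (eventually_injective (fun q : Fin t × Fin 4 => w₀ q.1 q.2)
    (fun (q : Fin t × Fin 4) s => rename (Prod.mk q.1) (B s q.2)) fun c hc => ?_).mono
    fun x hx hxf F hF hFx hfF => ?_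
  · have hmem : ∑ s, c s • B s ∈ vecForms k (Fin 4) a ⊓ LinearMap.ker T :=
      Submodule.sum_mem _ fun s _ => Submodule.smul_mem _ _ (hB s)
    apply hind
    rw [← hsum, hU]
    refine h _ (mem_vecForms.mp hmem.1) (fun i p => ?_) ((hT _).mp hmem.2)
    rw [heval]
    have h1 := hc (p, i)
    simp only [eval_rename] at h1
    exact h1
  · obtain ⟨c, hc⟩ := hspan (U F) ⟨F, ⟨mem_vecForms.mpr hF, (hT F).mpr hfF⟩, rfl⟩
    have h0 : ∀ i, f ∣ F i - (∑ s, c s • B s) i := by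
      rw [← hsum, ← sub_eq_zero, ← map_sub, hU] at hc
      exact hc
    have hc0 : c = 0 := by
      refine hx c fun q => ?_
      simp only [eval_rename]
      obtain ⟨r, hr⟩ := h0 q.2
      have h1 := congrArg (eval fun i => x (q.1, i)) hr
      rw [map_sub, map_mul, heval, show eval (fun i => x (q.1, i)) f = 0 from hxf q.1,
        show eval (fun i => x (q.1, i)) (F q.2) = 0 from hFx q.2 q.1, zero_mul, zero_sub,
        neg_eq_zero] at h1
      exact h1
    rw [← hU, hc, hc0]
    simp

end OpenCondition

section Count

variable {k : Type} [Field k]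

/-- Pairwise non-proportional vectors impose independent conditions on forms of large degree. -/
theorem exists_interpolates {ι : Type} [Fintype ι] {w : ι → Fin 4 → k} (hw : ∀ i, w i ≠ 0)
    (hww : ∀ i j, i ≠ j → ∀ t : k, w i ≠ t • w j) : ∃ d, Interpolates w d := by
  classical
  have hl : ∀ i j, ∃ l : R4 k, l.IsHomogeneous 1 ∧ eval (w j) l = 0 ∧ (i ≠ j → eval (w i) l ≠ 0) := by
    intro i j
    by_contra! hcon
    obtain ⟨c, hc⟩ := Function.ne_iff.mp (hw j)
    have h1 : ∀ s, i ≠ j ∧ w i s * w j c - w i c * w j s = 0 := fun s => by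
      have := hcon (X s * C (w j c) - X c * C (w j s)) (by
        refine IsHomogeneous.sub ?_ ?_ <;>
          exact (isHomogeneous_X k _).mul (isHomogeneous_C _ _)) (by simp; ring)
      simpa using this
    refine hww i j (h1 0).1 (w i c / w j c) (funext fun s => ?_)
    have h2 := (h1 s).2
    have hc' : w j c ≠ 0 := hc
    rw [Pi.smul_apply, smul_eq_mul]
    field_simp
    linear_combination h2
  choose l hl1 hl0 hl2 using hl
  refine ⟨Fintype.card ι - 1, fun c => ?_⟩
  let p (i : ι) : R4 k := ∏ j ∈ Finset.univ.erase i, l i j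
  have hp : ∀ i, (p i).IsHomogeneous (Fintype.card ι - 1) := fun i => by
    have := IsHomogeneous.prod (Finset.univ.erase i) (l i) (fun _ => 1) fun j _ => hl1 i j
    rwa [Finset.sum_const, smul_eq_mul, mul_one, Finset.card_erase_of_mem (Finset.mem_univ i),
      Finset.card_univ] at this
  have hpi : ∀ i, eval (w i) (p i) ≠ 0 := fun i => by
    rw [map_prod, Finset.prod_ne_zero_iff]
    exact fun j hj => hl2 i j (Finset.ne_of_mem_erase hj).symm
  have hpj : ∀ i j, i ≠ j → eval (w j) (p i) = 0 := fun i j hij => by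
    rw [map_prod]
    exact Finset.prod_eq_zero (Finset.mem_erase.mpr ⟨hij.symm, Finset.mem_univ j⟩) (hl0 i j)
  refine ⟨∑ i, C (c i / eval (w i) (p i)) * p i, IsHomogeneous.sum _ _ _ fun i _ => by
    simpa using (isHomogeneous_C (Fin 4) _).mul (hp i), fun i => ?_⟩
  rw [map_sum, Finset.sum_eq_single i (fun j _ hj => by rw [map_mul, hpj j i hj, mul_zero])
    (fun h => absurd (Finset.mem_univ i) h), map_mul, eval_C, div_mul_cancel₀ _ (hpi i)]

theorem finrank_forms_map_modPoly {f : R4 k} (hf : f.IsHomogeneous 3) (hf0 : f ≠ 0) (d : ℕ) :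
    Module.finrank k ((forms k d).map (modPoly f)) = 3 * (d * (d + 1) / 2) + 1 := by
  have h1 := finrank_map_add_finrank_inf_ker (modPoly f) (forms k d)
  rw [finrank_forms_inf_ker_modPoly hf hf0, finrank_forms, choose_three_add] at h1
  omega

theorem triangle_add_two_mul (e a : ℕ) :
    3 * ((e + 2 * a) * (e + 2 * a + 1) / 2) + 3 * (e * (e + 1) / 2) =
      2 * (3 * ((e + a) * (e + a + 1) / 2)) + 3 * a ^ 2 := by
  have h : ∀ d : ℕ, 2 * (d * (d + 1) / 2) = d * (d + 1) := fun d =>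
    Nat.mul_div_cancel' (Nat.even_mul_succ_self d).two_dvd
  have h1 := h (e + 2 * a)
  have h2 := h e
  have h3 := h (e + a)
  nlinarith

/-- A transversal complete intersection of type `(3, a, a)` contains at most `3 * a ^ 2` points. -/
theorem TransversalCI.card_le [IsAlgClosed k] {f g₁ g₂ : R4 k} {a : ℕ}
    (hG : TransversalCI f g₁ g₂ a) {ι : Type} [Fintype ι] {w : ι → Fin 4 → k} (hw : ∀ i, w i ≠ 0)
    (hww : ∀ i j, i ≠ j → ∀ t : k, w i ≠ t • w j) (hwf : VanishesOn w f) (hw₁ : VanishesOn w g₁)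
    (hw₂ : VanishesOn w g₂) : Fintype.card ι ≤ 3 * a ^ 2 := by
  obtain ⟨e, he⟩ := exists_interpolates hw hww
  have hf0 := hG.prime.ne_zero
  have he2 : Interpolates w (e + 2 * a) := he.of_le hw (Nat.le_add_right _ _)
  rw [interpolates_iff] at he2
  have h1 := finrank_map_modPoly_add hG.hf hf0 hwf (e + 2 * a)
  have h2 := finrank_forms_map_modPoly hG.hf hf0 (e + a)
  have h3 := finrank_forms_map_modPoly hG.hf hf0 e
  let W (d : ℕ) := (forms k d).map (modPoly f)
  let L : (W (e + a) × W (e + a)) →ₗ[k] (R4 k ⧸ Ideal.span {f}) :=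
    (LinearMap.mulRight k (modPoly f g₁) ∘ₗ (W (e + a)).subtype).coprod
      (LinearMap.mulRight k (modPoly f g₂) ∘ₗ (W (e + a)).subtype)
  have hL := L.finrank_range_add_finrank_ker
  rw [Module.finrank_prod] at hL
  have hrange : LinearMap.range L ≤ (formsThrough w (e + 2 * a)).map (modPoly f) := by
    rintro _ ⟨⟨⟨_, u, hu, rfl⟩, ⟨_, v, hv, rfl⟩⟩, rfl⟩
    refine ⟨u * g₁ + v * g₂, mem_formsThrough.mpr ⟨?_, fun i => ?_⟩, ?_⟩
    · rw [show e + 2 * a = e + a + a by ring]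
      exact IsHomogeneous.add (IsHomogeneous.mul hu hG.h₁) (IsHomogeneous.mul hv hG.h₂)
    · rw [map_add, map_mul, map_mul, hw₁ i, hw₂ i, mul_zero, mul_zero, add_zero]
    · rw [map_add, modPoly_mul, modPoly_mul]
      rfl
  have hker : Module.finrank k (LinearMap.ker L) ≤ Module.finrank k (W e) := by
    let P : LinearMap.ker L →ₗ[k] (R4 k ⧸ Ideal.span {f}) :=
      (W (e + a)).subtype ∘ₗ LinearMap.fst k _ _ ∘ₗ (LinearMap.ker L).subtype
    have hLd : ∀ u v, modPoly f u * modPoly f g₁ + modPoly f v * modPoly f g₂ = 0 →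
        f ∣ u * g₁ + v * g₂ := fun u v h => by
      rwa [← modPoly_mul, ← modPoly_mul, ← map_add, modPoly_eq_zero] at h
    have hP : Function.Injective P := by
      rw [injective_iff_map_eq_zero]
      rintro ⟨⟨⟨_, u, hu, rfl⟩, ⟨_, v, hv, rfl⟩⟩, hmem⟩ h0
      have hu0 : f ∣ u := modPoly_eq_zero.mp h0
      have hv0 : f ∣ v := (hG.prime.dvd_or_dvd (dvd_of_eq_combo₂ 1 (-g₁) (hLd u v hmem) hu0
        (by ring) : f ∣ v * g₂)).resolve_right hG.n₂
      refine Subtype.ext (Prod.ext (Subtype.ext ?_) (Subtype.ext ?_))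
      · exact modPoly_eq_zero.mpr hu0
      · exact modPoly_eq_zero.mpr hv0
    rw [← LinearMap.finrank_range_of_inj hP]
    refine le_trans (Submodule.finrank_mono (t := (W e).map (LinearMap.mulRight k (modPoly f g₂))) ?_)
      (Submodule.finrank_map_le _ _)
    rintro _ ⟨⟨⟨⟨_, u, hu, rfl⟩, ⟨_, v, hv, rfl⟩⟩, hmem⟩, rfl⟩
    obtain ⟨r, hr⟩ := hG.exists_of_syzygy (hLd u v hmem)
    refine ⟨_, ⟨homogeneousComponent e r, homogeneousComponent_isHomogeneous e r, rfl⟩, ?_⟩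
    have h4 := dvd_homogeneousComponent hG.hf hr (e + a)
    rw [map_sub, homogeneousComponent_of_isHomogeneous hu, mul_comm, add_comm e a,
      homogeneousComponent_mul_of_isHomogeneous hG.h₂, mul_comm, ← modPoly_eq] at h4
    rw [LinearMap.mulRight_apply, ← modPoly_mul]
    exact h4.symm
  have h4 := Submodule.finrank_mono hrange
  have h5 := triangle_add_two_mul e a
  change Module.finrank k (W (e + a)) = _ at h2
  change Module.finrank k (W e) = _ at h3
  omega

end Count

section Residual

variable {k : Type} [Field k]

theorem KoszulInjective.le_card [Infinite k] {f : R4 k} {ι : Type} [Fintype ι] {w : ι → Fin 4 → k}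
    {a : ℕ} (h : KoszulInjective f w a) (hf : f.IsHomogeneous 3) (hf0 : f ≠ 0)
    (hw : ∀ i, w i ≠ 0) (hfw : VanishesOn w f) :
    3 * (a * (a - 1) / 2) + 2 * a ≤ Fintype.card ι := by
  have h1 := finrank_map_modPoly_add hf hf0 hfw a
  have h2 := finrank_map_modPoly_add hf hf0 hfw (a + 1)
  have h3 := h.four_mul_finrank_le
  have h4 := finrank_map_evalFamily_le_succ hw a
  have h5 : Module.finrank k ((forms k a).map (evalFamily w)) ≤ Fintype.card ι := by
    rw [← Module.finrank_fintype_fun_eq_card k]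
    exact Submodule.finrank_le _
  rw [triangle_succ] at h2
  rw [triangle_pred] at h1 h2
  omega

theorem KoszulInjective.comp_equiv {f : R4 k} {ι κ : Type} {w : ι → Fin 4 → k} {a : ℕ}
    (h : KoszulInjective f w a) (e : κ ≃ ι) : KoszulInjective f (w ∘ e) a :=
  fun F hF hFw => h F hF fun i j => by simpa using hFw i (e.symm j)

theorem exists_smul_of_mk_eq {z w : Fin 4 → k} {hz : z ≠ 0} {hw : w ≠ 0}
    (h : Projectivization.mk k z hz = Projectivization.mk k w hw) : ∃ t : k, z = t • w := by
  obtain ⟨t, ht⟩ := (Projectivization.mk_eq_mk_iff k z w hz hw).mp h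
  exact ⟨t, ht.symm⟩

theorem rep_ne_smul_rep {p q : P3 k} (h : p ≠ q) (t : k) : p.rep ≠ t • q.rep := fun he => by
  have ht : t ≠ 0 := fun h0 => p.rep_nonzero (by rw [he, h0, zero_smul])
  apply h
  rw [← p.mk_rep, ← q.mk_rep, Projectivization.mk_eq_mk_iff]
  exact ⟨Units.mk0 t ht, he.symm⟩

theorem triangle_residual (a : ℕ) :
    3 * a ^ 2 = (3 * (a * (a - 1) / 2) + a) + (3 * (a * (a - 1) / 2) + 2 * a) := by
  have h : 2 * (a * (a - 1) / 2) = a * (a - 1) :=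
    Nat.mul_div_cancel' (Nat.even_mul_pred_self a).two_dvd
  cases a with
  | zero => rfl
  | succ a => rw [Nat.add_sub_cancel] at *; nlinarith

theorem Interpolates.ne_smul {ι : Type} {v : ι → Fin 4 → k} {a : ℕ} (hv : Interpolates v a)
    {i j : ι} (hij : i ≠ j) (t : k) : v i ≠ t • v j := fun h => by
  classical
  obtain ⟨p, hp, hpv⟩ := hv (Pi.single i 1)
  have h1 := hpv i
  rw [h, eval_smul_of_isHomogeneous hp, hpv j, Pi.single_eq_same, Pi.single_eq_of_ne hij.symm,
    mul_zero] at h1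
  exact zero_ne_one h1

variable {f g₁ g₂ : R4 k} {a : ℕ}

/-- The points of a transversal complete intersection. -/
def commonZeros (f g₁ g₂ : R4 k) : Set (P3 k) :=
  {p | eval p.rep f = 0 ∧ eval p.rep g₁ = 0 ∧ eval p.rep g₂ = 0}

theorem TransversalCI.card_le_of_subset [IsAlgClosed k] (hG : TransversalCI f g₁ g₂ a)
    {T : Finset (P3 k)} (hT : (T : Set (P3 k)) ⊆ commonZeros f g₁ g₂) : T.card ≤ 3 * a ^ 2 := by
  rw [← Fintype.card_coe]
  exact hG.card_le (w := fun p : T => p.1.rep) (fun p => p.1.rep_nonzero)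
    (fun p q hpq t => rep_ne_smul_rep (fun h => hpq (Subtype.ext h)) t)
    (fun p => (hT p.2).1) (fun p => (hT p.2).2.1) (fun p => (hT p.2).2.2)

theorem TransversalCI.finite_commonZeros [IsAlgClosed k] (hG : TransversalCI f g₁ g₂ a) :
    (commonZeros f g₁ g₂).Finite := by
  by_contra hinf
  obtain ⟨T, hTS, hTc⟩ := Set.Infinite.exists_subset_card_eq hinf (3 * a ^ 2 + 1)
  have := hG.card_le_of_subset hTS
  omega

theorem eval_rep_mk_eq_zero {z : Fin 4 → k} (hz : z ≠ 0) {p : R4 k} {d : ℕ} (hp : p.IsHomogeneous d)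
    (h0 : eval z p = 0) : eval (Projectivization.mk k z hz).rep p = 0 := by
  obtain ⟨t, ht⟩ := exists_smul_of_mk_eq (hz := Projectivization.rep_nonzero _)
    (Projectivization.mk_rep (Projectivization.mk k z hz))
  rw [ht, eval_smul_of_isHomogeneous hp, h0, mul_zero]

theorem TransversalCI.mk_mem_commonZeros (hG : TransversalCI f g₁ g₂ a) {z : Fin 4 → k}
    (hz : z ≠ 0) (h0 : eval z f = 0) (h1 : eval z g₁ = 0) (h2 : eval z g₂ = 0) :
    Projectivization.mk k z hz ∈ commonZeros f g₁ g₂ :=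
  ⟨eval_rep_mk_eq_zero hz hG.hf h0, eval_rep_mk_eq_zero hz hG.h₁ h1,
    eval_rep_mk_eq_zero hz hG.h₂ h2⟩

/-- The points residual to a family `v` in a transversal complete intersection. -/
theorem TransversalCI.exists_residual [IsAlgClosed k] (hG : TransversalCI f g₁ g₂ a)
    (ha : 2 ≤ a) {v : Fin (3 * (a * (a - 1) / 2) + a) → Fin 4 → k} (hv0 : ∀ i, v i ≠ 0)
    (hvf : VanishesOn v f) (hv₁ : VanishesOn v g₁) (hv₂ : VanishesOn v g₂) (hv : Interpolates v a)
    (hex : KoszulExact₁ f v a) :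
    ∃ W : Fin (3 * (a * (a - 1) / 2) + 2 * a) → P3 k, Function.Injective W ∧
      VanishesOn (fun i => (W i).rep) f ∧ KoszulInjective f (fun i => (W i).rep) a := by
  classical
  have hsep : ∀ i, ∃ e : R4 k, e.IsHomogeneous a ∧ eval (v i) e = 1 ∧
      ∀ j ≠ i, eval (v j) e = 0 := by
    intro i
    obtain ⟨p, hp, hpe⟩ := hv (Pi.single i 1)
    exact ⟨p, hp, by rw [hpe, Pi.single_eq_same], fun j hj => by rw [hpe, Pi.single_eq_of_ne hj]⟩
  have hS := hG.finite_commonZeros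
  let V (i) : P3 k := Projectivization.mk k (v i) (hv0 i)
  have hVinj : Function.Injective V := fun i j hij => by
    by_contra hne
    obtain ⟨t, ht⟩ := exists_smul_of_mk_eq hij
    exact hv.ne_smul hne t ht
  let R : Finset (P3 k) := Finset.univ.image V
  have hR : R.card = 3 * (a * (a - 1) / 2) + a := by
    rw [Finset.card_image_of_injective _ hVinj, Finset.card_univ, Fintype.card_fin]
  let D : Finset (P3 k) := hS.toFinset \ R
  have hD : ∀ p : D, p.1 ∈ commonZeros f g₁ g₂ := fun p =>
    hS.mem_toFinset.mp (Finset.mem_sdiff.mp p.2).1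
  have hRS : R ⊆ hS.toFinset := fun p hp => by
    obtain ⟨i, -, rfl⟩ := Finset.mem_image.mp hp
    exact hS.mem_toFinset.mpr (hG.mk_mem_commonZeros (hv0 i) (hvf i) (hv₁ i) (hv₂ i))
  have hK : KoszulInjective f (fun p : D => p.1.rep) a := by
    refine hG.koszulInjective ha hv0 hvf hv₁ hv₂ (fun z hz h0 h1 h2 => ?_) hsep hex
    by_cases hzR : Projectivization.mk k z hz ∈ R
    · obtain ⟨i, -, hi⟩ := Finset.mem_image.mp hzR
      exact Or.inl ⟨i, exists_smul_of_mk_eq hi.symm⟩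
    · refine Or.inr ⟨⟨_, Finset.mem_sdiff.mpr
        ⟨hS.mem_toFinset.mpr (hG.mk_mem_commonZeros hz h0 h1 h2), hzR⟩⟩, ?_⟩
      exact exists_smul_of_mk_eq (hw := Projectivization.rep_nonzero _)
        (Projectivization.mk_rep _).symm
  have hcard : D.card = 3 * (a * (a - 1) / 2) + 2 * a := by
    have h1 := hK.le_card hG.hf hG.prime.ne_zero (fun p => p.1.rep_nonzero) fun p => (hD p).1
    rw [Fintype.card_coe] at h1
    have h2 := hG.card_le_of_subset (T := hS.toFinset) (by rw [hS.coe_toFinset])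
    have h3 : D.card + R.card = hS.toFinset.card := Finset.card_sdiff_add_card_eq_card hRS
    have h4 := triangle_residual a
    omega
  let e : Fin (3 * (a * (a - 1) / 2) + 2 * a) ≃ D := (Finset.equivFinOfCardEq hcard).symm
  exact ⟨fun i => (e i).1, Subtype.val_injective.comp e.injective, fun i => (hD (e i)).1,
    hK.comp_equiv e⟩

end Residual

section Line

variable {k : Type} [Field k]

theorem cubic_induction {P : R4 k → Prop} (hadd : ∀ p q, P p → P q → P (p + q)) (h0 : P 0)
    (hX : ∀ (c : k) (i j l : Fin 4), P (X i * (X j * (X l * C c)))) {f : R4 k}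
    (hf : f.IsHomogeneous 3) : P f := by
  have hsum : ∀ g : Fin 4 → R4 k, (∀ i, P (g i)) → P (∑ i, g i) := fun g hg =>
    Finset.sum_induction g P hadd h0 fun i _ => hg i
  obtain ⟨q, hq, rfl⟩ := exists_sum_X_mul_of_isHomogeneous (d := 2) hf
  refine hsum _ fun i => ?_
  obtain ⟨r, hr, hqr⟩ := exists_sum_X_mul_of_isHomogeneous (d := 1) (hq i)
  rw [hqr, Finset.mul_sum]
  refine hsum _ fun j => ?_
  obtain ⟨s, hs, hrs⟩ := exists_sum_X_mul_of_isHomogeneous (d := 0) (hr j)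
  rw [hrs, Finset.mul_sum, Finset.mul_sum]
  refine hsum _ fun l => ?_
  obtain ⟨c, hc⟩ := exists_C_of_isHomogeneous_zero hs
  rw [hc]
  exact hX (c l) i j l

theorem gradAt_add (p q : R4 k) (z : Fin 4 → k) : gradAt (p + q) z = gradAt p z + gradAt q z := by
  funext i; simp [gradAt]

theorem gradAt_zero (z : Fin 4 → k) : gradAt 0 z = 0 := by
  funext i; simp [gradAt]

theorem gradAt_cubicMonomial (c : k) (i j l : Fin 4) (z w : Fin 4 → k) :
    gradAt (X i * (X j * (X l * C c))) z ⬝ᵥ w =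
      (w i * z j * z l + z i * w j * z l + z i * z j * w l) * c := by
  have h : gradAt (X i * (X j * (X l * C c))) z = Pi.single i (z j * z l * c) +
      Pi.single j (z i * z l * c) + Pi.single l (z i * z j * c) := by
    funext m
    simp only [gradAt, Derivation.leibniz, pderiv_X, smul_eq_mul, map_add, map_mul, eval_X,
      eval_C, pderiv_C, Pi.add_apply, Pi.single_apply, apply_ite (eval z), map_zero, map_one,
      eq_comm (a := m)]
    split_ifs <;> ring
  rw [h, add_dotProduct, add_dotProduct, single_dotProduct, single_dotProduct, single_dotProduct]
  ring

theorem cubic_expand {f : R4 k} (hf : f.IsHomogeneous 3) (z w : Fin 4 → k) (s t : k) :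
    eval (s • z + t • w) f = s ^ 3 * eval z f + s ^ 2 * t * (gradAt f z ⬝ᵥ w) +
      s * t ^ 2 * (gradAt f w ⬝ᵥ z) + t ^ 3 * eval w f := by
  refine cubic_induction (P := fun f => eval (s • z + t • w) f = s ^ 3 * eval z f +
    s ^ 2 * t * (gradAt f z ⬝ᵥ w) + s * t ^ 2 * (gradAt f w ⬝ᵥ z) + t ^ 3 * eval w f) ?_ ?_ ?_ hf
  · intro p q hp hq
    simp only [gradAt_add, add_dotProduct, map_add, hp, hq]
    ring
  · simp only [gradAt_zero, zero_dotProduct, map_zero, mul_zero, add_zero]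
  · intro c i j l
    simp only [gradAt_cubicMonomial, map_mul, eval_X, eval_C, Pi.add_apply, Pi.smul_apply,
      smul_eq_mul]
    ring

theorem cubic_grad_expand {f : R4 k} (hf : f.IsHomogeneous 3) (z w : Fin 4 → k) (s t : k) :
    gradAt f (s • z + t • w) ⬝ᵥ z = 3 * s ^ 2 * eval z f + 2 * s * t * (gradAt f z ⬝ᵥ w) +
      t ^ 2 * (gradAt f w ⬝ᵥ z) := by
  refine cubic_induction (P := fun f => gradAt f (s • z + t • w) ⬝ᵥ z = 3 * s ^ 2 * eval z f +
    2 * s * t * (gradAt f z ⬝ᵥ w) + t ^ 2 * (gradAt f w ⬝ᵥ z)) ?_ ?_ ?_ hf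
  · intro p q hp hq
    simp only [gradAt_add, add_dotProduct, map_add, hp, hq]
    ring
  · simp only [gradAt_zero, zero_dotProduct, map_zero, mul_zero, add_zero]
  · intro c i j l
    simp only [gradAt_cubicMonomial, map_mul, eval_X, eval_C, Pi.add_apply, Pi.smul_apply,
      smul_eq_mul]
    ring

/-- A line which meets the cubic `f` in three distinct points. -/
theorem cubic_grad_ne_zero {f : R4 k} (hf : f.IsHomogeneous 3) {z w : Fin 4 → k}
    (hz : eval z f = 0) (hP : gradAt f z ⬝ᵥ w ≠ 0)
    (hD : (gradAt f w ⬝ᵥ z) ^ 2 - 4 * (gradAt f z ⬝ᵥ w) * eval w f ≠ 0) {s t : k}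
    (hst : s • z + t • w ≠ 0) (h0 : eval (s • z + t • w) f = 0) :
    gradAt f (s • z + t • w) ⬝ᵥ z ≠ 0 ∨ gradAt f (s • z + t • w) ⬝ᵥ w ≠ 0 := by
  by_contra! hcon
  obtain ⟨h1, h2⟩ := hcon
  rw [cubic_expand hf, hz] at h0
  rw [cubic_grad_expand hf, hz] at h1
  rw [add_comm, cubic_grad_expand hf] at h2
  by_cases ht : t = 0
  · subst ht
    have hs : s ≠ 0 := by rintro rfl; simp at hst
    apply hP
    have : s ^ 2 * (gradAt f z ⬝ᵥ w) = 0 := by linear_combination h2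
    exact (mul_eq_zero.mp this).resolve_left (pow_ne_zero 2 hs)
  · set P := gradAt f z ⬝ᵥ w
    set Q := gradAt f w ⬝ᵥ z
    have e1 : 2 * s * P + t * Q = 0 := by
      apply mul_left_cancel₀ ht; linear_combination h1
    have e2 : s ^ 2 * P + s * t * Q + t ^ 2 * eval w f = 0 := by
      apply mul_left_cancel₀ ht; linear_combination h0
    apply hD
    apply mul_left_cancel₀ (pow_ne_zero 2 ht)
    linear_combination (2 * s * P + t * Q) * e1 - 4 * P * e2

end Line

section ThreePoints

/-- The linear form with the given coefficients. -/
noncomputable def linForm {R : Type*} [CommSemiring R] (l : Fin 4 → R) : MvPolynomial (Fin 4) R :=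
  ∑ j, C (l j) * X j

theorem linForm_isHomogeneous {R : Type*} [CommSemiring R] (l : Fin 4 → R) :
    (linForm l).IsHomogeneous 1 :=
  IsHomogeneous.sum _ _ _ fun j _ => by
    simpa using (isHomogeneous_C (Fin 4) (l j)).mul (isHomogeneous_X R j)

theorem map_linForm {R S : Type*} [CommSemiring R] [CommSemiring S] (φ : R →+* S) (l : Fin 4 → R) :
    map φ (linForm l) = linForm fun i => φ (l i) := by
  simp [linForm]

variable {k : Type} [Field k]

theorem eval_linForm (l z : Fin 4 → k) : eval z (linForm l) = l ⬝ᵥ z := by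
  simp [linForm, dotProduct]

theorem gradAt_linForm (l z : Fin 4 → k) : gradAt (linForm l) z = l := by
  funext i
  simp [gradAt, linForm, Pi.single_apply, pderiv_X]

theorem linForm_ne_zero {l : Fin 4 → k} (hl : l ≠ 0) : linForm l ≠ 0 := fun h => by
  apply hl
  rw [← gradAt_linForm l 0, h, gradAt_zero]

theorem exists_zero_eval_ne_zero [IsAlgClosed k] {f p : R4 k} (hf : Prime f) (h : ¬ f ∣ p) :
    ∃ z, eval z f = 0 ∧ eval z p ≠ 0 := by
  by_contra! hcon
  have hprime : (Ideal.span {f}).IsPrime := (Ideal.span_singleton_prime hf.ne_zero).mpr hf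
  apply h
  rw [← Ideal.mem_span_singleton, ← IsPrime.vanishingIdeal_zeroLocus (K := k) (Ideal.span {f})]
  intro z hz
  have hz' : eval z f = 0 := by
    have := (mem_zeroLocus_iff.mp hz) f (Ideal.mem_span_singleton_self f)
    rwa [aeval_eq_eval] at this
  rw [aeval_eq_eval]
  exact hcon z hz'

theorem finrank_ker_dotProduct {z w : Fin 4 → k} (h : LinearIndependent k ![z, w]) :
    Module.finrank k (LinearMap.ker (Matrix.of ![z, w]).mulVecLin) = 2 := by
  have h1 := (Matrix.of ![z, w]).mulVecLin.finrank_range_add_finrank_ker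
  have h2 : (Matrix.of ![z, w]).rank = 2 := by
    simpa using LinearIndependent.rank_matrix (M := Matrix.of ![z, w]) h
  rw [Matrix.rank] at h2
  rw [h2, Module.finrank_fintype_fun_eq_card, Fintype.card_fin] at h1
  omega

theorem mem_ker_dotProduct {z w l : Fin 4 → k} :
    l ∈ LinearMap.ker (Matrix.of ![z, w]).mulVecLin ↔ z ⬝ᵥ l = 0 ∧ w ⬝ᵥ l = 0 := by
  rw [LinearMap.mem_ker, Matrix.mulVecLin_apply, funext_iff, Fin.forall_fin_two]
  rfl

/-- Two linear forms cutting out a given line. -/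
theorem exists_line_equations {z w : Fin 4 → k} (h : LinearIndependent k ![z, w]) :
    ∃ l l' : Fin 4 → k, LinearIndependent k ![l, l'] ∧ (l ⬝ᵥ z = 0 ∧ l ⬝ᵥ w = 0) ∧
      (l' ⬝ᵥ z = 0 ∧ l' ⬝ᵥ w = 0) ∧
      ∀ y, l ⬝ᵥ y = 0 → l' ⬝ᵥ y = 0 → ∃ s t : k, y = s • z + t • w := by
  obtain ⟨b, hb, -, hind⟩ := exists_basis_of_finrank_eq
    (S := LinearMap.ker (Matrix.of ![z, w]).mulVecLin) (finrank_ker_dotProduct h)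
  have hl : LinearIndependent k ![b 0, b 1] := by
    rw [LinearIndependent.pair_iff]
    intro s t hst
    have := hind ![s, t] (by rw [Fin.sum_univ_two]; exact hst)
    exact ⟨congrFun this 0, congrFun this 1⟩
  have h0 := mem_ker_dotProduct.mp (hb 0)
  have h1 := mem_ker_dotProduct.mp (hb 1)
  refine ⟨b 0, b 1, hl, ⟨?_, ?_⟩, ⟨?_, ?_⟩, fun y hy0 hy1 => ?_⟩
  · rw [dotProduct_comm]; exact h0.1
  · rw [dotProduct_comm]; exact h0.2
  · rw [dotProduct_comm]; exact h1.1
  · rw [dotProduct_comm]; exact h1.2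
  · have hle : Submodule.span k (Set.range ![z, w]) ≤
        LinearMap.ker (Matrix.of ![b 0, b 1]).mulVecLin := by
      rw [Submodule.span_le, Set.range_subset_iff, Fin.forall_fin_two]
      constructor
      · exact mem_ker_dotProduct.mpr ⟨by rw [dotProduct_comm]; exact h0.1,
          by rw [dotProduct_comm]; exact h1.1⟩
      · exact mem_ker_dotProduct.mpr ⟨by rw [dotProduct_comm]; exact h0.2,
          by rw [dotProduct_comm]; exact h1.2⟩
    have heq := Submodule.eq_of_le_of_finrank_eq hle (by
      rw [finrank_ker_dotProduct hl, finrank_span_eq_card h, Fintype.card_fin])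
    have hy : y ∈ Submodule.span k (Set.range ![z, w]) := by
      rw [heq]; exact mem_ker_dotProduct.mpr ⟨hy0, hy1⟩
    rw [Matrix.range_cons, Matrix.range_cons, Matrix.range_empty, Set.union_empty,
      Set.singleton_union, Submodule.mem_span_pair] at hy
    obtain ⟨s, t, hst⟩ := hy
    exact ⟨s, t, hst.symm⟩

/-- The polar quadric `∑ zᵢ ∂ᵢ f`. -/
noncomputable def polarForm (f : R4 k) (z : Fin 4 → k) : R4 k := ∑ i, C (z i) * pderiv i f

theorem eval_polarForm (f : R4 k) (z w : Fin 4 → k) : eval w (polarForm f z) = gradAt f w ⬝ᵥ z := by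
  simp [polarForm, gradAt, dotProduct, mul_comm]

/-- A smooth cubic surface meets some line in three distinct points. -/
theorem exists_transversal_line [IsAlgClosed k] {f : R4 k} (hp : Prime f) (hf : f.IsHomogeneous 3)
    (hs : ∀ z, z ≠ 0 → eval z f = 0 → gradAt f z ≠ 0) :
    ∃ l l' : Fin 4 → k, TransversalCI f (linForm l) (linForm l') 1 := by
  have : Infinite k := IsAlgClosed.instInfinite
  have hlin : ∀ l : Fin 4 → k, l ≠ 0 → ¬ f ∣ linForm l := fun l hl =>
    not_dvd_of_degree_one hf (linForm_isHomogeneous l) (linForm_ne_zero hl)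
  obtain ⟨u, hu⟩ : ∃ u, gradAt f u ≠ 0 := by
    obtain ⟨z, hz, hz0⟩ := exists_zero_eval_ne_zero hp
      (not_dvd_of_degree_one hf (isHomogeneous_X k 0) (X_ne_zero 0))
    refine ⟨z, hs z ?_ hz⟩
    rintro rfl
    simp at hz0
  obtain ⟨z, hz, hzu⟩ := exists_zero_eval_ne_zero hp (hlin _ hu)
  rw [eval_linForm] at hzu
  have hz0 : z ≠ 0 := by rintro rfl; simp at hzu
  have hQ0 : polarForm f z ≠ 0 := fun h => by
    rw [← eval_polarForm, h, map_zero] at hzu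
    exact hzu rfl
  have hQ : ¬ f ∣ polarForm f z := fun h => hQ0 (eq_zero_of_dvd_of_lt hf h (d := 2)
    (IsHomogeneous.sum _ _ _ fun i _ => by
      simpa using (isHomogeneous_C (Fin 4) (z i)).mul (hf.pderiv (i := i))) (by norm_num))
  have hP := linForm_ne_zero (hs z hz0 hz)
  have hD : polarForm f z ^ 2 - 4 * linForm (gradAt f z) * f ≠ 0 := fun h =>
    hQ (hp.dvd_of_dvd_pow (n := 2) ⟨4 * linForm (gradAt f z), by linear_combination h⟩)
  obtain ⟨w, hw⟩ : ∃ w, eval w (linForm (gradAt f z) *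
      (polarForm f z ^ 2 - 4 * linForm (gradAt f z) * f)) ≠ 0 := by
    by_contra! hcon
    exact mul_ne_zero hP hD (MvPolynomial.funext fun w => by rw [hcon, map_zero])
  rw [map_mul] at hw
  have hPw := left_ne_zero_of_mul hw
  have hDw := right_ne_zero_of_mul hw
  rw [map_sub, map_pow, map_mul, map_mul, eval_polarForm, eval_linForm, map_ofNat] at hDw
  rw [eval_linForm] at hPw
  have hzz : gradAt f z ⬝ᵥ z = 0 := by
    have := cubic_grad_expand hf z w 1 0
    rw [hz] at this
    simpa using this
  have hzw : LinearIndependent k ![z, w] := by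
    rw [LinearIndependent.pair_iff]
    intro s t hst
    have h1 := congrArg (gradAt f z ⬝ᵥ ·) hst
    simp only [dotProduct_add, dotProduct_smul, hzz, smul_zero, zero_add, dotProduct_zero] at h1
    have ht : t = 0 := (mul_eq_zero.mp h1).resolve_right hPw
    subst ht
    rw [zero_smul, add_zero] at hst
    exact ⟨(smul_eq_zero.mp hst).resolve_right hz0, rfl⟩
  obtain ⟨l, l', hll, hl, hl', hcut⟩ := exists_line_equations hzw
  refine ⟨l, l', hp, hf, linForm_isHomogeneous l, linForm_isHomogeneous l',
    hlin _ (hll.ne_zero 0), hlin _ (hll.ne_zero 1), fun y hy0 hyf hy1 hy2 => ?_⟩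
  rw [eval_linForm] at hy1 hy2
  rw [gradAt_linForm, gradAt_linForm]
  obtain ⟨s, t, rfl⟩ := hcut y hy1 hy2
  have hgrad := cubic_grad_ne_zero hf hz hPw hDw hy0 hyf
  rw [LinearIndependent.pair_iff] at hll
  rw [Fintype.linearIndependent_iff]
  intro c hc
  rw [Fin.sum_univ_three] at hc
  change c 0 • gradAt f (s • z + t • w) + c 1 • l + c 2 • l' = 0 at hc
  have hpair : ∀ x, l ⬝ᵥ x = 0 → l' ⬝ᵥ x = 0 → c 0 * (gradAt f (s • z + t • w) ⬝ᵥ x) = 0 := by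
    intro x h1 h2
    have := congrArg (· ⬝ᵥ x) hc
    simpa [add_dotProduct, smul_dotProduct, h1, h2] using this
  have hc0 : c 0 = 0 := by
    rcases hgrad with h | h
    · exact (mul_eq_zero.mp (hpair z hl.1 hl'.1)).resolve_right h
    · exact (mul_eq_zero.mp (hpair w hl.2 hl'.2)).resolve_right h
  rw [hc0, zero_smul, zero_add] at hc
  obtain ⟨h1, h2⟩ := hll _ _ hc
  intro i
  fin_cases i
  exacts [hc0, h1, h2]

end ThreePoints

section JacobianForms

/-- The Jacobian matrix of three forms, bordered by a coordinate vector. -/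
noncomputable def jacMatrix {R : Type*} [CommRing R] (f g h : MvPolynomial (Fin 4) R) (j : Fin 4) :
    Matrix (Fin 4) (Fin 4) (MvPolynomial (Fin 4) R) :=
  Matrix.of ![Pi.single j 1, fun i => pderiv i f, fun i => pderiv i g, fun i => pderiv i h]

/-- Three forms together with the maximal minors of their Jacobian matrix. -/
noncomputable def transversalForms {R : Type*} [CommRing R] (f g h : MvPolynomial (Fin 4) R) :
    Fin 3 ⊕ Fin 4 → MvPolynomial (Fin 4) R :=
  Sum.elim ![f, g, h] fun j => (jacMatrix f g h j).det

theorem map_transversalForms {R S : Type*} [CommRing R] [CommRing S] (φ : R →+* S)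
    (f g h : MvPolynomial (Fin 4) R) (s : Fin 3 ⊕ Fin 4) :
    map φ (transversalForms f g h s) = transversalForms (map φ f) (map φ g) (map φ h) s := by
  rcases s with s | j
  · fin_cases s <;> rfl
  · change map φ (jacMatrix f g h j).det = (jacMatrix _ _ _ j).det
    rw [RingHom.map_det]
    congr 1
    ext1 r i
    fin_cases r
    · simp [jacMatrix, Pi.single_apply, apply_ite (map φ)]
    · simp [jacMatrix, pderiv_map]
    · simp [jacMatrix, pderiv_map]
    · simp [jacMatrix, pderiv_map]

theorem isHomogeneous_det {R : Type*} [CommRing R] {M : Matrix (Fin 4) (Fin 4) (MvPolynomial (Fin 4) R)}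
    {d : Fin 4 → ℕ} (hM : ∀ r i, (M r i).IsHomogeneous (d r)) : M.det.IsHomogeneous (∑ r, d r) := by
  rw [← Matrix.det_transpose, Matrix.det_apply']
  refine IsHomogeneous.sum _ _ _ fun σ _ => ?_
  have h1 := IsHomogeneous.prod Finset.univ (fun r => M.transpose (σ r) r) d fun r _ => hM r (σ r)
  have h2 : ((Equiv.Perm.sign σ : ℤ) : MvPolynomial (Fin 4) R).IsHomogeneous 0 := by
    rw [← map_intCast (C : R →+* MvPolynomial (Fin 4) R)]
    exact isHomogeneous_C _ _
  simpa using h2.mul h1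

theorem transversalForms_isHomogeneous {R : Type*} [CommRing R] {f g h : MvPolynomial (Fin 4) R}
    {b c d : ℕ} (hf : f.IsHomogeneous b) (hg : g.IsHomogeneous c) (hh : h.IsHomogeneous d)
    (s : Fin 3 ⊕ Fin 4) : (transversalForms f g h s).IsHomogeneous
      (Sum.elim ![b, c, d] (fun _ => ∑ r, ![0, b - 1, c - 1, d - 1] r) s) := by
  rcases s with s | j
  · fin_cases s
    exacts [hf, hg, hh]
  · refine isHomogeneous_det fun r i => ?_
    fin_cases r
    · change ((Pi.single j 1 : Fin 4 → MvPolynomial (Fin 4) R) i).IsHomogeneous 0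
      rw [Pi.single_apply]
      split_ifs
      exacts [isHomogeneous_one _ _, isHomogeneous_zero _ _ _]
    · exact hf.pderiv
    · exact hg.pderiv
    · exact hh.pderiv

variable {k : Type} [Field k]

theorem eval_det_jacMatrix (f g h : R4 k) (j : Fin 4) (z : Fin 4 → k) :
    eval z (jacMatrix f g h j).det =
      (Matrix.of ![Pi.single j 1, gradAt f z, gradAt g z, gradAt h z]).det := by
  rw [RingHom.map_det]
  congr 1
  ext r i
  fin_cases r
  · simp [jacMatrix, Pi.single_apply, apply_ite (eval z)]
  · rfl
  · rfl
  · rfl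

theorem linearIndependent_iff_exists_det {x : Fin 3 → Fin 4 → k} : LinearIndependent k x ↔
    ∃ j, (Matrix.of (Fin.cons (Pi.single j 1) x : Fin 4 → Fin 4 → k)).det ≠ 0 := by
  constructor
  · intro hx
    obtain ⟨j, hj⟩ : ∃ j, Pi.single j (1 : k) ∉ Submodule.span k (Set.range x) := by
      by_contra! hcon
      have htop : Submodule.span k (Set.range x) = ⊤ := by
        rw [eq_top_iff, ← (Pi.basisFun k (Fin 4)).span_eq, Submodule.span_le]
        rintro _ ⟨j, rfl⟩
        rw [Pi.basisFun_apply]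
        exact hcon j
      have h1 := finrank_span_eq_card hx
      rw [htop, finrank_top, Module.finrank_fintype_fun_eq_card] at h1
      simp at h1
    refine ⟨j, ?_⟩
    rw [← isUnit_iff_ne_zero, ← Matrix.isUnit_iff_isUnit_det,
      ← Matrix.linearIndependent_rows_iff_isUnit]
    exact hx.finCons hj
  · rintro ⟨j, hj⟩
    rw [← isUnit_iff_ne_zero, ← Matrix.isUnit_iff_isUnit_det,
      ← Matrix.linearIndependent_rows_iff_isUnit] at hj
    exact hj.comp Fin.succ (Fin.succ_injective 3)

theorem forall_linearIndependent_iff {f g h : R4 k} :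
    (∀ z : Fin 4 → k, z ≠ 0 → eval z f = 0 → eval z g = 0 → eval z h = 0 →
      LinearIndependent k ![gradAt f z, gradAt g z, gradAt h z]) ↔
    ∀ z : Fin 4 → k, z ≠ 0 → ∃ s, eval z (transversalForms f g h s) ≠ 0 := by
  have key : ∀ z, LinearIndependent k ![gradAt f z, gradAt g z, gradAt h z] ↔
      ∃ j, eval z (transversalForms f g h (Sum.inr j)) ≠ 0 := fun z => by
    rw [linearIndependent_iff_exists_det]
    exact exists_congr fun j => by
      change _ ↔ eval z (jacMatrix f g h j).det ≠ 0
      rw [eval_det_jacMatrix]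
      rfl
  refine forall_congr' fun z => forall_congr' fun _ => ?_
  have h3 : (∃ i, eval z (transversalForms f g h (Sum.inl i)) ≠ 0) ↔
      eval z f ≠ 0 ∨ eval z g ≠ 0 ∨ eval z h ≠ 0 := by
    simp [Fin.exists_fin_succ, transversalForms]
  rw [key, Sum.exists, h3]
  tauto

end JacobianForms

section Grid

variable {k : Type} [Field k]

/-- Finitely many nonempty Zariski-open conditions on affine space can be met simultaneously. -/
theorem exists_forall_of_eventually [Infinite k] {σ S : Type*} [Finite S] {P : S → (σ → k) → Prop}
    (h : ∀ s, ∃ c, ∀ᶠ x in zariskiNhds c, P s x) : ∃ x, ∀ s, P s x := by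
  have := Fintype.ofFinite S
  choose c hc using h
  choose g hg hgP using fun s => eventually_zariskiNhds.mp (hc s)
  obtain ⟨x, hx⟩ : ∃ x, eval x (∏ s, g s) ≠ 0 := by
    by_contra! hcon
    refine Finset.prod_ne_zero_iff.mpr (fun s _ h0 => hg s ?_) (MvPolynomial.funext fun x => by
      rw [hcon, map_zero])
    rw [h0, map_zero]
  rw [map_prod, Finset.prod_ne_zero_iff] at hx
  exact ⟨x, fun s => hgP s x (hx s (Finset.mem_univ s))⟩

/-- Three planes meeting in a single point off the surface. -/
theorem exists_three_planes {f : R4 k} {d : ℕ} (hf : f.IsHomogeneous d) {p : Fin 4 → k} (hp : p ≠ 0)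
    (hfp : eval p f ≠ 0) : ∃ m : Fin 3 → Fin 4 → k, ∀ z, z ≠ 0 → eval z f = 0 →
      ∃ i, m i ⬝ᵥ z ≠ 0 := by
  obtain ⟨c, hc⟩ := Function.ne_iff.mp hp
  have hc' : p c ≠ 0 := hc
  refine ⟨fun i => p c • Pi.single (c.succAbove i) 1 - p (c.succAbove i) • Pi.single c 1,
    fun z hz hzf => ?_⟩
  by_contra! hcon
  have hzp : z = (z c / p c) • p := funext fun s => by
    rw [Pi.smul_apply, smul_eq_mul]
    rcases Fin.eq_self_or_eq_succAbove c s with rfl | ⟨i, rfl⟩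
    · field_simp
    · have := hcon i
      simp only [sub_dotProduct, smul_dotProduct, single_dotProduct, smul_eq_mul, one_mul] at this
      field_simp
      linear_combination this
  rw [hzp, eval_smul_of_isHomogeneous hf] at hzf
  rcases mul_eq_zero.mp hzf with h | h
  · exact hz (by rw [hzp, eq_zero_of_pow_eq_zero h, zero_smul])
  · exact hfp h

theorem exists_grid [IsAlgClosed k] {f : R4 k} (hp : Prime f) (hf : f.IsHomogeneous 3)
    (hs : ∀ z, z ≠ 0 → eval z f = 0 → gradAt f z ≠ 0) (J : Type) [Fintype J] [DecidableEq J] :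
    ∃ l : J → Fin 4 → k,
      (∀ s t, s ≠ t → TransversalCI f (linForm (l s)) (linForm (l t)) 1) ∧
      ∀ s t r, s ≠ t → s ≠ r → t ≠ r → ∀ z, z ≠ 0 → eval z f = 0 → l s ⬝ᵥ z = 0 → l t ⬝ᵥ z = 0 →
        l r ⬝ᵥ z ≠ 0 := by
  have : Infinite k := IsAlgClosed.instInfinite
  let L (s : J) : MvPolynomial (Fin 4) (MvPolynomial (J × Fin 4) k) := linForm fun j => X (s, j)
  let F : MvPolynomial (Fin 4) (MvPolynomial (J × Fin 4) k) := map C f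
  have hL : ∀ y s, map (eval y) (L s) = linForm fun j => y (s, j) := fun y s => by
    simp [L, map_linForm]
  have hF : ∀ y, map (eval y) F = f := fun y => by
    rw [map_map]
    convert map_id f
    ext; simp
  have hF3 : F.IsHomogeneous 3 := hf.map _
  have hLh : ∀ s, (L s).IsHomogeneous 1 := fun s => linForm_isHomogeneous _
  let P₁ (s : J) (y : J × Fin 4 → k) : Prop := y (s, 0) ≠ 0
  let P₂ (q : J × J) (y : J × Fin 4 → k) : Prop := q.1 ≠ q.2 → ∀ z : Fin 4 → k, z ≠ 0 →
    ∃ i, eval z (map (eval y) (transversalForms F (L q.1) (L q.2) i)) ≠ 0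
  let P₃ (q : J × J × J) (y : J × Fin 4 → k) : Prop := q.1 ≠ q.2.1 → q.1 ≠ q.2.2 → q.2.1 ≠ q.2.2 →
    ∀ z : Fin 4 → k, z ≠ 0 →
      ∃ i, eval z (map (eval y) (![F, L q.1, L q.2.1, L q.2.2] i)) ≠ 0
  obtain ⟨y, hy⟩ := exists_forall_of_eventually (k := k) (P := Sum.elim P₁ (Sum.elim P₂ P₃)) (by
    rintro (s | ⟨s, t⟩ | ⟨s, t, r⟩)
    · refine ⟨fun _ => 1, (eventually_eval_ne_zero (g := X (s, 0)) (by simp)).mono fun y hy => ?_⟩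
      simpa using hy
    · by_cases hst : s = t
      · exact ⟨0, Filter.Eventually.of_forall fun y h => absurd hst h⟩
      · obtain ⟨m, m', hm⟩ := exists_transversal_line hp hf hs
        refine ⟨fun q => if q.1 = s then m q.2 else m' q.2, (eventually_no_common_zero _
          (transversalForms F (L s) (L t)) _ (transversalForms_isHomogeneous hF3 (hLh s) (hLh t))
          ?_).mono fun y hy _ => hy⟩
        simp only [map_transversalForms, hF, hL, if_true, if_neg (Ne.symm hst)]
        exact forall_linearIndependent_iff.mp hm.jac
    · by_cases hst : s = t
      · exact ⟨0, Filter.Eventually.of_forall fun y h => absurd hst h⟩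
      by_cases hsr : s = r
      · exact ⟨0, Filter.Eventually.of_forall fun y _ h => absurd hsr h⟩
      by_cases htr : t = r
      · exact ⟨0, Filter.Eventually.of_forall fun y _ _ h => absurd htr h⟩
      obtain ⟨p, hp⟩ : ∃ p, eval p (f * X 0) ≠ 0 := by
        by_contra! hcon
        exact mul_ne_zero hp.ne_zero (X_ne_zero 0) (MvPolynomial.funext fun x => by
          rw [hcon, map_zero])
      rw [map_mul] at hp
      have hp0 : p ≠ 0 := by rintro rfl; simp at hp
      obtain ⟨m, hm⟩ := exists_three_planes hf hp0 (left_ne_zero_of_mul hp)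
      refine ⟨fun q => if q.1 = s then m 0 q.2 else if q.1 = t then m 1 q.2 else m 2 q.2,
        (eventually_no_common_zero _ ![F, L s, L t, L r] ![3, 1, 1, 1] (fun i => ?_)
          fun z hz => ?_).mono fun y hy _ _ _ => hy⟩
      · fin_cases i
        exacts [hF3, hLh s, hLh t, hLh r]
      · by_cases hzf : eval z f = 0
        · obtain ⟨i, hi⟩ := hm z hz hzf
          refine ⟨i.succ, ?_⟩
          fin_cases i
          · change eval z (map _ (L s)) ≠ 0
            simp only [hL, eval_linForm, if_true]
            exact hi
          · change eval z (map _ (L t)) ≠ 0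
            simp only [hL, eval_linForm, if_true, if_neg (Ne.symm hst)]
            exact hi
          · change eval z (map _ (L r)) ≠ 0
            simp only [hL, eval_linForm, if_neg (Ne.symm hsr), if_neg (Ne.symm htr)]
            exact hi
        · refine ⟨0, ?_⟩
          change eval z (map _ F) ≠ 0
          rwa [hF])
  have hy1 : ∀ s, y (s, 0) ≠ 0 := fun s => hy (Sum.inl s)
  have hn : ∀ s, ¬ f ∣ linForm fun j => y (s, j) := fun s =>
    not_dvd_of_degree_one hf (linForm_isHomogeneous _) (linForm_ne_zero fun h =>
      hy1 s (congrFun h 0))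
  refine ⟨fun s j => y (s, j), fun s t hst => ⟨hp, hf, linForm_isHomogeneous _,
    linForm_isHomogeneous _, hn s, hn t, ?_⟩, fun s t r hst hsr htr z hz hzf h1 h2 => ?_⟩
  · rw [forall_linearIndependent_iff]
    have := hy (Sum.inr (Sum.inl (s, t))) hst
    simpa only [map_transversalForms, hF, hL] using this
  · obtain ⟨i, hi⟩ := hy (Sum.inr (Sum.inr (s, t, r))) hst hsr htr z hz
    rw [← eval_linForm] at h1 h2 ⊢
    fin_cases i
    · change eval z (map _ F) ≠ 0 at hi
      rw [hF] at hi
      exact absurd hzf hi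
    · change eval z (map _ (L s)) ≠ 0 at hi
      rw [hL] at hi
      exact absurd h1 hi
    · change eval z (map _ (L t)) ≠ 0 at hi
      rw [hL] at hi
      exact absurd h2 hi
    · change eval z (map _ (L r)) ≠ 0 at hi
      rwa [hL] at hi

end Grid

section GridProduct

variable {k : Type} [Field k]

theorem gradAt_mul_of_eval_eq_zero {p : R4 k} {z : Fin 4 → k} (h : eval z p = 0) (q : R4 k) :
    gradAt (p * q) z = eval z q • gradAt p z := by
  funext i
  simp [gradAt, h]

/-- The surface contains transversal complete intersections of type `(3, a, a)`. -/
theorem exists_transversalCI [IsAlgClosed k] {f : R4 k} (hp : Prime f) (hf : f.IsHomogeneous 3)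
    (hs : ∀ z, z ≠ 0 → eval z f = 0 → gradAt f z ≠ 0) (a : ℕ) :
    ∃ g₁ g₂, TransversalCI f g₁ g₂ a := by
  classical
  obtain ⟨l, hl2, hl3⟩ := exists_grid hp hf hs (Fin a ⊕ Fin a)
  have hhom : ∀ e : Fin a → Fin a ⊕ Fin a, (∏ i, linForm (l (e i))).IsHomogeneous a := fun e => by
    have := IsHomogeneous.prod Finset.univ (fun i => linForm (l (e i))) (fun _ => 1) fun i _ =>
      linForm_isHomogeneous _
    simpa using this
  have hnd : ∀ e : Fin a → Fin a ⊕ Fin a, (∀ i, ∃ t, e i ≠ t) → ¬ f ∣ ∏ i, linForm (l (e i)) := by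
    intro e he hdvd
    obtain ⟨i, -, hi⟩ := (Prime.dvd_finsetProd_iff hp _).mp hdvd
    obtain ⟨t, ht⟩ := he i
    exact (hl2 _ t ht).n₁ hi
  have hzero : ∀ (e : Fin a → Fin a ⊕ Fin a) (z : Fin 4 → k), eval z (∏ i, linForm (l (e i))) = 0 →
      ∃ i, l (e i) ⬝ᵥ z = 0 := fun e z h => by
    rw [map_prod, Finset.prod_eq_zero_iff] at h
    obtain ⟨i, -, hi⟩ := h
    exact ⟨i, by rwa [eval_linForm] at hi⟩
  have hgrad : ∀ (e : Fin a → Fin a ⊕ Fin a) (z : Fin 4 → k) (i : Fin a), l (e i) ⬝ᵥ z = 0 →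
      (∀ j, i ≠ j → l (e j) ⬝ᵥ z ≠ 0) →
      ∃ c : kˣ, gradAt (∏ i, linForm (l (e i))) z = c • l (e i) := by
    intro e z i hi hj
    rw [← eval_linForm] at hi
    have h0 : eval z (∏ j ∈ Finset.univ.erase i, linForm (l (e j))) ≠ 0 := by
      rw [map_prod, Finset.prod_ne_zero_iff]
      exact fun j h => by rw [eval_linForm]; exact hj j (Finset.ne_of_mem_erase h).symm
    refine ⟨Units.mk0 _ h0, ?_⟩
    rw [← Finset.mul_prod_erase _ _ (Finset.mem_univ i), gradAt_mul_of_eval_eq_zero hi,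
      gradAt_linForm]
    rfl
  refine ⟨_, _, hp, hf, hhom Sum.inl, hhom Sum.inr, hnd _ fun i => ⟨Sum.inr i, Sum.inl_ne_inr⟩,
    hnd _ fun i => ⟨Sum.inl i, Sum.inr_ne_inl⟩, fun z hz hzf h1 h2 => ?_⟩
  obtain ⟨i, hi⟩ := hzero _ z h1
  obtain ⟨j, hj⟩ := hzero _ z h2
  obtain ⟨c, hc⟩ := hgrad _ z i hi fun i' hii => hl3 (Sum.inl i) (Sum.inr j) (Sum.inl i')
    Sum.inl_ne_inr (fun h => hii (Sum.inl_injective h)) Sum.inr_ne_inl z hz hzf hi hj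
  obtain ⟨d, hd⟩ := hgrad _ z j hj fun j' hjj => hl3 (Sum.inl i) (Sum.inr j) (Sum.inr j')
    Sum.inl_ne_inr Sum.inl_ne_inr (fun h => hjj (Sum.inr_injective h)) z hz hzf hi hj
  have hind := (hl2 (Sum.inl i) (Sum.inr j) Sum.inl_ne_inr).jac z hz hzf
    (by rwa [eval_linForm]) (by rwa [eval_linForm])
  rw [gradAt_linForm, gradAt_linForm] at hind
  rw [hc, hd]
  convert hind.units_smul ![1, c, d] using 1
  funext s
  fin_cases s <;> simp

end GridProduct

section Selection

variable {k : Type} [Field k] {f g₁ g₂ : R4 k} {a : ℕ}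

/-- Forms of degree `a` separate all but at most two conditions on the points of a transversal
complete intersection of type `(3, a, a)`. -/
theorem TransversalCI.le_finrank_map_evalFamily [IsAlgClosed k] (hG : TransversalCI f g₁ g₂ a)
    {ι : Type} [Finite ι] {u : ι → Fin 4 → k} (huf : VanishesOn u f) (ha : 1 ≤ a)
    (hcover : ∀ z, z ≠ 0 → eval z f = 0 → eval z g₁ = 0 → eval z g₂ = 0 →
      ∃ i, ∃ t : k, z = t • u i) :
    3 * (a * (a - 1) / 2) + a ≤ Module.finrank k ((forms k a).map (evalFamily u)) := by
  have h1 := finrank_map_modPoly_add hG.hf hG.prime.ne_zero huf a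
  have hle : (formsThrough u a).map (modPoly f) ≤
      Submodule.span k (Set.range ![modPoly f g₁, modPoly f g₂]) := by
    rintro _ ⟨q, hq, rfl⟩
    obtain ⟨hq, hqu⟩ := mem_formsThrough.mp hq
    have hmem := hG.mem_of_vanish hq fun z hz h0 h1 h2 => by
      obtain ⟨i, t, rfl⟩ := hcover z hz h0 h1 h2
      rw [eval_smul_of_isHomogeneous hq, hqu i, mul_zero]
    obtain ⟨α, β, h⟩ := mem_span_triple_iff_dvd.mp hmem
    have h := dvd_homogeneousComponent hG.hf h (a + 0)
    rw [map_sub, map_add, mul_comm α, mul_comm β,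
      homogeneousComponent_mul_of_isHomogeneous hG.h₁,
      homogeneousComponent_mul_of_isHomogeneous hG.h₂, homogeneousComponent_zero,
      homogeneousComponent_zero, add_zero, homogeneousComponent_of_isHomogeneous hq,
      ← modPoly_eq, mul_comm, mul_comm g₂, C_mul', C_mul', map_add, map_smul, map_smul] at h
    rw [h, Matrix.range_cons_cons_empty]
    exact Submodule.mem_span_pair.mpr ⟨_, _, rfl⟩
  have : FiniteDimensional k
      (Submodule.span k (Set.range ![modPoly f g₁, modPoly f g₂])) :=
    FiniteDimensional.span_of_finite k (Set.finite_range _)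
  have h2 := (Submodule.finrank_mono hle).trans (finrank_range_le_card (R := k) _)
  rw [Fintype.card_fin] at h2
  rw [triangle_pred] at h1
  omega

end Selection

section Greedy

variable {k : Type} [Field k] {f g₁ g₂ : R4 k} {a : ℕ}

/-- A family on which forms of degree `d` impose at least `m` conditions contains `m` points with
independent conditions. -/
theorem exists_interpolates_comp {ι : Type} [Finite ι] {u : ι → Fin 4 → k} {d m : ℕ}
    (h : m ≤ Module.finrank k ((forms k d).map (evalFamily u))) :
    ∃ s : Fin m → ι, Interpolates (fun i => u (s i)) d := by
  induction m with
  | zero => exact ⟨Fin.elim0, fun c => ⟨0, isHomogeneous_zero _ _ _, fun i => i.elim0⟩⟩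
  | succ m ih =>
    obtain ⟨s, hs⟩ := ih (Nat.le_of_succ_le h)
    have h1 := finrank_map_add_finrank_inf_ker (LinearMap.funLeft k k s)
      ((forms k d).map (evalFamily u))
    have h2 := Submodule.finrank_le (((forms k d).map (evalFamily u)).map (LinearMap.funLeft k k s))
    rw [Module.finrank_fintype_fun_eq_card, Fintype.card_fin] at h2
    have h3 : ((forms k d).map (evalFamily u) ⊓ LinearMap.ker (LinearMap.funLeft k k s)) ≠ ⊥ :=
      fun h0 => by
        rw [h0, finrank_bot] at h1
        omega
    obtain ⟨_, ⟨⟨q, hq, rfl⟩, hq0⟩, hne⟩ := Submodule.exists_mem_ne_zero_of_ne_bot h3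
    have hq : q.IsHomogeneous d := hq
    have hqs : ∀ i, eval (u (s i)) q = 0 := fun i => by
      simpa [evalFamily_apply] using congrFun (LinearMap.mem_ker.mp hq0) i
    obtain ⟨j, hj⟩ := Function.ne_iff.mp hne
    rw [evalFamily_apply, Pi.zero_apply] at hj
    refine ⟨Fin.cons j s, fun c => ?_⟩
    obtain ⟨p, hp, hpc⟩ := hs fun i => c i.succ
    refine ⟨p + C ((c 0 - eval (u j) p) / eval (u j) q) * q, hp.add ?_, fun i => ?_⟩
    · simpa using (isHomogeneous_C (Fin 4) _).mul hq
    · refine Fin.cases ?_ (fun i => ?_) i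
      · simp [hj]
      · simp [hqs, hpc]

/-- A transversal complete intersection of type `(3, a, a)` contains many points imposing
independent conditions on forms of degree `a`. -/
theorem TransversalCI.exists_interpolates [IsAlgClosed k] (hG : TransversalCI f g₁ g₂ a)
    (ha : 1 ≤ a) : ∃ u : Fin (3 * (a * (a - 1) / 2) + a) → Fin 4 → k, Interpolates u a ∧
      VanishesOn u f ∧ VanishesOn u g₁ ∧ VanishesOn u g₂ := by
  have := hG.finite_commonZeros.to_subtype
  obtain ⟨s, hs⟩ := exists_interpolates_comp (hG.le_finrank_map_evalFamily
    (u := fun p : commonZeros f g₁ g₂ => p.1.rep) (fun p => p.2.1) ha fun z hz h0 h1 h2 => by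
      obtain ⟨t, ht⟩ := exists_smul_of_mk_eq (hz := hz)
        (hw := Projectivization.rep_nonzero _) (Projectivization.mk_rep _).symm
      exact ⟨⟨_, hG.mk_mem_commonZeros hz h0 h1 h2⟩, t, ht⟩)
  exact ⟨_, hs, fun i => (s i).2.1, fun i => (s i).2.2.1, fun i => (s i).2.2.2⟩

end Greedy

section Deformation

variable {k : Type} [Field k] {m a : ℕ}

/-- The values of the polynomials `h p` at a variable family of `m` points. -/
noncomputable def valueMatrix (h : Fin m → R4 k) :
    Matrix (Fin m) (Fin m) (MvPolynomial (Fin m × Fin 4) k) :=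
  Matrix.of fun q p => rename (Prod.mk q) (h p)

/-- The values of `g` at a variable family of `m` points. -/
noncomputable def valueVec (m : ℕ) (g : R4 k) : Fin m → MvPolynomial (Fin m × Fin 4) k :=
  fun q => rename (Prod.mk q) g

/-- The modification of `g` by a combination of the `h p` which vanishes at a variable family of
`m` points. -/
noncomputable def deform (h : Fin m → R4 k) (g : R4 k) :
    MvPolynomial (Fin 4) (MvPolynomial (Fin m × Fin 4) k) :=
  C (valueMatrix h).det * map C g -
    ∑ p, C (((valueMatrix h).adjugate.mulVec (valueVec m g)) p) * map C (h p)

theorem mapMatrix_valueMatrix (h : Fin m → R4 k) (x : Fin m × Fin 4 → k) (q p : Fin m) :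
    (eval x).mapMatrix (valueMatrix h) q p = eval (fun i => x (q, i)) (h p) :=
  eval_rename _ _ _

theorem mapMatrix_valueMatrix_of_dual {h : Fin m → R4 k} {u : Fin m → Fin 4 → k}
    (hh : ∀ q p, eval (u q) (h p) = (1 : Matrix (Fin m) (Fin m) k) q p) :
    (eval fun q => u q.1 q.2).mapMatrix (valueMatrix h) = 1 :=
  Matrix.ext fun q p => (mapMatrix_valueMatrix h _ q p).trans (hh q p)

theorem deform_isHomogeneous {h : Fin m → R4 k} {g : R4 k} (hh : ∀ p, (h p).IsHomogeneous a)
    (hg : g.IsHomogeneous a) : (deform h g).IsHomogeneous a := by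
  have hC : ∀ (c : MvPolynomial (Fin m × Fin 4) k) {p : R4 k}, p.IsHomogeneous a →
      (C c * map C p : MvPolynomial (Fin 4) _).IsHomogeneous a := fun c p hp => by
    simpa using (isHomogeneous_C (Fin 4) c).mul (hp.map C)
  exact (hC _ hg).sub (IsHomogeneous.sum _ _ _ fun p _ => hC _ (hh p))

theorem map_eval_map_C (x : Fin m × Fin 4 → k) (p : R4 k) : map (eval x) (map C p) = p := by
  rw [map_map]
  convert map_id p
  ext; simp

theorem map_deform (h : Fin m → R4 k) (g : R4 k) (x : Fin m × Fin 4 → k) :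
    map (eval x) (deform h g) = C (eval x (valueMatrix h).det) * g -
      ∑ p, C (eval x (((valueMatrix h).adjugate.mulVec (valueVec m g)) p)) * h p := by
  simp only [deform, map_sub, map_mul, map_sum, map_C, map_eval_map_C]

theorem eval_map_deform (h : Fin m → R4 k) (g : R4 k) (x : Fin m × Fin 4 → k) (q : Fin m) :
    eval (fun i => x (q, i)) (map (eval x) (deform h g)) = 0 := by
  have h1 : (valueMatrix h).mulVec ((valueMatrix h).adjugate.mulVec (valueVec m g)) q =
      (valueMatrix h).det * valueVec m g q := by
    rw [Matrix.mulVec_mulVec, Matrix.mul_adjugate, Matrix.smul_mulVec, Matrix.one_mulVec]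
    rfl
  rw [map_deform]
  generalize (valueMatrix h).adjugate.mulVec (valueVec m g) = w at h1 ⊢
  have h2 : ∑ p, eval (fun i => x (q, i)) (h p) * eval x (w p) =
      eval x (valueMatrix h).det * eval (fun i => x (q, i)) g := by
    have := congrArg (eval x) h1
    simp only [Matrix.mulVec, dotProduct, map_sum, map_mul, valueVec, eval_rename] at this
    refine Eq.trans ?_ this
    exact Finset.sum_congr rfl fun p _ => by
      rw [← mapMatrix_valueMatrix, RingHom.mapMatrix_apply, Matrix.map_apply]
  simp only [map_sub, map_mul, map_sum, eval_C]
  rw [← h2, sub_eq_zero]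
  exact Finset.sum_congr rfl fun p _ => mul_comm _ _

theorem map_deform_of_dual {h : Fin m → R4 k} {g : R4 k} {u : Fin m → Fin 4 → k}
    (hh : ∀ q p, eval (u q) (h p) = (1 : Matrix (Fin m) (Fin m) k) q p) (hg : VanishesOn u g) :
    map (eval fun q => u q.1 q.2) (deform h g) = g := by
  rw [map_deform]
  have hb : ∀ p, eval (fun q => u q.1 q.2) ((valueMatrix h).adjugate.mulVec (valueVec m g) p) = 0 :=
    fun p => by
      rw [Matrix.mulVec, dotProduct, map_sum]
      exact Finset.sum_eq_zero fun q _ => by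
        rw [map_mul, valueVec, eval_rename]
        exact mul_eq_zero_of_right _ (hg q)
  rw [RingHom.map_det, mapMatrix_valueMatrix_of_dual hh]
  simp [hb]

/-- Interpolation is an open condition. -/
theorem interpolates_of_det_ne_zero {h : Fin m → R4 k} (hh : ∀ p, (h p).IsHomogeneous a)
    {x : Fin m × Fin 4 → k} (hx : eval x (valueMatrix h).det ≠ 0) :
    Interpolates (fun q i => x (q, i)) a := by
  intro c
  rw [RingHom.map_det] at hx
  set M := (eval x).mapMatrix (valueMatrix h) with hM
  have hu : IsUnit M.det := isUnit_iff_ne_zero.mpr hx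
  refine ⟨∑ p, C (M⁻¹.mulVec c p) * h p, IsHomogeneous.sum _ _ _ fun p _ => ?_, fun q => ?_⟩
  · simpa using (isHomogeneous_C (Fin 4) _).mul (hh p)
  · have h1 : M.mulVec (M⁻¹.mulVec c) q = c q := by
      rw [Matrix.mulVec_mulVec, Matrix.mul_nonsing_inv _ hu, Matrix.one_mulVec]
    rw [← h1, map_sum]
    refine Finset.sum_congr rfl fun p _ => ?_
    rw [map_mul, eval_C, mul_comm, ← mapMatrix_valueMatrix]

/-- Nearby families of points imposing independent conditions lie on a transversal complete
intersection as well. -/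
theorem TransversalCI.eventually [IsAlgClosed k] {f g₁ g₂ : R4 k} (hG : TransversalCI f g₁ g₂ a)
    {u : Fin m → Fin 4 → k} (hu : Interpolates u a) (h₁ : VanishesOn u g₁) (h₂ : VanishesOn u g₂) :
    ∀ᶠ x : Fin m × Fin 4 → k in zariskiNhds fun q => u q.1 q.2,
      Interpolates (fun q i => x (q, i)) a ∧ ∃ g₁ g₂, TransversalCI f g₁ g₂ a ∧
        VanishesOn (fun q i => x (q, i)) g₁ ∧ VanishesOn (fun q i => x (q, i)) g₂ := by
  choose h hh hhu using fun p => hu fun q => (1 : Matrix (Fin m) (Fin m) k) q p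
  have hd₁ := map_deform_of_dual (fun q p => hhu p q) h₁
  have hd₂ := map_deform_of_dual (fun q p => hhu p q) h₂
  have hdet : ∀ᶠ x : Fin m × Fin 4 → k in zariskiNhds fun q => u q.1 q.2,
      eval x (valueMatrix h).det ≠ 0 := eventually_eval_ne_zero (by
    rw [RingHom.map_det, mapMatrix_valueMatrix_of_dual fun q p => hhu p q, Matrix.det_one]
    exact one_ne_zero)
  have hndvd : ∀ g : R4 k, ¬ f ∣ g → map (eval fun q => u q.1 q.2) (deform h g) = g →
      ∀ᶠ x : Fin m × Fin 4 → k in zariskiNhds fun q => u q.1 q.2,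
        ¬ f ∣ map (eval x) (deform h g) := fun g hg hgu => by
    obtain ⟨z, hz, hzg⟩ := exists_zero_eval_ne_zero hG.prime hg
    have key : ∀ x, eval x (eval (fun i => C (z i)) (deform h g)) =
        eval z (map (eval x) (deform h g)) := fun x => by
      rw [eval_map, ← RingHom.comp_id (eval x)]
      refine (eval₂_comp_left (eval x) (RingHom.id _) _ _).trans ?_
      congr 1
      ext i
      simp
    refine (eventually_eval_ne_zero (g := eval (fun i => C (z i)) (deform h g))
      (by rwa [key, hgu])).mono fun x hx ⟨r, hr⟩ => hx ?_
    rw [key, hr, map_mul, hz, zero_mul]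
  filter_upwards [hdet, hndvd g₁ hG.n₁ hd₁, hndvd g₂ hG.n₂ hd₂,
    eventually_no_common_zero _ (transversalForms (map C f) (deform h g₁) (deform h g₂)) _
      (transversalForms_isHomogeneous (hG.hf.map C) (deform_isHomogeneous hh hG.h₁)
        (deform_isHomogeneous hh hG.h₂)) (by
      simp only [map_transversalForms, map_eval_map_C, hd₁, hd₂]
      exact forall_linearIndependent_iff.mp hG.jac)] with x hx hx₁ hx₂ hx₃
  simp only [map_transversalForms, map_eval_map_C] at hx₃
  exact ⟨interpolates_of_det_ne_zero hh hx, _, _, ⟨hG.prime, hG.hf,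
    (deform_isHomogeneous hh hG.h₁).map _, (deform_isHomogeneous hh hG.h₂).map _, hx₁, hx₂,
    forall_linearIndependent_iff.mpr hx₃⟩, eval_map_deform h g₁ x, eval_map_deform h g₂ x⟩

end Deformation

section GeneralConfigurations

variable {k : Type} [Field k]

theorem Interpolates.ne_zero {ι : Type} {v : ι → Fin 4 → k} {a : ℕ} (hv : Interpolates v a)
    (ha : 1 ≤ a) (i : ι) : v i ≠ 0 := fun h => by
  obtain ⟨p, hp, hpv⟩ := hv fun _ => 1
  have h1 := hpv i
  rw [h, ← zero_smul k (0 : Fin 4 → k), eval_smul_of_isHomogeneous hp, zero_pow (by omega),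
    zero_mul] at h1
  exact zero_ne_one h1

variable {t : ℕ} {Z : Fin t → P3 k} {v : Fin t → Fin 4 → k} {S : SmoothCubicSurface k}

theorem Represents.configOn (h : Represents v Z) {a : ℕ} (hv : Interpolates v a)
    (hf : VanishesOn v S.f) : ConfigOn k S Z := by
  refine ⟨fun i j hij => ?_, fun i => (h.vanishesAt_iff S.homog i).mpr (hf i)⟩
  by_contra hne
  obtain ⟨hi, hi'⟩ := h i
  obtain ⟨hj, hj'⟩ := h j
  obtain ⟨c, hc⟩ := exists_smul_of_mk_eq (hi'.trans (hij.trans hj'.symm))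
  exact hv.ne_smul hne c hc

theorem SmoothCubicSurface.gradAt_ne_zero (S : SmoothCubicSurface k) (z : Fin 4 → k) (hz : z ≠ 0)
    (h0 : eval z S.f = 0) : gradAt S.f z ≠ 0 := fun h => by
  obtain ⟨i, hi⟩ := S.smooth z hz h0
  exact hi (congrFun h i)

/-- If `P` holds for general points, it holds for some points in independent position on a
transversal complete intersection of type `(3, a, a)`. -/
theorem GeneralPointsSatisfy.exists_on_transversalCI [IsAlgClosed k] {a : ℕ} (ha : 1 ≤ a)
    {P : (Fin (3 * (a * (a - 1) / 2) + a) → P3 k) → Prop} (h : GeneralPointsSatisfy k S _ P) :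
    ∃ Z v, Represents v Z ∧ P Z ∧ VanishesOn v S.f ∧ Interpolates v a ∧
      ∃ g₁ g₂, TransversalCI S.f g₁ g₂ a ∧ VanishesOn v g₁ ∧ VanishesOn v g₂ := by
  obtain ⟨gR, ⟨Z₀, hZ₀, v₀, hv₀, hgv₀⟩, hP⟩ := h
  obtain ⟨g₁, g₂, hG⟩ := exists_transversalCI S.irred.prime S.homog S.gradAt_ne_zero a
  obtain ⟨u, hu, huf, hu₁, hu₂⟩ := hG.exists_interpolates ha
  obtain ⟨gG, hgu, hgG⟩ := eventually_zariskiNhds.mp (hG.eventually hu hu₁ hu₂)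
  obtain ⟨v, hvf, hvR, hvG⟩ := (zariskiIrreducible_zeroLocus S.irred).pi
    (fun p => (Represents.vanishesAt_iff hv₀ S.homog p).mp (hZ₀.2 p)) huf hgv₀ hgu
  obtain ⟨hv, hG'⟩ := hgG _ hvG
  have hv0 := hv.ne_zero ha
  have hrep : Represents v fun i => Projectivization.mk k (v i) (hv0 i) := fun i => ⟨hv0 i, rfl⟩
  exact ⟨_, v, hrep, hP _ (hrep.configOn hv hvf) ⟨v, hrep, hvR⟩, hvf, hv, hG'⟩

end GeneralConfigurations

/-- First link.  If a general set of `m(a)` points on `X` has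
`0 → R(-a-3)^(a-1) → R(-a-1)^(3a) → R(-a)^(2a+1) → I_(Z,X) → 0` as graded minimal free
resolution over `R`, then a general set of `n(a)` points on `X` has graded minimal free
resolution `0 → R(-a-3)^(2a-1) → R(-a-2)^(3a) → R(-a)^(a+1) → I_(Z,X) → 0`. -/
theorem first_link (k : Type) [Field k] [IsAlgClosed k]
    (S : SmoothCubicSurface k) (a : ℕ) (ha : 1 ≤ a)
    (hyp : GeneralPointsSatisfy k S (3 * (a * (a - 1) / 2) + a) (fun Z =>
      HasMinFreeRes3 k (Ideal.span {S.f}) (pointsIdeal k (Set.range Z))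
        (fun _ : Fin (2 * a + 1) => a) (fun _ : Fin (3 * a) => a + 1) (fun _ : Fin (a - 1) => a + 3))) :
    GeneralPointsSatisfy k S (3 * (a * (a - 1) / 2) + 2 * a) (fun Z =>
      HasMinFreeRes3 k (Ideal.span {S.f}) (pointsIdeal k (Set.range Z))
        (fun _ : Fin (a + 1) => a) (fun _ : Fin (3 * a) => a + 2) (fun _ : Fin (2 * a - 1) => a + 3)) := by
  have : Infinite k := IsAlgClosed.instInfinite
  obtain ⟨Z, v, hvZ, ⟨g, M2, M3, hres⟩, hvf, hv, g₁, g₂, hG, hv₁, hv₂⟩ :=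
    hyp.exists_on_transversalCI ha
  obtain rfl | ha2 : a = 1 ∨ 2 ≤ a := by omega
  · exact absurd hres not_res3Body_linear
  have hex := Res3Body.koszulExact₁ S.homog (fun p d hp => hvZ.mem_pointsIdeal_iff hp) hres
  obtain ⟨W, hW, hWf, hWK⟩ := hG.exists_residual ha2 (hv.ne_zero ha) hvf hv₁ hv₂ hv hex
  have hWrep : Represents (fun i => (W i).rep) W := fun i =>
    ⟨(W i).rep_nonzero, (W i).mk_rep⟩
  obtain ⟨gK, hgW, hgK⟩ := eventually_zariskiNhds.mp hWK.eventually
  refine ⟨gK, ⟨W, ⟨hW, fun i => (hWrep.vanishesAt_iff S.homog i).mpr (hWf i)⟩, _, hWrep, hgW⟩, ?_⟩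
  rintro Z hZ ⟨w, hw : Represents w Z, hgw⟩
  have hwf : VanishesOn w S.f := fun i => (hw.vanishesAt_iff S.homog i).mp (hZ.2 i)
  exact (hgK _ hgw hwf).hasMinFreeRes3 S.irred.prime S.homog (fun i => (hw i).1) hwf
    (Fintype.card_fin _) ha (fun p d hp => hw.mem_pointsIdeal_iff hp)
    fun p hp d q hq => (hp q hq).homogeneousComponent d
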